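/- Let (c(n))_{n≥0} be the coefficient sequence of a quasimodular form for SL₂(ℤ), i.e., c(n) = E(n) + S(n) for all n ≥ 0, where (E(n)) is the coefficient sequence of a quasimodular Eisenstein series and (S(n)) is the coefficient sequence of a quasimodular cusp form (complex coefficients allowed). If c(p) = 0 for every prime p, then S(n) = 0 for all n ≥ 0; in other words, every quasimodular form vanishing at all primes is a quasimodular Eisenstein series (Ω̃ = 𝓔 ∩ Ω̃). -/

import Mathlib

open Complex Filter Finset

noncomputable section

/-- `a` is the Fourier coefficient sequence of the cusp form `f` of weight `k` for `SL₂(ℤ)`: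
`f(τ) = Σ_{n ≥ 1} a(n) e^{2πinτ}` (with `a 0 = 0`). -/
def CuspFormCoeffs (k : ℤ) (f : CuspForm (CongruenceSubgroup.Gamma 1) k) (a : ℕ → ℂ) : Prop :=
  a 0 = 0 ∧ ∀ τ : UpperHalfPlane,
    Summable (fun n : ℕ => a n * Complex.exp (2 * (Real.pi : ℂ) * Complex.I * (n : ℂ) * (τ : ℂ))) ∧
    f τ = ∑' n : ℕ, a n * Complex.exp (2 * (Real.pi : ℂ) * Complex.I * (n : ℂ) * (τ : ℂ))

/-- `S` is the coefficient sequence of a quasimodular cusp form for `SL₂(ℤ)`, i.e. of a linear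
combination of cusp forms and their iterated derivatives under `D = q d/dq`. -/
def IsQuasiCuspCoeff (S : ℕ → ℂ) : Prop :=
  ∃ (m : ℕ) (A : Fin m → ℂ) (j : Fin m → ℕ) (k : Fin m → ℤ)
    (f : ∀ i, CuspForm (CongruenceSubgroup.Gamma 1) (k i)) (a : Fin m → ℕ → ℂ),
    (∀ i, CuspFormCoeffs (k i) (f i) (a i)) ∧ S 0 = 0 ∧
      ∀ n : ℕ, 1 ≤ n → S n = ∑ i, A i * (n : ℂ) ^ (j i) * a i n

/-- `E` is the coefficient sequence of a quasimodular Eisenstein series, i.e. of a linear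
combination of the Eisenstein series `G_k` and their iterated derivatives under `D = q d/dq`. -/
def IsQuasiEisCoeff (E : ℕ → ℂ) : Prop :=
  ∃ (s : Finset (ℕ × ℕ)) (α : ℕ × ℕ → ℂ),
    (∀ p ∈ s, 2 ≤ p.1 ∧ Even p.1) ∧
    E 0 = ∑ p ∈ s.filter (fun p => p.2 = 0), α p * (bernoulli p.1 : ℂ) / (2 * (p.1 : ℂ)) ∧
    ∀ n : ℕ, 1 ≤ n →
      E n = ∑ p ∈ s, α p * (n : ℂ) ^ p.2 * ((ArithmeticFunction.sigma (p.1 - 1) n : ℕ) : ℂ)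

/-! ## Theta kernels -/

namespace QMF

open scoped Real Topology

lemma HasSum.of_eq {ι α : Type*} [AddCommMonoid α] [TopologicalSpace α] {f g : ι → α} {a b : α}
    (h : HasSum f a) (hfg : ∀ i, g i = f i) (hab : b = a) : HasSum g b := by
  rw [hab, funext hfg]; exact h

/-- A Gaussian beats any power. -/
lemma exists_exp_quadratic_le {a : ℝ} (ha : 0 < a) (b : ℝ) (N : ℕ) :
    ∃ C : ℝ, 0 < C ∧ ∀ x : ℝ, 0 ≤ x → Real.exp (b * x - a * x ^ 2) * x ^ N ≤ C := by
  refine ⟨N.factorial * Real.exp ((b + 1) ^ 2 / (4 * a)), by positivity, fun x hx ↦ ?_⟩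
  have h1 : x ^ N ≤ N.factorial * Real.exp x := by
    have := Real.pow_div_factorial_le_exp x hx N
    rwa [div_le_iff₀ (by positivity), mul_comm] at this
  calc _ ≤ Real.exp (b * x - a * x ^ 2) * (N.factorial * Real.exp x) := by gcongr
    _ = N.factorial * Real.exp ((b + 1) * x - a * x ^ 2) := by
      rw [mul_left_comm, ← Real.exp_add]; ring_nf
    _ ≤ _ := by
      gcongr
      rw [le_div_iff₀ (by positivity)]
      nlinarith [sq_nonneg (b + 1 - 2 * a * x)]

/-- The linear form `v₀ z + v₁`. -/
def lin (v : Fin 2 → ℤ) (z : ℂ) : ℂ := v 0 * z + v 1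

lemma norm_lin_conj (v : Fin 2 → ℤ) (z : ℂ) :
    ‖lin v (starRingEnd ℂ z)‖ = ‖lin v z‖ := by
  rw [← Complex.norm_conj (lin v z)]
  simp [lin]

lemma normSq_lin (v : Fin 2 → ℤ) (z : ℂ) :
    ‖lin v z‖ ^ 2 = (v 0 * z.re + v 1) ^ 2 + (v 0 * z.im) ^ 2 := by
  rw [Complex.sq_norm, Complex.normSq_apply]
  simp [lin]; ring

lemma summable_of_norm_le_rpow {f : (Fin 2 → ℤ) → ℂ} {C : ℝ}
    (h : ∀ v ≠ 0, ‖f v‖ ≤ C * ‖v‖ ^ (-3 : ℝ)) : Summable f := by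
  rw [← summable_norm_iff]
  have hs : Summable fun v : Fin 2 → ℤ ↦ ‖f 0‖ * (if v = 0 then 1 else 0) + C * ‖v‖ ^ (-3 : ℝ) := by
    refine Summable.add ?_ ?_
    · exact (summable_of_ne_finset_zero (s := {0}) (by simp +contextual))
    · exact (EisensteinSeries.summable_one_div_norm_rpow (by norm_num)).mul_left C
  refine Summable.of_nonneg_of_le (fun _ ↦ norm_nonneg _) (fun v ↦ ?_) hs
  by_cases hv : v = 0
  · subst hv; simp
  · simpa [hv] using h v hv

lemma one_le_norm_of_ne_zero {v : Fin 2 → ℤ} (hv : v ≠ 0) : 1 ≤ ‖v‖ := by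
  rw [EisensteinSeries.norm_eq_max_natAbs]
  norm_cast
  rw [Nat.one_le_iff_ne_zero]
  intro h
  apply hv
  ext i
  fin_cases i <;> simp <;> omega

/-- Summability of `exp (b |vz| - a |vz|²)`. -/
lemma summable_exp_lin (z : UpperHalfPlane) {a : ℝ} (ha : 0 < a) (b : ℝ) :
    Summable fun v : Fin 2 → ℤ ↦ Real.exp (b * ‖lin v z‖ - a * ‖lin v z‖ ^ 2) := by
  obtain ⟨C, hC, h⟩ := exists_exp_quadratic_le ha b 3
  have hr := EisensteinSeries.r_pos z
  suffices H : Summable fun v : Fin 2 → ℤ ↦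
      ((Real.exp (b * ‖lin v z‖ - a * ‖lin v z‖ ^ 2) : ℝ) : ℂ) by exact_mod_cast H
  refine summable_of_norm_le_rpow (C := C / EisensteinSeries.r z ^ 3) fun v hv ↦ ?_
  have hv1 := one_le_norm_of_ne_zero hv
  have h1 := EisensteinSeries.r_mul_max_le z hv
  have h2 := h ‖lin v z‖ (norm_nonneg _)
  change _ ≤ ‖lin v z‖ at h1
  have h3 : 0 < ‖lin v z‖ := lt_of_lt_of_le (by positivity) h1
  rw [Complex.norm_real, Real.norm_of_nonneg (Real.exp_pos _).le,
    show (-3 : ℝ) = -((3 : ℕ) : ℝ) by norm_num, Real.rpow_neg (by positivity), Real.rpow_natCast,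
    ← div_eq_mul_inv, div_div, ← mul_pow, le_div_iff₀ (by positivity)]
  refine le_trans ?_ h2
  gcongr

/-- The theta kernel with spherical polynomial `v ↦ (v z̄)^h`. -/
def thetaTerm (h : ℕ) (z : UpperHalfPlane) (t : ℝ) (v : Fin 2 → ℤ) : ℂ :=
  lin v (starRingEnd ℂ (z : ℂ)) ^ h * Real.exp (-π * t * ‖lin v z‖ ^ 2 / z.im)

def thetaKernel (h : ℕ) (z : UpperHalfPlane) (t : ℝ) : ℂ := ∑' v, thetaTerm h z t v

def genTerm (u : ℂ) (z : UpperHalfPlane) (t : ℝ) (v : Fin 2 → ℤ) : ℂ :=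
  cexp (-π * t * ‖lin v z‖ ^ 2 / z.im + 2 * π * I * u * lin v (starRingEnd ℂ (z : ℂ)))

def genKernel (u : ℂ) (z : UpperHalfPlane) (t : ℝ) : ℂ := ∑' v, genTerm u z t v

lemma norm_genTerm_le (u : ℂ) (z : UpperHalfPlane) (t : ℝ) (v : Fin 2 → ℤ) :
    ‖genTerm u z t v‖ ≤
      Real.exp (2 * π * ‖u‖ * ‖lin v z‖ - (π * t / z.im) * ‖lin v z‖ ^ 2) := by
  rw [genTerm, Complex.norm_exp, Real.exp_le_exp, Complex.add_re]
  have h1 : (2 * π * I * u * lin v (starRingEnd ℂ (z : ℂ))).re ≤ 2 * π * ‖u‖ * ‖lin v z‖ := by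
    refine (Complex.re_le_norm _).trans ?_
    simp [norm_lin_conj, abs_of_pos Real.pi_pos]
  have h2 : (-π * t * ‖lin v z‖ ^ 2 / z.im : ℂ).re = -(π * t / z.im) * ‖lin v z‖ ^ 2 := by
    rw [show (-π * t * ‖lin v z‖ ^ 2 / z.im : ℂ) = ((-(π * t / z.im) * ‖lin v z‖ ^ 2 : ℝ) : ℂ) by
      push_cast; ring, Complex.ofReal_re]
  linarith

lemma summable_genTerm (u : ℂ) (z : UpperHalfPlane) {t : ℝ} (ht : 0 < t) :
    Summable (genTerm u z t) := by
  have := z.im_pos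
  exact (summable_exp_lin z (a := π * t / z.im) (by positivity) (2 * π * ‖u‖)).of_norm_bounded
    (norm_genTerm_le u z t)

/-- Expansion of the generating kernel in powers of `u`. -/
lemma hasSum_genKernel (u : ℂ) (z : UpperHalfPlane) {t : ℝ} (ht : 0 < t) :
    HasSum (fun h : ℕ ↦ ((2 * π * I) ^ h / h.factorial * thetaKernel h z t) * u ^ h)
      (genKernel u z t) ∧ ∀ h, Summable (thetaTerm h z t) := by
  have := z.im_pos
  set F : ((Fin 2 → ℤ) × ℕ) → ℂ := fun p ↦
    (2 * π * I * u) ^ p.2 / p.2.factorial * thetaTerm p.2 z t p.1 with hF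
  have hexp (w : ℂ) (v : Fin 2 → ℤ) : HasSum (fun h : ℕ ↦ (2 * π * I * w) ^ h / h.factorial *
      thetaTerm h z t v) (genTerm w z t v) := by
    have := (NormedSpace.expSeries_div_hasSum_exp (2 * π * I * w *
      lin v (starRingEnd ℂ (z : ℂ)))).mul_left (cexp (-π * t * ‖lin v z‖ ^ 2 / z.im))
    rw [← Complex.exp_eq_exp_ℂ, ← Complex.exp_add] at this
    refine HasSum.of_eq this (fun h ↦ ?_) rfl
    rw [thetaTerm, mul_pow]; push_cast; ring
  have hexpn (w : ℂ) (v : Fin 2 → ℤ) : HasSum (fun h : ℕ ↦ ‖(2 * π * I * w) ^ h / h.factorial *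
      thetaTerm h z t v‖) (Real.exp (2 * π * ‖w‖ * ‖lin v z‖ - (π * t / z.im) *
          ‖lin v z‖ ^ 2)) := by
    have := (NormedSpace.expSeries_div_hasSum_exp (2 * π * ‖w‖ *
      ‖lin v z‖)).mul_left (Real.exp (-(π * t / z.im) * ‖lin v z‖ ^ 2))
    rw [← Real.exp_eq_exp_ℝ, ← Real.exp_add] at this
    refine HasSum.of_eq this (fun h ↦ ?_) ?_
    · rw [thetaTerm, norm_mul, norm_mul, norm_div, norm_pow, norm_pow, norm_lin_conj,
        Complex.norm_real, Real.norm_of_nonneg (Real.exp_pos _).le]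
      simp only [norm_mul, Complex.norm_ofNat, Complex.norm_real, norm_I, mul_one,
        Real.norm_of_nonneg Real.pi_pos.le, RCLike.norm_natCast]
      rw [show -(π * t / z.im) * ‖lin v z‖ ^ 2 = -π * t * ‖lin v z‖ ^ 2 / z.im by ring]
      ring
    · congr 1; ring
  have hsumm (w : ℂ) : Summable fun p : (Fin 2 → ℤ) × ℕ ↦
      (2 * π * I * w) ^ p.2 / p.2.factorial * thetaTerm p.2 z t p.1 := by
    rw [← summable_norm_iff, summable_prod_of_nonneg (fun _ ↦ norm_nonneg _)]
    refine ⟨fun v ↦ (hexpn w v).summable, ?_⟩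
    simp_rw [(hexpn w _).tsum_eq]
    exact summable_exp_lin z (by positivity) _
  constructor
  · have h1 := (hsumm u).hasSum
    have h2 : ∑' p : (Fin 2 → ℤ) × ℕ, (2 * π * I * u) ^ p.2 / p.2.factorial * thetaTerm p.2 z t p.1
        = genKernel u z t := by
      rw [(hsumm u).tsum_prod, genKernel]
      exact tsum_congr fun v ↦ (hexp u v).tsum_eq
    rw [h2] at h1
    have h3 := ((Equiv.prodComm ℕ (Fin 2 → ℤ)).hasSum_iff.mpr h1).prod_fiberwise
      (g := fun h : ℕ ↦ ((2 * π * I) ^ h / h.factorial * thetaKernel h z t) * u ^ h) fun h ↦ ?_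
    · exact h3
    · have h4 := ((hsumm u).prod_symm.prod_factor h)
      have h5 : ((2 * π * I) ^ h / h.factorial * thetaKernel h z t) * u ^ h
        = ∑' v, (2 * π * I * u) ^ h / h.factorial * thetaTerm h z t v := by
        rw [tsum_mul_left, thetaKernel, mul_pow]; ring
      rw [h5]
      exact h4.hasSum
  · intro h
    have h4 := ((hsumm 1).prod_symm.prod_factor h)
    have hne : (2 * π * I * (1 : ℂ)) ^ h / (h.factorial : ℂ) ≠ 0 := by
      simp [Real.pi_ne_zero, Nat.factorial_ne_zero]
    exact (summable_mul_left_iff hne).mp h4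

end QMF

/-! ## Modular transformation of theta kernels -/

namespace QMF

open scoped Real Topology

def thetaMid (u : ℂ) (z : UpperHalfPlane) (t : ℝ) (m n : ℤ) : ℂ :=
  cexp (-π * t * z.im * m ^ 2 + 2 * π * u * m * z.im - π * n ^ 2 * z.im / t +
    2 * π * I * n * (m * z.re - I * u * z.im / t))

lemma summable_thetaMid (u : ℂ) (z : UpperHalfPlane) {t : ℝ} (ht : 0 < t) :
    Summable fun p : ℤ × ℤ ↦ thetaMid u z t p.1 p.2 := by
  have hz := z.im_pos
  have h1 : Summable (jacobiTheta₂_term · (-I * u * z.im) (I * t * z.im)) := by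
    rw [summable_jacobiTheta₂_term_iff]; simp; positivity
  have h2 : Summable (jacobiTheta₂_term · (-I * u * z.im / t) (I * z.im / t)) := by
    rw [summable_jacobiTheta₂_term_iff]
    rw [show (I * z.im / t : ℂ) = I * ((z.im / t : ℝ) : ℂ) by push_cast; ring]
    simp; positivity
  have := (h1.norm.mul_of_nonneg h2.norm (fun _ ↦ norm_nonneg _) (fun _ ↦ norm_nonneg _))
  refine Summable.of_norm_bounded this fun p ↦ le_of_eq ?_
  have e : thetaMid u z t p.1 p.2 = jacobiTheta₂_term p.1 (-I * u * z.im) (I * t * z.im) *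
      jacobiTheta₂_term p.2 (-I * u * z.im / t) (I * z.im / t) *
      cexp ((2 * π * p.2 * p.1 * z.re : ℝ) * I) := by
    rw [thetaMid, jacobiTheta₂_term, jacobiTheta₂_term, ← Complex.exp_add, ← Complex.exp_add]
    congr 1
    push_cast
    have := Complex.I_sq
    linear_combination (2 * π * p.1 * u * z.im - π * p.1 ^ 2 * t * z.im - π * p.2 ^ 2 *
        z.im / t : ℂ) * this
  rw [e, norm_mul, norm_mul, Complex.norm_exp_ofReal_mul_I, mul_one]

lemma sq_norm_lin_cast (z : UpperHalfPlane) (m n : ℤ) :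
    ((‖lin ![m, n] z‖ : ℝ) : ℂ) ^ 2 = (m * z.re + n) ^ 2 + (m * z.im) ^ 2 := by
  have := normSq_lin ![m, n] z
  exact_mod_cast this

lemma genKernel_eq_tsum_prod (u : ℂ) (z : UpperHalfPlane) {t : ℝ} (ht : 0 < t) :
    genKernel u z t = ∑' m : ℤ, ∑' n : ℤ, genTerm u z t ![m, n] := by
  rw [genKernel, ← (finTwoArrowEquiv ℤ).symm.tsum_eq]
  exact ((finTwoArrowEquiv ℤ).symm.summable_iff.mpr (summable_genTerm u z ht)).tsum_prod

lemma conj_coe (z : UpperHalfPlane) :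
    (starRingEnd ℂ (z : ℂ)) = z.re - z.im * I := by
  apply Complex.ext <;> simp

lemma tsum_genTerm_inner (u : ℂ) (z : UpperHalfPlane) {t : ℝ} (ht : 0 < t) (m : ℤ) :
    ∑' n : ℤ, genTerm u z t ![m, n] = 1 / (t / z.im : ℂ) ^ (1 / 2 : ℂ) *
      cexp (-π * u ^ 2 * z.im / t) * ∑' n : ℤ, thetaMid u z t m n := by
  have hz := z.im_pos
  have hz' : (z.im : ℂ) ≠ 0 := by exact_mod_cast hz.ne'
  have ht' : (t : ℂ) ≠ 0 := by exact_mod_cast ht.ne'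
  have key := jacobiTheta₂_functional_equation (u + (I * t / z.im) * m * z.re) (I * t / z.im)
  have hI := Complex.I_sq
  rw [show (-I * (I * t / z.im) : ℂ) = t / z.im by field_simp; linear_combination -hI] at key
  have e1 : ∑' n : ℤ, genTerm u z t ![m, n] =
      cexp (-π * t * ((m * z.re) ^ 2 + (m * z.im) ^ 2) / z.im +
        2 * π * I * u * m * starRingEnd ℂ (z : ℂ)) *
      jacobiTheta₂ (u + (I * t / z.im) * m * z.re) (I * t / z.im) := by
    rw [jacobiTheta₂, ← tsum_mul_left]
    refine tsum_congr fun n ↦ ?_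
    rw [genTerm, jacobiTheta₂_term, ← Complex.exp_add, sq_norm_lin_cast]
    congr 1
    simp only [lin, Matrix.cons_val_zero, Matrix.cons_val_one]
    field_simp
    linear_combination (-(n ^ 2 * t + 2 * n * t * m * z.re)) * hI
  rw [e1, key, jacobiTheta₂, ← mul_assoc, ← mul_assoc, mul_comm (cexp _) (1 / _)]
  simp only [mul_assoc]
  congr 1
  simp only [← mul_assoc]
  rw [← Complex.exp_add, ← tsum_mul_left, ← tsum_mul_left]
  refine tsum_congr fun n ↦ ?_
  rw [jacobiTheta₂_term, thetaMid, ← Complex.exp_add, ← Complex.exp_add]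
  congr 1
  rw [conj_coe]
  have hI0 := Complex.I_ne_zero
  field_simp
  linear_combination (norm := skip) 0 * hI
  ring_nf
  simp only [Complex.I_sq]
  ring_nf

lemma tsum_thetaMid_inner (u : ℂ) (z : UpperHalfPlane) {t : ℝ} (ht : 0 < t) (n : ℤ) :
    cexp (-π * u ^ 2 * z.im / t) * ∑' m : ℤ, thetaMid u z t m n =
      1 / (t * z.im : ℂ) ^ (1 / 2 : ℂ) * ∑' m : ℤ, genTerm (u / t) z (1 / t) ![n, m] := by
  have hz := z.im_pos
  have hz' : (z.im : ℂ) ≠ 0 := by exact_mod_cast hz.ne'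
  have ht' : (t : ℂ) ≠ 0 := by exact_mod_cast ht.ne'
  have hI := Complex.I_sq
  have hI0 := Complex.I_ne_zero
  have key := jacobiTheta₂_functional_equation (n * z.re - I * u * z.im) (I * t * z.im)
  rw [show (-I * (I * t * z.im) : ℂ) = t * z.im by linear_combination -t * z.im * hI] at key
  have e1 : ∑' m : ℤ, thetaMid u z t m n =
      cexp (-π * n ^ 2 * z.im / t + 2 * π * n * u * z.im / t) *
      jacobiTheta₂ (n * z.re - I * u * z.im) (I * t * z.im) := by
    rw [jacobiTheta₂, ← tsum_mul_left]
    refine tsum_congr fun m ↦ ?_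
    rw [thetaMid, jacobiTheta₂_term, ← Complex.exp_add]
    congr 1
    field_simp
    ring_nf
    simp only [Complex.I_sq]
    ring_nf
  rw [e1, key, jacobiTheta₂, mul_assoc (1 / _), ← mul_assoc, ← mul_assoc, ← mul_assoc,
    ← Complex.exp_add, mul_comm (cexp _) (1 / _), mul_assoc (1 / _), mul_assoc (1 / _)]
  congr 1
  rw [← Complex.exp_add, ← tsum_mul_left, ← (Equiv.neg ℤ).tsum_eq]
  refine tsum_congr fun m ↦ ?_
  rw [genTerm, jacobiTheta₂_term, ← Complex.exp_add, sq_norm_lin_cast]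
  congr 1
  simp only [lin, Matrix.cons_val_zero, Matrix.cons_val_one, conj_coe, Equiv.neg_apply]
  push_cast
  field_simp
  ring_nf
  simp only [Complex.I_sq]
  ring_nf

lemma genKernel_functional_equation (u : ℂ) (z : UpperHalfPlane) {t : ℝ} (ht : 0 < t) :
    genKernel u z t = 1 / t * genKernel (u / t) z (1 / t) := by
  have hz := z.im_pos
  have hs := summable_thetaMid u z ht
  rw [genKernel_eq_tsum_prod u z ht, genKernel_eq_tsum_prod _ z (one_div_pos.mpr ht)]
  simp_rw [tsum_genTerm_inner u z ht]
  rw [tsum_mul_left, mul_assoc, ← Summable.tsum_comm (f := fun m n ↦ thetaMid u z t m n) hs,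
      ← tsum_mul_left]
  simp_rw [tsum_thetaMid_inner u z ht]
  rw [tsum_mul_left, ← mul_assoc]
  congr 1
  have h1 : (t / z.im : ℂ) ^ (1 / 2 : ℂ) = ((t / z.im) ^ (1 / 2 : ℝ) : ℝ) := by
    rw [Complex.ofReal_cpow (by positivity)]; push_cast; rfl
  have h2 : (t * z.im : ℂ) ^ (1 / 2 : ℂ) = ((t * z.im) ^ (1 / 2 : ℝ) : ℝ) := by
    rw [Complex.ofReal_cpow (by positivity)]; push_cast; rfl
  rw [h1, h2, one_div_mul_one_div, ← Complex.ofReal_mul, ← Real.mul_rpow (by positivity)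
    (by positivity), show t / z.im * (t * z.im) = t ^ 2 by field_simp, ← Real.sqrt_eq_rpow,
    Real.sqrt_sq ht.le]

lemma coeff_eq_of_forall_hasSum {a b : ℕ → ℂ} {F : ℂ → ℂ}
    (ha : ∀ u, HasSum (fun n ↦ a n * u ^ n) (F u)) (hb : ∀ u, HasSum (fun n ↦ b n * u ^ n) (F u)) :
    a = b := by
  have key (c : ℕ → ℂ) (hc : ∀ u, HasSum (fun n ↦ c n * u ^ n) (F u)) :
      HasFPowerSeriesOnBall F (FormalMultilinearSeries.ofScalars ℂ c) 0 1 := by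
    refine ⟨?_, one_pos, fun {y} _ ↦ ?_⟩
    · refine FormalMultilinearSeries.le_radius_of_summable _ ?_
      have := (hc 1).summable.norm
      simpa [FormalMultilinearSeries.ofScalars_norm] using this
    · rw [zero_add]
      refine HasSum.of_eq (hc y) (fun n ↦ ?_) rfl
      rw [FormalMultilinearSeries.ofScalars_apply_eq]; simp
  have h := (key a ha).hasFPowerSeriesAt.eq_formalMultilinearSeries (key b hb).hasFPowerSeriesAt
  exact FormalMultilinearSeries.ofScalars_series_injective ℂ ℂ h

lemma thetaKernel_functional_equation (h : ℕ) (z : UpperHalfPlane) {t : ℝ} (ht : 0 < t) :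
    thetaKernel h z t = (1 / t : ℂ) ^ (h + 1) * thetaKernel h z (1 / t) := by
  have h1 (u : ℂ) := (hasSum_genKernel u z ht).1
  have h2 (u : ℂ) : HasSum (fun h : ℕ ↦ ((2 * π * I) ^ h / h.factorial *
      ((1 / t : ℂ) ^ (h + 1) * thetaKernel h z (1 / t))) * u ^ h) (genKernel u z t) := by
    refine HasSum.of_eq ((hasSum_genKernel (u / t) z (one_div_pos.mpr ht)).1.mul_left (1 / t : ℂ))
      (fun n ↦ ?_) (genKernel_functional_equation u z ht)
    rw [div_pow, pow_succ, div_pow, one_pow]; ring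
  have := congrFun (coeff_eq_of_forall_hasSum h1 h2) h
  refine mul_left_cancel₀ ?_ this
  simp [Real.pi_ne_zero, Nat.factorial_ne_zero]

end QMF

/-! ## Theta kernels on the upper half-plane and the averaging measure -/

namespace QMF

open scoped Real Topology Modular MatrixGroups ENNReal
open UpperHalfPlane MeasureTheory

/-- The kernel with the zero vector removed. -/
def thetaTail (h : ℕ) (z : ℍ) (t : ℝ) : ℂ :=
  ∑' v : Fin 2 → ℤ, if v = 0 then 0 else thetaTerm h z t v

lemma thetaKernel_eq_tail (h : ℕ) (z : ℍ) {t : ℝ} (ht : 0 < t) :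
    thetaKernel h z t = (if h = 0 then 1 else 0) + thetaTail h z t := by
  rw [thetaKernel, ((hasSum_genKernel 0 z ht).2 h).tsum_eq_add_tsum_ite 0, thetaTail]
  congr 1
  rcases eq_or_ne h 0 with rfl | hh <;> simp [thetaTerm, lin, *]

lemma exp_neg_le_factorial_div {x : ℝ} (hx : 0 < x) (N : ℕ) :
    Real.exp (-x) ≤ N.factorial / x ^ N := by
  have := Real.pow_div_factorial_le_exp x hx.le N
  rw [Real.exp_neg, inv_le_comm₀ (Real.exp_pos _) (by positivity), inv_div]
  exact this

lemma half_le_im_of_mem_fd {z : ℍ} (hz : z ∈ 𝒟) : 1 / 2 ≤ z.im := by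
  nlinarith [ModularGroup.three_le_four_mul_im_sq_of_mem_fd hz, z.im_pos]

lemma exists_norm_thetaTerm_le (h N : ℕ) (hN : h + 3 ≤ 2 * N) : ∃ C : ℝ, 0 < C ∧
    ∀ z : ℍ, z ∈ 𝒟 → ∀ t : ℝ, 0 < t → ∀ v ≠ 0,
      ‖thetaTerm h z t v‖ ≤ C * (z.im ^ N / t ^ N) * ‖v‖ ^ (-3 : ℝ) := by
  set r0 := EisensteinSeries.r ⟨⟨1 / 2, 1 / 2⟩, by norm_num⟩
  have hr0 : 0 < r0 := EisensteinSeries.r_pos _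
  refine ⟨N.factorial / π ^ N * (1 / r0) ^ (2 * N - h), by positivity, fun z hz t ht v hv ↦ ?_⟩
  have hzim := z.im_pos
  have hstrip : z ∈ verticalStrip (1 / 2) (1 / 2) := ⟨hz.2, half_le_im_of_mem_fd hz⟩
  have h1 : r0 ≤ EisensteinSeries.r z :=
    EisensteinSeries.r_lower_bound_on_verticalStrip z (by norm_num) hstrip
  have hv1 := one_le_norm_of_ne_zero hv
  have h2 : r0 * ‖v‖ ≤ ‖lin v z‖ :=
    (mul_le_mul_of_nonneg_right h1 (norm_nonneg _)).trans (EisensteinSeries.r_mul_max_le z hv)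
  have h3 : 0 < ‖lin v z‖ := lt_of_lt_of_le (by positivity) h2
  have h4 := exp_neg_le_factorial_div (x := π * t * ‖lin v z‖ ^ 2 / z.im) (by positivity) N
  rw [thetaTerm, norm_mul, norm_pow, norm_lin_conj, Complex.norm_real,
    Real.norm_of_nonneg (Real.exp_pos _).le]
  calc _ ≤ ‖lin v z‖ ^ h * (N.factorial / (π * t * ‖lin v z‖ ^ 2 / z.im) ^ N) := by
        gcongr
        refine le_trans (le_of_eq ?_) h4
        congr 1; ring
    _ = (N.factorial / π ^ N) * (z.im ^ N / t ^ N) * (1 / ‖lin v z‖) ^ (2 * N - h) := by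
        have : ‖lin v z‖ ^ (2 * N) = ‖lin v z‖ ^ h * ‖lin v z‖ ^ (2 * N - h) := by
          rw [← pow_add]; congr 1; omega
        rw [div_pow, mul_pow, mul_pow, ← pow_mul, this, one_div_pow]
        field_simp
    _ ≤ (N.factorial / π ^ N) * (z.im ^ N / t ^ N) * (1 / (r0 * ‖v‖)) ^ (2 * N - h) := by
        gcongr
    _ ≤ (N.factorial / π ^ N) * (z.im ^ N / t ^ N) * ((1 / r0) ^ (2 * N - h) * ‖v‖ ^ (-3 : ℝ)) := by
        gcongr
        rw [show 1 / (r0 * ‖v‖) = 1 / r0 * (1 / ‖v‖) by field_simp, mul_pow]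
        gcongr
        rw [show (-3 : ℝ) = -((3 : ℕ) : ℝ) by norm_num, Real.rpow_neg (by positivity),
          Real.rpow_natCast, one_div, inv_pow]
        gcongr
        omega
    _ = _ := by ring

lemma exists_thetaTail_bound (h N : ℕ) (hN : h + 3 ≤ 2 * N) : ∃ C : ℝ, 0 < C ∧
    ∀ z : ℍ, z ∈ 𝒟 → ∀ t : ℝ, 0 < t → ‖thetaTail h z t‖ ≤ C * (z.im ^ N / t ^ N) := by
  obtain ⟨C, hC, hb⟩ := exists_norm_thetaTerm_le h N hN
  have hs : Summable fun v : Fin 2 → ℤ ↦ ‖v‖ ^ (-3 : ℝ) :=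
    EisensteinSeries.summable_one_div_norm_rpow (by norm_num)
  refine ⟨C * (∑' v : Fin 2 → ℤ, ‖v‖ ^ (-3 : ℝ) + 1), mul_pos hC (add_pos_of_nonneg_of_pos
    (tsum_nonneg fun v ↦ by positivity) one_pos), fun z hz t ht ↦ ?_⟩
  have hzim := z.im_pos
  have h1 := tsum_of_norm_bounded (f := fun v : Fin 2 → ℤ ↦ if v = 0 then 0 else thetaTerm h z t v)
    (hs.mul_left (C * (z.im ^ N / t ^ N))).hasSum fun v ↦ by
      rcases eq_or_ne v 0 with rfl | hv
      · simp
      · simpa [hv] using hb z hz t ht v hv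
  refine h1.trans ?_
  rw [tsum_mul_left]
  have : 0 ≤ C * (z.im ^ N / t ^ N) := by positivity
  nlinarith

/-! ### The averaging measure -/

lemma sl_smul_eq (γ : SL(2, ℤ)) (z : ℍ) : γ • z = (Matrix.SpecialLinearGroup.mapGL ℝ γ) • z := rfl

instance countable_SL2Z : Countable SL(2, ℤ) :=
  haveI : Countable (Matrix (Fin 2) (Fin 2) ℤ) := inferInstanceAs (Countable (Fin 2 → Fin 2 → ℤ))
  inferInstanceAs (Countable {A : Matrix (Fin 2) (Fin 2) ℤ // A.det = 1})

instance : ContinuousConstSMul SL(2, ℤ) ℍ :=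
  ⟨fun γ ↦ continuous_const_smul (Matrix.SpecialLinearGroup.mapGL ℝ γ)⟩

instance : SMulInvariantMeasure SL(2, ℤ) ℍ volume :=
  ⟨fun γ _ hs ↦ SMulInvariantMeasure.measure_preimage_smul
    (Matrix.SpecialLinearGroup.mapGL ℝ γ) hs⟩

lemma finite_smul_mem_fd (z : ℍ) : {γ : SL(2, ℤ) | γ • z ∈ 𝒟}.Finite := by
  obtain ⟨g, hg⟩ := ModularGroup.exists_max_im z
  have hf := ProperlyDiscontinuousSMul.finite_disjoint_inter_image
    (Γ := ↥(Matrix.SpecialLinearGroup.mapGL (n := Fin 2) (R := ℤ) ℝ).range)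
    (isCompact_singleton (x := z))
    (ModularGroup.isCompact_truncatedFundamentalDomain (g • z).im)
  have hinj : Function.Injective (Matrix.SpecialLinearGroup.mapGL (n := Fin 2) (R := ℤ) ℝ) :=
    Matrix.SpecialLinearGroup.mapGL_injective
  refine Set.Finite.of_finite_image (f := fun γ ↦ (⟨Matrix.SpecialLinearGroup.mapGL ℝ γ, γ, rfl⟩ :
    ↥(Matrix.SpecialLinearGroup.mapGL (n := Fin 2) (R := ℤ) ℝ).range)) (hf.subset ?_) ?_
  · rintro _ ⟨γ, hγ, rfl⟩
    exact ⟨γ • z, ⟨z, rfl, rfl⟩, hγ, hg γ⟩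
  · intro a _ b _ hab
    exact hinj (congrArg Subtype.val hab)

lemma isClosed_fd : IsClosed (𝒟 : Set ℍ) := by
  have h1 : Continuous fun z : ℍ ↦ normSq (z : ℂ) := Complex.continuous_normSq.comp continuous_coe
  have h2 : Continuous fun z : ℍ ↦ |z.re| := UpperHalfPlane.continuous_re.abs
  exact (isClosed_le continuous_const h1).inter (isClosed_le h2 continuous_const)

def fdInd (z : ℍ) : ℝ≥0∞ := Set.indicator 𝒟 1 z

lemma fdInd_of_mem {z : ℍ} (h : z ∈ (𝒟 : Set ℍ)) : fdInd z = 1 := by simp [fdInd, h]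

lemma fdInd_of_notMem {z : ℍ} (h : z ∉ (𝒟 : Set ℍ)) : fdInd z = 0 := by simp [fdInd, h]

lemma measurable_fdInd : Measurable fdInd :=
  (measurable_one).indicator isClosed_fd.measurableSet

/-- Number of `γ` moving `z` to the fundamental domain. -/
def fdCount (z : ℍ) : ℝ≥0∞ := ∑' γ : SL(2, ℤ), fdInd (γ • z)

def wt (z : ℍ) : ℝ≥0∞ := fdInd z / fdCount z

lemma measurable_fdCount : Measurable fdCount :=
  Measurable.tsum fun γ ↦ measurable_fdInd.comp (measurable_const_smul γ)

lemma measurable_wt : Measurable wt := measurable_fdInd.div measurable_fdCount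

lemma fdCount_ne_top (z : ℍ) : fdCount z ≠ ⊤ := by
  rw [fdCount, tsum_eq_sum (s := (finite_smul_mem_fd z).toFinset)]
  · refine (ENNReal.sum_lt_top.mpr fun γ _ ↦ ?_).ne
    by_cases h : γ • z ∈ (𝒟 : Set ℍ)
    · rw [fdInd_of_mem h]; exact ENNReal.one_lt_top
    · rw [fdInd_of_notMem h]; exact ENNReal.zero_lt_top
  · intro γ hγ
    exact fdInd_of_notMem fun h ↦ hγ ((Set.Finite.mem_toFinset _).mpr h)

lemma fdCount_ne_zero (z : ℍ) : fdCount z ≠ 0 := by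
  obtain ⟨g, hg⟩ := ModularGroup.exists_smul_mem_fd z
  rw [fdCount, Ne, ENNReal.tsum_eq_zero]
  intro h
  have := h g
  rw [fdInd_of_mem hg] at this
  exact one_ne_zero this

lemma fdCount_smul (γ : SL(2, ℤ)) (z : ℍ) : fdCount (γ • z) = fdCount z := by
  simp only [fdCount, smul_smul]
  exact (Equiv.mulRight γ).tsum_eq (fun g ↦ fdInd (g • z))

lemma tsum_wt_smul (z : ℍ) : ∑' γ : SL(2, ℤ), wt (γ • z) = 1 := by
  simp only [wt, fdCount_smul, div_eq_mul_inv]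
  rw [ENNReal.tsum_mul_right]
  exact ENNReal.mul_inv_cancel (fdCount_ne_zero z) (fdCount_ne_top z)

lemma wt_le_fdInd (z : ℍ) : wt z ≤ fdInd z := by
  by_cases h : z ∈ (𝒟 : Set ℍ)
  · refine ENNReal.div_le_of_le_mul ?_
    have : 1 ≤ fdCount z := by
      have := ENNReal.le_tsum (f := fun γ : SL(2, ℤ) ↦ fdInd (γ • z)) 1
      simpa [fdInd, h, fdCount] using this
    calc fdInd z = fdInd z * 1 := (mul_one _).symm
      _ ≤ _ := by gcongr
  · simp [wt, fdInd, h]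

/-- The weighted restriction of the hyperbolic measure to the fundamental domain. -/
def nu : Measure ℍ := volume.withDensity wt

theorem lintegral_unfold {φ : ℍ → ℝ≥0∞} (hφ : Measurable φ) :
    ∫⁻ z, φ z = ∑' γ : SL(2, ℤ), ∫⁻ z, φ (γ • z) ∂nu := by
  have h1 (γ : SL(2, ℤ)) : ∫⁻ z, φ (γ • z) ∂nu = ∫⁻ z, wt (γ⁻¹ • z) * φ z := by
    have e1 := lintegral_withDensity_eq_lintegral_mul volume measurable_wt
      (hφ.comp (measurable_const_smul γ))
    have e2 := (measurePreserving_smul γ (volume : Measure ℍ)).lintegral_comp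
      ((measurable_wt.comp (measurable_const_smul γ⁻¹)).mul hφ)
    refine e1.trans (Eq.trans ?_ e2)
    refine lintegral_congr fun z ↦ ?_
    simp only [Pi.mul_apply, Function.comp_apply, inv_smul_smul]
  simp_rw [h1]
  have hm (γ : SL(2, ℤ)) : AEMeasurable (fun z ↦ wt (γ⁻¹ • z) * φ z) :=
    ((measurable_wt.comp (measurable_const_smul γ⁻¹)).mul hφ).aemeasurable
  rw [← lintegral_tsum hm]
  refine lintegral_congr fun z ↦ ?_
  rw [ENNReal.tsum_mul_right, show ∑' γ : SL(2, ℤ), wt (γ⁻¹ • z) = 1 from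
    ((Equiv.inv SL(2, ℤ)).tsum_eq (fun γ ↦ wt (γ • z))).trans (tsum_wt_smul z), one_mul]

lemma sum_map_nu : Measure.sum (fun γ : SL(2, ℤ) ↦ nu.map (γ • ·)) = volume := by
  ext s hs
  rw [Measure.sum_apply _ hs, ← lintegral_indicator_one hs, lintegral_unfold
    (measurable_one.indicator hs)]
  refine tsum_congr fun γ ↦ ?_
  rw [Measure.map_apply (measurable_const_smul γ) hs,
    ← lintegral_indicator_one (measurable_const_smul γ hs)]
  rfl

theorem hasSum_integral_unfold {φ : ℍ → ℂ} (hφ : Integrable φ) :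
    HasSum (fun γ : SL(2, ℤ) ↦ ∫ z, φ (γ • z) ∂nu) (∫ z, φ z) := by
  have h := hφ
  rw [← sum_map_nu] at h
  have := hasSum_integral_measure h
  rw [sum_map_nu] at this
  refine HasSum.of_eq this (fun γ ↦ ?_) rfl
  rw [integral_map (measurable_const_smul γ).aemeasurable]
  rw [← sum_map_nu] at hφ
  exact (hφ.mono_measure (Measure.le_sum _ γ)).aestronglyMeasurable

lemma integrable_smul_nu {φ : ℍ → ℂ} (hφ : Integrable φ) (γ : SL(2, ℤ)) :
    Integrable (fun z ↦ φ (γ • z)) nu := by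
  rw [← sum_map_nu] at hφ
  exact (hφ.mono_measure (Measure.le_sum _ γ)).comp_measurable (measurable_const_smul γ)

lemma ae_mem_fd : ∀ᵐ z ∂nu, z ∈ (𝒟 : Set ℍ) := by
  rw [nu, ae_withDensity_iff measurable_wt]
  refine Eventually.of_forall fun z hz ↦ ?_
  by_contra h
  exact hz (by simp [wt, fdInd, h])

/-! ### Coordinates -/

def coord (z : ℍ) : ℝ × ℝ := (z.re, z.im)

lemma measurableEmbedding_coord : MeasurableEmbedding coord :=
  Complex.measurableEquivRealProd.measurableEmbedding.comp measurableEmbedding_coe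

lemma map_coord_comap : (volume.comap UpperHalfPlane.coe).map coord =
    (volume : Measure ℝ).prod (volume.restrict (Set.Ioi 0)) := by
  have h1 : (volume.comap UpperHalfPlane.coe).map UpperHalfPlane.coe =
    (volume.restrict (.range UpperHalfPlane.coe)) := measurableEmbedding_coe.map_comap _
  have h2 : coord = Complex.measurableEquivRealProd ∘ UpperHalfPlane.coe := rfl
  rw [h2, ← Measure.map_map Complex.measurableEquivRealProd.measurable measurable_coe, h1]
  have h3 := Complex.volume_preserving_equiv_real_prod.restrict_preimage
    (s := Set.univ ×ˢ Set.Ioi (0 : ℝ)) (MeasurableSet.univ.prod measurableSet_Ioi)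
  have h4 : Complex.measurableEquivRealProd ⁻¹' (Set.univ ×ˢ Set.Ioi (0 : ℝ)) =
      Set.range UpperHalfPlane.coe := by
    ext w
    simp only [Set.mem_preimage, Set.mem_prod, Set.mem_univ, true_and, Set.mem_Ioi, Set.mem_range]
    constructor
    · intro hw; exact ⟨⟨w, hw⟩, rfl⟩
    · rintro ⟨z, rfl⟩; exact z.im_pos
  rw [← h4, h3.map_eq, Measure.volume_eq_prod, ← Measure.prod_restrict, Measure.restrict_univ]

theorem lintegral_coord {φ : ℝ × ℝ → ℝ≥0∞} (hφ : Measurable φ) :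
    ∫⁻ z : ℍ, φ (coord z) =
      ∫⁻ y in Set.Ioi (0 : ℝ), ∫⁻ x : ℝ, ENNReal.ofReal (1 / y ^ 2) * φ (x, y) := by
  have hm : Measurable fun p : ℝ × ℝ ↦ ENNReal.ofReal (1 / p.2 ^ 2) := by fun_prop
  have hz : (fun z : ℍ ↦ (((1 / NNReal.mk z.im z.im_pos.le : NNReal) ^ 2 : NNReal) : ℝ≥0∞)) =
      fun z ↦ ENNReal.ofReal (1 / (coord z).2 ^ 2) := by
    funext z
    rw [ENNReal.ofReal, ENNReal.coe_inj]
    ext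
    rw [Real.coe_toNNReal _ (by positivity)]
    simp [coord]
  rw [volume_def, hz]
  refine (lintegral_withDensity_eq_lintegral_mul _
    (hm.comp measurableEmbedding_coord.measurable)
    (hφ.comp measurableEmbedding_coord.measurable)).trans ?_
  change _ = ∫⁻ y in Set.Ioi (0 : ℝ), ∫⁻ x : ℝ,
    ((fun p : ℝ × ℝ ↦ ENNReal.ofReal (1 / p.2 ^ 2)) * φ) (x, y)
  rw [← lintegral_prod_symm' (μ := volume) (ν := volume.restrict (Set.Ioi 0)) _ (hm.mul hφ),
    ← map_coord_comap,
    lintegral_map (hm.mul hφ) measurableEmbedding_coord.measurable]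
  rfl

end QMF

/-! ## Unfolding, and Fourier expansions of cusp forms -/

namespace QMF

open scoped Real Topology Modular MatrixGroups ENNReal
open UpperHalfPlane hiding I
open MeasureTheory

/-- The point of the upper half plane with given real and imaginary part. -/
def pt (p : ℝ × ℝ) : ℍ := ofComplex (p.1 + p.2 * I)

lemma pt_coord (z : ℍ) : pt (coord z) = z := by
  have : ((z.re : ℂ) + z.im * I) = (z : ℂ) := by
    apply Complex.ext <;> simp
  simp only [pt, coord, this, ofComplex_apply]

lemma coe_pt {x y : ℝ} (hy : 0 < y) : (pt (x, y) : ℂ) = x + y * I := by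
  rw [pt, ofComplex_apply_of_im_pos (by simpa using hy)]

lemma im_pt {x y : ℝ} (hy : 0 < y) : (pt (x, y)).im = y := by
  rw [← coe_im, coe_pt hy]; simp

/-- The vertical strip `0 ≤ Re z < 1`. -/
def strip : Set ℍ := {z | z.re ∈ Set.Ico (0 : ℝ) 1}

lemma measurableSet_strip : MeasurableSet strip :=
  (measurable_fst.comp measurableEmbedding_coord.measurable) measurableSet_Ico

lemma map_coord_volume : (volume : Measure ℍ).map coord =
    ((volume : Measure ℝ).prod (volume.restrict (Set.Ioi 0))).withDensity
      (fun p ↦ ENNReal.ofReal (1 / p.2 ^ 2)) := by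
  ext s hs
  have hm : Measurable fun p : ℝ × ℝ ↦ ENNReal.ofReal (1 / p.2 ^ 2) := by fun_prop
  have hi : Measurable (s.indicator (1 : ℝ × ℝ → ℝ≥0∞)) := measurable_one.indicator hs
  rw [withDensity_apply _ hs, ← lintegral_indicator_one hs,
    lintegral_map hi measurableEmbedding_coord.measurable,
    lintegral_coord hi, ← lintegral_indicator hs,
    lintegral_prod_symm' _ (hm.indicator hs)]
  refine lintegral_congr fun y ↦ lintegral_congr fun x ↦ ?_
  by_cases h : (x, y) ∈ s <;> simp [h]

instance nu_isFinite : IsFiniteMeasure nu := by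
  refine ⟨?_⟩
  let φ : ℝ × ℝ → ℝ≥0∞ := (Set.Icc (-1 / 2) (1 / 2) ×ˢ Set.Ici (1 / 2 : ℝ)).indicator 1
  have hφ : Measurable φ :=
    measurable_one.indicator (measurableSet_Icc.prod measurableSet_Ici)
  have h1 : nu Set.univ ≤ ∫⁻ z : ℍ, φ (coord z) := by
    rw [nu, withDensity_apply _ MeasurableSet.univ, Measure.restrict_univ]
    refine lintegral_mono fun z ↦ (wt_le_fdInd z).trans ?_
    by_cases h : z ∈ (𝒟 : Set ℍ)
    · have : coord z ∈ (Set.Icc (-1 / 2) (1 / 2) ×ˢ Set.Ici (1 / 2 : ℝ)) := by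
        have := abs_le.1 h.2
        exact ⟨⟨by simpa [coord, neg_div] using this.1, by simpa [coord] using this.2⟩,
          half_le_im_of_mem_fd h⟩
      rw [fdInd_of_mem h]
      exact (Set.indicator_of_mem this (1 : ℝ × ℝ → ℝ≥0∞)).ge
    · simp [fdInd_of_notMem h]
  refine h1.trans_lt ?_
  rw [lintegral_coord hφ]
  have h2 : ∀ y : ℝ, ∫⁻ x : ℝ, ENNReal.ofReal (1 / y ^ 2) * φ (x, y) =
      (Set.Ici (1 / 2)).indicator (fun y ↦ ENNReal.ofReal (1 / y ^ 2)) y := by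
    intro y
    by_cases hy : y ∈ Set.Ici (1 / 2 : ℝ)
    · have : ∀ x, φ (x, y) = (Set.Icc (-1 / 2) (1 / 2)).indicator 1 x := by
        intro x
        by_cases hx : x ∈ Set.Icc (-1 / 2 : ℝ) (1 / 2)
        · rw [Set.indicator_of_mem hx]; exact Set.indicator_of_mem (Set.mem_prod.2 ⟨hx, hy⟩) _
        · rw [Set.indicator_of_notMem hx]; exact Set.indicator_of_notMem (fun h ↦
            hx (Set.mem_prod.1 h).1) _
      simp_rw [this]
      rw [lintegral_const_mul _ (measurable_one.indicator measurableSet_Icc),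
        lintegral_indicator_one measurableSet_Icc, Set.indicator_of_mem hy, Real.volume_Icc]
      norm_num
    · have : ∀ x, φ (x, y) = 0 := fun x ↦ Set.indicator_of_notMem (fun h ↦
        hy (Set.mem_prod.1 h).2) _
      simp only [this, mul_zero, lintegral_zero, Set.indicator_of_notMem hy]
  simp_rw [h2]
  refine (lintegral_mono' Measure.restrict_le_self le_rfl).trans_lt ?_
  rw [lintegral_indicator measurableSet_Ici, ← setLIntegral_congr Ioi_ae_eq_Ici]
  have := integrableOn_Ioi_rpow_of_lt (show (-2 : ℝ) < -1 by norm_num) (show (0 : ℝ) < 1 / 2 by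
      norm_num)
  have h3 := this.lintegral_lt_top
  refine (lintegral_mono_ae ?_).trans_lt h3
  filter_upwards [ae_restrict_mem measurableSet_Ioi] with y hy
  have hy' : (0 : ℝ) < y := lt_trans (by norm_num) hy
  rw [Real.rpow_neg hy'.le]
  norm_num

/-- Integration over the strip in Cartesian coordinates. -/
theorem integral_strip_aux {F : ℍ → ℂ} (hF : IntegrableOn F strip) :
    IntegrableOn (fun y : ℝ ↦
      ((1 / y ^ 2 : ℝ) : ℂ) * ∫ x in Set.Ico (0 : ℝ) 1, F (pt (x, y))) (Set.Ioi 0) ∧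
    ∫ z in strip, F z =
      ∫ y in Set.Ioi (0 : ℝ), ((1 / y ^ 2 : ℝ) : ℂ) * ∫ x in Set.Ico (0 : ℝ) 1, F (pt (x, y)) := by
  let Fc : ℝ × ℝ → ℂ := (Prod.fst ⁻¹' Set.Ico (0 : ℝ) 1).indicator fun p ↦ F (pt p)
  have hms : MeasurableSet (Prod.fst ⁻¹' Set.Ico (0 : ℝ) 1 : Set (ℝ × ℝ)) :=
    measurable_fst measurableSet_Ico
  have hFc : ∀ z, Fc (coord z) = strip.indicator F z := by
    intro z
    by_cases h : z ∈ strip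
    · rw [Set.indicator_of_mem h]
      exact (Set.indicator_of_mem (s := Prod.fst ⁻¹' Set.Ico (0 : ℝ) 1) (a := coord z) h _).trans
        (by rw [pt_coord])
    · rw [Set.indicator_of_notMem h]
      exact Set.indicator_of_notMem (s := Prod.fst ⁻¹' Set.Ico (0 : ℝ) 1) (a := coord z) h _
  have hm : Measurable fun p : ℝ × ℝ ↦ (1 / p.2 ^ 2).toNNReal := by fun_prop
  have hi : Integrable Fc ((volume : Measure ℍ).map coord) := by
    rw [measurableEmbedding_coord.integrable_map_iff]
    refine (hF.integrable_indicator measurableSet_strip).congr (Eventually.of_forall fun z ↦ ?_)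
    exact (hFc z).symm
  rw [← integral_indicator measurableSet_strip, ← funext hFc,
    ← measurableEmbedding_coord.integral_map Fc]
  rw [map_coord_volume] at hi ⊢
  have hi' := (integrable_withDensity_iff_integrable_smul hm).1 hi
  have heq : ∀ y ∈ Set.Ioi (0 : ℝ), ∫ x, (1 / y ^ 2).toNNReal • Fc (x, y) =
      ((1 / y ^ 2 : ℝ) : ℂ) * ∫ x in Set.Ico (0 : ℝ) 1, F (pt (x, y)) := by
    intro y hy
    rw [← integral_indicator measurableSet_Ico, ← integral_const_mul]
    congr 1
    funext x
    rw [NNReal.smul_def, Real.coe_toNNReal _ (by positivity), Complex.real_smul]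
    rfl
  refine ⟨?_, (integral_withDensity_eq_integral_smul hm _).trans ?_⟩
  · exact IntegrableOn.congr_fun hi'.integral_prod_right heq measurableSet_Ioi
  · rw [integral_prod_symm _ hi']
    exact setIntegral_congr_fun measurableSet_Ioi heq

theorem integrableOn_strip {F : ℍ → ℂ} (hF : Continuous F) {a b C : ℝ} (ha : 1 < a) (hb : b < 1)
    (hFa : ∀ z, ‖F z‖ ≤ C * z.im ^ a) (hFb : ∀ z, ‖F z‖ ≤ C * z.im ^ b) :
    IntegrableOn F strip := by
  rw [← integrable_indicator_iff measurableSet_strip]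
  refine ⟨hF.aestronglyMeasurable.indicator measurableSet_strip, ?_⟩
  let ψ : ℝ → ℝ≥0∞ := fun y ↦ ENNReal.ofReal (if y ≤ 1 then C * y ^ a else C * y ^ b)
  have hψ : Measurable ψ := by
    refine ENNReal.measurable_ofReal.comp (Measurable.ite measurableSet_Iic ?_ ?_) <;> fun_prop
  let φ : ℝ × ℝ → ℝ≥0∞ := fun p ↦ (Set.Ico (0 : ℝ) 1).indicator 1 p.1 * ψ p.2
  have hφ : Measurable φ := by
    exact ((measurable_one.indicator measurableSet_Ico).comp measurable_fst).mul
      (hψ.comp measurable_snd)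
  have h1 : ∫⁻ z, ‖strip.indicator F z‖ₑ ≤ ∫⁻ z, φ (coord z) := by
    refine lintegral_mono fun z ↦ ?_
    by_cases h : z ∈ strip
    · have h' : (coord z).1 ∈ Set.Ico (0 : ℝ) 1 := h
      simp only [φ, ψ, Set.indicator_of_mem h, Set.indicator_of_mem h', Pi.one_apply, one_mul]
      rw [← ofReal_norm]
      refine ENNReal.ofReal_le_ofReal ?_
      split_ifs
      exacts [hFa z, hFb z]
    · simp [h]
  refine h1.trans_lt ?_
  rw [lintegral_coord hφ]
  have h2 : ∀ y : ℝ, ∫⁻ x : ℝ, ENNReal.ofReal (1 / y ^ 2) * φ (x, y) =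
      ENNReal.ofReal (1 / y ^ 2) * ψ y := by
    intro y
    simp only [φ]
    rw [lintegral_const_mul _ (by
        exact (measurable_one.indicator measurableSet_Ico).mul_const _),
      lintegral_mul_const _ (measurable_one.indicator measurableSet_Ico),
      lintegral_indicator_one measurableSet_Ico, Real.volume_Ico]
    norm_num
  simp_rw [h2]
  have h3 : IntegrableOn (fun y : ℝ ↦ C * y ^ (a - 2)) (Set.Ioc 0 1) := by
    refine Integrable.const_mul ?_ _
    exact (intervalIntegrable_iff_integrableOn_Ioc_of_le zero_le_one).1
      (intervalIntegral.intervalIntegrable_rpow' (by linarith))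
  have h4 : IntegrableOn (fun y : ℝ ↦ C * y ^ (b - 2)) (Set.Ioi 1) := by
    refine Integrable.const_mul ?_ _
    exact integrableOn_Ioi_rpow_of_lt (by linarith) one_pos
  have key : ∀ y : ℝ, 0 < y → ∀ c : ℝ, ENNReal.ofReal (1 / y ^ 2) * ENNReal.ofReal (C * y ^ c) =
      ENNReal.ofReal (C * y ^ (c - 2)) := by
    intro y hy c
    rw [← ENNReal.ofReal_mul (by positivity), Real.rpow_sub hy]
    congr 1
    norm_num
    ring
  rw [← Set.Ioc_union_Ioi_eq_Ioi (zero_le_one' ℝ)]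
  refine (lintegral_union_le _ _ _).trans_lt (ENNReal.add_lt_top.2 ⟨?_, ?_⟩)
  · refine (lintegral_mono_ae ?_).trans_lt h3.lintegral_lt_top
    filter_upwards [ae_restrict_mem measurableSet_Ioc] with y hy
    simp only [ψ, hy.2, if_true]
    exact (key y hy.1 a).le
  · refine (lintegral_mono_ae ?_).trans_lt h4.lintegral_lt_top
    filter_upwards [ae_restrict_mem measurableSet_Ioi] with y hy
    simp only [ψ, not_le.2 (Set.mem_Ioi.1 hy), if_false]
    exact (key y (one_pos.trans hy) b).le

/-! ### Cusp forms -/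

variable {k : ℤ}

/-- The Fourier coefficients of a cusp form. -/
def cf (f : CuspForm 𝒮ℒ k) (n : ℕ) : ℂ := (qExpansion 1 f).coeff n

lemma hasSum_cf (f : CuspForm 𝒮ℒ k) (z : ℍ) :
    HasSum (fun n : ℕ ↦ cf f n * cexp (2 * π * I * n * z)) (f z) := by
  refine HasSum.of_eq (ModularForm.hasSum_qExpansion (f := f) one_pos
    one_mem_strictPeriods_SL z) (fun n ↦ ?_) rfl
  rw [cf, Function.Periodic.qParam, ← Complex.exp_nat_mul]
  congr 2
  push_cast
  ring

end QMF

/-! ## Fourier coefficients and growth of cusp forms -/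

namespace QMF

open scoped Real Topology Modular MatrixGroups ENNReal ComplexConjugate
open UpperHalfPlane hiding I
open MeasureTheory

variable {k : ℤ}

lemma cf_zero (f : CuspForm 𝒮ℒ k) : cf f 0 = 0 :=
  CuspFormClass.qExpansion_coeff_zero f one_pos one_mem_strictPeriods_SL

lemma cf_unique {f : CuspForm 𝒮ℒ k} {c : ℕ → ℂ}
    (h : ∀ z : ℍ, HasSum (fun n : ℕ ↦ c n * cexp (2 * π * I * n * z)) (f z)) (n : ℕ) :
    c n = cf f n := by
  refine ModularFormClass.qExpansion_coeff_unique (f := f) one_pos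
    one_mem_strictPeriods_SL (fun z ↦ ?_) n
  refine HasSum.of_eq (h z) (fun n ↦ ?_) rfl
  rw [Function.Periodic.qParam, ← Complex.exp_nat_mul, smul_eq_mul]
  congr 2
  push_cast
  ring

lemma cusp_ext_of_cf {f g : CuspForm 𝒮ℒ k} (h : ∀ n, cf f n = cf g n) : f = g := by
  refine DFunLike.ext _ _ fun z ↦ (hasSum_cf f z).unique ?_
  simp_rw [h]
  exact hasSum_cf g z

lemma cf_add (f g : CuspForm 𝒮ℒ k) (n : ℕ) : cf (f + g) n = cf f n + cf g n := by
  refine (cf_unique (c := fun n ↦ cf f n + cf g n) (fun z ↦ ?_) n).symm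
  refine HasSum.of_eq ((hasSum_cf f z).add (hasSum_cf g z)) (fun n ↦ ?_) rfl
  ring

lemma cf_smul (c : ℂ) (f : CuspForm 𝒮ℒ k) (n : ℕ) : cf (c • f) n = c * cf f n := by
  refine (cf_unique (c := fun n ↦ c * cf f n) (fun z ↦ ?_) n).symm
  refine HasSum.of_eq ((hasSum_cf f z).mul_left c) (fun n ↦ ?_) rfl
  ring

/-- The coefficient map as a linear map. -/
def cfₗ (k : ℤ) (n : ℕ) : CuspForm 𝒮ℒ k →ₗ[ℂ] ℂ where
  toFun f := cf f n
  map_add' f g := cf_add f g n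
  map_smul' c f := cf_smul c f n

lemma cusp_continuous (f : CuspForm 𝒮ℒ k) : Continuous f := (CuspFormClass.holo f).continuous

/-- The bottom row automorphy factor as a linear form. -/
lemma cusp_smul (f : CuspForm 𝒮ℒ k) (γ : SL(2, ℤ)) (z : ℍ) :
    f (γ • z) = lin (γ 1) z ^ k * f z := by
  have := SlashInvariantForm.slash_action_eqn' f (γ := Matrix.SpecialLinearGroup.mapGL ℝ γ)
    (MonoidHom.mem_range.2 ⟨γ, rfl⟩) z
  rw [sl_smul_eq, this]
  rfl

lemma im_sl_smul (γ : SL(2, ℤ)) (z : ℍ) : (γ • z).im = z.im / ‖lin (γ 1) z‖ ^ 2 := by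
  rw [← Complex.normSq_eq_norm_sq]
  exact ModularGroup.im_smul_eq_div_normSq γ z

lemma lin_row_ne_zero (γ : SL(2, ℤ)) (z : ℍ) : lin (γ 1) z ≠ 0 :=
  denom_ne_zero (Matrix.SpecialLinearGroup.mapGL ℝ γ) z

lemma exists_cusp_bound (f : CuspForm 𝒮ℒ k) (N : ℕ) :
    ∃ C : ℝ, 0 < C ∧ ∀ z : ℍ, ‖f z‖ ≤ C * z.im ^ (-(k / 2 : ℝ)) ∧
      ‖f z‖ ≤ C * z.im ^ (-(k / 2 : ℝ) - N) := by
  obtain ⟨C, hC⟩ := CuspFormClass.exists_bound f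
  have h1 := CuspFormClass.exp_decay_atImInfty f one_pos one_mem_strictPeriods_SL
  obtain ⟨D, hD⟩ := h1.bound
  rw [Filter.eventually_iff, atImInfty_mem] at hD
  obtain ⟨A, hA⟩ := hD
  set B := max A 1
  have hB : 1 ≤ B := le_max_right _ _
  obtain ⟨M, hM⟩ := exists_nat_ge ((k / 2 : ℝ) + N)
  have hC0 : 0 ≤ |C| := abs_nonneg C
  have hBN : 1 ≤ B ^ N := one_le_pow₀ hB
  refine ⟨|C| * B ^ N + |D| * M.factorial + 1, by positivity, fun z ↦ ?_⟩
  have hy := z.im_pos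
  have h0 : ‖f z‖ ≤ |C| * z.im ^ (-(k / 2 : ℝ)) := by
    refine (hC z).trans ?_
    rw [Real.rpow_neg hy.le, div_eq_mul_inv]
    gcongr
    exact le_abs_self C
  refine ⟨h0.trans ?_, ?_⟩
  · gcongr
    have : (0 : ℝ) ≤ |D| * M.factorial := by positivity
    nlinarith
  · rcases le_total B z.im with h | h
    · have h2 := hA z ((le_max_left _ _).trans h)
      have h1y : 1 ≤ z.im := hB.trans h
      have h3 : Real.exp (-z.im) ≤ M.factorial * z.im ^ (-(k / 2 : ℝ) - N) := by
        refine (exp_neg_le_factorial_div hy M).trans ?_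
        rw [div_eq_mul_inv, ← Real.rpow_natCast, ← Real.rpow_neg hy.le]
        gcongr
        linarith
      have h4 : Real.exp (-2 * π * z.im / 1) ≤ Real.exp (-z.im) := by
        apply Real.exp_le_exp.2
        have := Real.pi_gt_three
        nlinarith
      calc ‖f z‖ ≤ D * ‖Real.exp (-2 * π * z.im / 1)‖ := h2
        _ ≤ |D| * (M.factorial * z.im ^ (-(k / 2 : ℝ) - N)) := by
          rw [Real.norm_of_nonneg (Real.exp_pos _).le]
          gcongr
          · exact le_abs_self D
          · exact h4.trans h3
        _ ≤ _ := by
          rw [← mul_assoc]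
          gcongr
          have : 0 ≤ |C| * B ^ N := by positivity
          linarith
    · refine h0.trans ?_
      have : z.im ^ (-(k / 2 : ℝ)) ≤ B ^ N * z.im ^ (-(k / 2 : ℝ) - N) := by
        have e : z.im ^ (-(k / 2 : ℝ)) = z.im ^ N * z.im ^ (-(k / 2 : ℝ) - N) := by
          rw [← Real.rpow_natCast, ← Real.rpow_add hy]
          congr 1
          ring
        rw [e]
        gcongr
      calc |C| * z.im ^ (-(k / 2 : ℝ)) ≤ |C| * (B ^ N * z.im ^ (-(k / 2 : ℝ) - N)) := by gcongr
        _ ≤ _ := by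
          rw [← mul_assoc]
          gcongr
          have : (0 : ℝ) ≤ |D| * M.factorial := by positivity
          linarith

/-- The Fourier expansion restricted to a horizontal line, with absolute convergence. -/
lemma summable_norm_cf (f : CuspForm 𝒮ℒ k) {y : ℝ} (hy : 0 < y) :
    Summable fun n : ℕ ↦ ‖cf f n‖ * Real.exp (-2 * π * n * y) := by
  have := (hasSum_cf f (pt (0, y))).summable.norm
  refine this.congr fun n ↦ ?_
  rw [norm_mul, Complex.norm_exp, coe_pt hy]
  simp

lemma hasSum_prod_mul {u v : ℕ → ℂ} {a b : ℂ} (hu : HasSum u a) (hv : HasSum v b)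
    (h : Summable fun p : ℕ × ℕ ↦ u p.1 * v p.2) :
    HasSum (fun p : ℕ × ℕ ↦ u p.1 * v p.2) (a * b) := by
  have := h.hasSum
  rwa [← hu.summable.tsum_mul_tsum hv.summable h, hu.tsum_eq, hv.tsum_eq] at this

/-- Parseval's formula on a horizontal line. -/
theorem hasSum_parseval {l : ℤ} (f : CuspForm 𝒮ℒ k) (g : CuspForm 𝒮ℒ l) {y : ℝ} (hy : 0 < y) :
    HasSum (fun n : ℕ ↦ cf f n * conj (cf g n) * Real.exp (-(4 * π * n) * y))
      (∫ x in Set.Ico (0 : ℝ) 1, f (pt (x, y)) * conj (g (pt (x, y)))) := by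
  let F : ℕ × ℕ → ℝ → ℂ := fun p x ↦ cf f p.1 * cexp (2 * π * I * p.1 * (x + y * I)) *
    conj (cf g p.2 * cexp (2 * π * I * p.2 * (x + y * I)))
  have hnorm : ∀ p x, ‖F p x‖ = (‖cf f p.1‖ * Real.exp (-2 * π * p.1 * y)) *
      (‖cf g p.2‖ * Real.exp (-2 * π * p.2 * y)) := by
    intro p x
    simp only [F, norm_mul, RCLike.norm_conj, Complex.norm_exp]
    congr 3 <;> simp
  have hsum : Summable fun p : ℕ × ℕ ↦ (‖cf f p.1‖ * Real.exp (-2 * π * p.1 * y)) *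
      (‖cf g p.2‖ * Real.exp (-2 * π * p.2 * y)) :=
    (summable_norm_cf f hy).mul_of_nonneg (summable_norm_cf g hy)
      (fun n ↦ by positivity) (fun n ↦ by positivity)
  have hF : ∀ x, HasSum (fun p ↦ F p x) (f (pt (x, y)) * conj (g (pt (x, y)))) := by
    intro x
    have h1 := hasSum_cf f (pt (x, y))
    have h2 := hasSum_cf g (pt (x, y))
    rw [coe_pt hy] at h1 h2
    have h3 := Complex.hasSum_conj'.2 h2
    have h4 : Summable fun p ↦ F p x :=
      Summable.of_norm (hsum.congr fun p ↦ (hnorm p x).symm)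
    refine HasSum.of_eq (hasSum_prod_mul h1 h3 (h4.congr fun p ↦ ?_)) (fun p ↦ ?_) rfl
    · rfl
    · rfl
  have hInt : HasSum (fun p ↦ ∫ x in Set.Ico (0 : ℝ) 1, F p x)
      (∫ x in Set.Ico (0 : ℝ) 1, f (pt (x, y)) * conj (g (pt (x, y)))) := by
    refine hasSum_integral_of_dominated_convergence
      (fun p _ ↦ (‖cf f p.1‖ * Real.exp (-2 * π * p.1 * y)) *
      (‖cf g p.2‖ * Real.exp (-2 * π * p.2 * y))) (fun p ↦ ?_) (fun p ↦ ?_) ?_ ?_ ?_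
    · refine Continuous.aestronglyMeasurable ?_
      simp only [F]
      fun_prop
    · exact Eventually.of_forall fun x ↦ (hnorm p x).le
    · exact Eventually.of_forall fun x ↦ hsum
    · exact integrable_const _
    · exact Eventually.of_forall hF
  have hval : ∀ p : ℕ × ℕ, ∫ x in Set.Ico (0 : ℝ) 1, F p x =
      if p.1 = p.2 then cf f p.1 * conj (cf g p.1) * Real.exp (-(4 * π * p.1) * y) else 0 := by
    rintro ⟨n, m⟩
    have e : ∀ x : ℝ, F (n, m) x = cf f n * conj (cf g m) * Real.exp (-(2 * π * (n + m)) * y) *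
        cexp ((2 * π * I * (n - m)) * x) := by
      intro x
      simp only [F, map_mul, ← Complex.exp_conj, conj_ofReal, conj_I, map_add, map_ofNat,
        map_natCast]
      rw [mul_mul_mul_comm, ← Complex.exp_add, mul_assoc (cf f n * conj (cf g m)),
        Complex.ofReal_exp, ← Complex.exp_add]
      congr 2
      push_cast
      linear_combination (2 * π * y * (n + m)) * I_sq
    simp_rw [e]
    rw [integral_const_mul, integral_Ico_eq_integral_Ioc,
      ← intervalIntegral.integral_of_le zero_le_one]
    rcases eq_or_ne n m with rfl | hnm
    · simp only [sub_self, mul_zero, zero_mul, Complex.exp_zero, if_true]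
      rw [intervalIntegral.integral_const]
      simp only [sub_zero, one_smul, mul_one]
      congr 3
      ring
    · have hc : (2 * π * I * (n - m) : ℂ) ≠ 0 := by
        have : (n : ℂ) - m ≠ 0 := sub_ne_zero.2 (by exact_mod_cast hnm)
        simp [this, Real.pi_ne_zero]
      rw [integral_exp_mul_complex hc]
      have : cexp (2 * π * I * (n - m) * (1 : ℝ)) = 1 := by
        rw [Complex.exp_eq_one_iff]
        exact ⟨n - m, by push_cast; ring⟩
      rw [this]
      simp [hnm]
  simp_rw [hval] at hInt
  have hinj : Function.Injective (fun n : ℕ ↦ (n, n)) := fun a b h ↦ (Prod.mk.inj h).1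
  have := (hinj.hasSum_iff (f := fun p : ℕ × ℕ ↦ if p.1 = p.2 then
    cf f p.1 * conj (cf g p.1) * (Real.exp (-(4 * π * p.1) * y) : ℂ) else 0) (fun p hp ↦ ?_)).2 hInt
  · exact HasSum.of_eq this (fun n ↦ by simp) rfl
  · rw [if_neg]
    intro h
    exact hp ⟨p.1, Prod.ext rfl h⟩

end QMF

/-! ## Integrals over the strip -/

namespace QMF

open scoped Real Topology Modular MatrixGroups ENNReal ComplexConjugate
open UpperHalfPlane hiding I
open MeasureTheory

/-! ### Nonzero vectors and the strip -/

lemma re_T_zpow_smul (n : ℤ) (z : ℍ) : (ModularGroup.T ^ n • z).re = z.re + n := by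
  rw [modular_T_zpow_smul, vadd_re, add_comm]

lemma eq_T_zpow_mul {γ δ : SL(2, ℤ)} (h : γ 1 = δ 1) : ∃ n : ℤ, δ = ModularGroup.T ^ n * γ := by
  have h0 : γ 1 0 = δ 1 0 := congrFun h 0
  have h1 : γ 1 1 = δ 1 1 := congrFun h 1
  have d1 := γ.det_coe
  have d2 := δ.det_coe
  rw [Matrix.det_fin_two] at d1 d2
  rw [← h0, ← h1] at d2
  refine ⟨δ 0 1 * γ 0 0 - δ 0 0 * γ 0 1, ?_⟩
  ext i j
  rw [Matrix.SpecialLinearGroup.coe_mul, ModularGroup.coe_T_zpow, Matrix.mul_apply,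
    Fin.sum_univ_two]
  fin_cases i <;> fin_cases j <;> simp
  · linear_combination (γ 0 0 : ℤ) * d2 - (δ 0 0 : ℤ) * d1
  · linear_combination (γ 0 1 : ℤ) * d2 - (δ 0 1 : ℤ) * d1
  · exact h0.symm
  · exact h1.symm

lemma gcd_row (γ : SL(2, ℤ)) : Int.gcd (γ 1 0) (γ 1 1) = 1 :=
  Int.isCoprime_iff_gcd_eq_one.1 (ModularGroup.bottom_row_coprime γ)

/-- Nonzero integer vectors are parametrised by a positive integer and a matrix carrying `z` into
the strip. -/
def stripVec (z : ℍ) (p : {p : ℕ+ × SL(2, ℤ) // p.2 • z ∈ strip}) : {v : Fin 2 → ℤ // v ≠ 0} :=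
  ⟨fun i ↦ (p.1.1 : ℤ) * p.1.2 1 i, fun h ↦ by
    have hd : (p.1.1 : ℤ) ≠ 0 := by exact_mod_cast p.1.1.ne_zero
    have h0 : p.1.2 1 0 = 0 := (mul_eq_zero.1 (congrFun h 0)).resolve_left hd
    have h1 : p.1.2 1 1 = 0 := (mul_eq_zero.1 (congrFun h 1)).resolve_left hd
    have := gcd_row p.1.2
    rw [h0, h1] at this
    simp at this⟩

lemma stripVec_bijective (z : ℍ) : Function.Bijective (stripVec z) := by
  constructor
  · rintro ⟨⟨d, γ⟩, h⟩ ⟨⟨e, δ⟩, h'⟩ heq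
    have hv : ∀ i, (d : ℤ) * γ 1 i = e * δ 1 i := fun i ↦ congrFun (Subtype.ext_iff.1 heq) i
    have hde : (d : ℤ) = e := by
      have h1 : Int.gcd ((d : ℤ) * γ 1 0) (d * γ 1 1) = d := by
        rw [Int.gcd_mul_left, gcd_row]; simp
      have h2 : Int.gcd ((e : ℤ) * δ 1 0) (e * δ 1 1) = e := by
        rw [Int.gcd_mul_left, gcd_row]; simp
      rw [hv, hv, h2] at h1
      exact_mod_cast h1.symm
    have hd : (d : ℤ) ≠ 0 := by exact_mod_cast d.ne_zero
    have hrow : γ 1 = δ 1 := by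
      funext i
      have := hv i
      rw [← hde] at this
      exact mul_left_cancel₀ hd this
    obtain ⟨n, rfl⟩ := eq_T_zpow_mul hrow
    have hn : n = 0 := by
      simp only [strip, Set.mem_ofPred_eq, mul_smul, re_T_zpow_smul, Set.mem_Ico] at h h'
      have a1 : (-1 : ℝ) < n := by linarith [h.2, h'.1]
      have a2 : (n : ℝ) < 1 := by linarith [h.1, h'.2]
      have b1 : -1 < n := by exact_mod_cast a1
      have b2 : n < 1 := by exact_mod_cast a2
      omega
    have hde' : d = e := by exact_mod_cast hde
    simp [hn, hde']
  · rintro ⟨v, hv⟩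
    have hg : 0 < Int.gcd (v 0) (v 1) := by
      rw [Int.gcd_pos_iff]
      by_contra! h
      exact hv (funext fun i ↦ by fin_cases i; exacts [h.1, h.2])
    obtain ⟨a, b, hab, ha, hb⟩ : ∃ a b : ℤ, IsCoprime a b ∧ v 0 = Int.gcd (v 0) (v 1) * a ∧
        v 1 = Int.gcd (v 0) (v 1) * b := by
      refine ⟨v 0 / Int.gcd (v 0) (v 1), v 1 / Int.gcd (v 0) (v 1), ?_, ?_, ?_⟩
      · exact Int.isCoprime_iff_gcd_eq_one.2 (Int.gcd_ediv_gcd_ediv_gcd hg)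
      · exact (Int.mul_ediv_cancel' (Int.gcd_dvd_left _ _)).symm
      · exact (Int.mul_ediv_cancel' (Int.gcd_dvd_right _ _)).symm
    obtain ⟨γ, -, hγ⟩ := ModularGroup.bottom_row_surj (R := ℤ) (a := ![a, b]) (by simpa using hab)
    have hγ' : γ 1 = ![a, b] := hγ
    refine ⟨⟨⟨⟨Int.gcd (v 0) (v 1), hg⟩, ModularGroup.T ^ (-⌊(γ • z).re⌋) * γ⟩, ?_⟩, ?_⟩
    · simp only [strip, Set.mem_ofPred_eq, mul_smul, re_T_zpow_smul, Set.mem_Ico]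
      push_cast
      constructor
      · linarith [Int.floor_le (γ • z).re]
      · linarith [Int.lt_floor_add_one (γ • z).re]
    · refine Subtype.ext (funext fun i ↦ ?_)
      simp only [stripVec, ModularGroup.T_pow_mul_apply_one, hγ', PNat.mk_coe]
      fin_cases i
      · exact ha.symm
      · exact hb.symm

lemma hasSum_strip_iff (z : ℍ) (F : (Fin 2 → ℤ) → ℂ) (a : ℂ) :
    HasSum (fun p : ℕ+ × SL(2, ℤ) ↦
      strip.indicator (fun _ ↦ F (fun i ↦ (p.1 : ℤ) * p.2 1 i)) (p.2 • z)) a ↔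
    HasSum (fun v ↦ if v = 0 then 0 else F v) a := by
  have h1 := (Equiv.ofBijective _ (stripVec_bijective z)).hasSum_iff
    (f := fun v : {v : Fin 2 → ℤ // v ≠ 0} ↦ F v) (a := a)
  have h2 : HasSum (fun v : {v : Fin 2 → ℤ // v ≠ 0} ↦ F v) a ↔
      HasSum (fun v ↦ if v = 0 then 0 else F v) a := by
    refine (hasSum_subtype_iff_indicator (s := {v : Fin 2 → ℤ | v ≠ 0})).trans ?_
    refine iff_of_eq (congrArg (fun f ↦ HasSum f a) (funext fun v ↦ ?_))
    by_cases h : v = 0 <;> simp [h]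
  have h3 : HasSum (fun p : {p : ℕ+ × SL(2, ℤ) // p.2 • z ∈ strip} ↦ F (stripVec z p)) a ↔
      HasSum (fun p : ℕ+ × SL(2, ℤ) ↦
        strip.indicator (fun _ ↦ F (fun i ↦ (p.1 : ℤ) * p.2 1 i)) (p.2 • z)) a := by
    refine (hasSum_subtype_iff_indicator
      (f := fun p : ℕ+ × SL(2, ℤ) ↦ F (fun i ↦ (p.1 : ℤ) * p.2 1 i))
      (s := {p : ℕ+ × SL(2, ℤ) | p.2 • z ∈ strip})).trans ?_
    refine iff_of_eq (congrArg (fun f ↦ HasSum f a) (funext fun v ↦ ?_))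
    by_cases h : v.2 • z ∈ strip
    · rw [Set.indicator_of_mem (by exact h), Set.indicator_of_mem h]
    · rw [Set.indicator_of_notMem (by exact h), Set.indicator_of_notMem h]
  exact h3.symm.trans (h1.trans h2)

/-! ### The product of two cusp forms -/

variable {k : ℤ} {h : ℕ}

/-- The product `f * conj g * y ^ k`. -/
def pet (f : CuspForm 𝒮ℒ k) (g : CuspForm 𝒮ℒ (k + h)) (z : ℍ) : ℂ :=
  f z * conj (g z) * (z.im : ℂ) ^ k

variable (f : CuspForm 𝒮ℒ k) (g : CuspForm 𝒮ℒ (k + h))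

lemma continuous_pet : Continuous (pet f g) := by
  refine ((cusp_continuous f).mul (Complex.continuous_conj.comp (cusp_continuous g))).mul ?_
  refine Continuous.zpow₀ (Complex.continuous_ofReal.comp UpperHalfPlane.continuous_im) _ fun z ↦
      Or.inl ?_
  simpa using z.im_pos.ne'

lemma lin_conj (v : Fin 2 → ℤ) (z : ℂ) : lin v (conj z) = conj (lin v z) := by
  simp [lin]

lemma pet_smul (γ : SL(2, ℤ)) (z : ℍ) :
    pet f g (γ • z) = lin (γ 1) (conj (z : ℂ)) ^ h * pet f g z := by
  have h0 := lin_row_ne_zero γ z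
  have h0' : conj (lin (γ 1) z) ≠ 0 := (map_ne_zero _).2 h0
  rw [pet, pet, cusp_smul, cusp_smul, im_sl_smul, lin_conj, map_mul, map_zpow₀,
    zpow_add₀ h0', zpow_natCast]
  push_cast
  rw [div_zpow, ← Complex.mul_conj', mul_zpow]
  field_simp

lemma exists_pet_bound (N : ℕ) : ∃ C : ℝ, 0 < C ∧ ∀ z : ℍ,
    ‖pet f g z‖ ≤ C * z.im ^ (-(h / 2 : ℝ)) ∧ ‖pet f g z‖ ≤ C * z.im ^ (-(h / 2 : ℝ) - N) := by
  obtain ⟨C, hC, h1⟩ := exists_cusp_bound f 0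
  obtain ⟨D, hD, h2⟩ := exists_cusp_bound g N
  refine ⟨C * D, by positivity, fun z ↦ ?_⟩
  have hy := z.im_pos
  have h3 : ‖pet f g z‖ = ‖f z‖ * ‖g z‖ * z.im ^ (k : ℝ) := by
    rw [pet, norm_mul, norm_mul, RCLike.norm_conj, norm_zpow, Complex.norm_real,
      Real.norm_of_nonneg hy.le, Real.rpow_intCast]
  have key : ∀ e : ℝ, ‖g z‖ ≤ D * z.im ^ (-((k + h : ℤ) / 2 : ℝ) - e) →
      ‖pet f g z‖ ≤ C * D * z.im ^ (-(h / 2 : ℝ) - e) := by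
    intro e he
    rw [h3]
    calc _ ≤ (C * z.im ^ (-(k / 2 : ℝ))) * (D * z.im ^ (-((k + h : ℤ) / 2 : ℝ) - e)) *
          z.im ^ (k : ℝ) := by
          gcongr
          exact (h1 z).1
      _ = C * D * (z.im ^ (-(k / 2 : ℝ)) * z.im ^ (-((k + h : ℤ) / 2 : ℝ) - e) *
          z.im ^ (k : ℝ)) := by ring
      _ = _ := by
        rw [← Real.rpow_add hy, ← Real.rpow_add hy]
        congr 2
        push_cast
        ring
  refine ⟨?_, key N (h2 z).2⟩
  have := key 0 (by simpa using (h2 z).1)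
  simpa using this

end QMF

/-! ## The unfolded theta integral -/

namespace QMF
open scoped Real Topology Modular MatrixGroups ENNReal ComplexConjugate
open UpperHalfPlane hiding I
open MeasureTheory

/-! ### Mellin transform of the theta integral -/

lemma hasSum_mul_prod {ι ι' : Type*} {a : ι → ℂ} {b : ι' → ℂ} {A B : ℂ} (ha : HasSum a A)
    (hb : HasSum b B) : HasSum (fun p : ι × ι' ↦ a p.1 * b p.2) (A * B) :=
  ha.mul hb (summable_mul_of_summable_norm ha.summable.norm hb.summable.norm)

section Measure

variable {X : Type*} [MeasurableSpace X] {ν : Measure X}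

lemma integrable_of_hasSum {ι : Type*} [Countable ι] {F : ι → X → ℂ} {S : X → ℂ}
    (hF : ∀ i, Integrable (F i) ν) (hs : Summable fun i ↦ ∫ a, ‖F i a‖ ∂ν)
    (h : ∀ᵐ a ∂ν, HasSum (fun i ↦ F i a) (S a)) :
    Integrable S ν ∧ HasSum (fun i ↦ ∫ a, F i a ∂ν) (∫ a, S a ∂ν) := by
  have hm : AEStronglyMeasurable S ν :=
    aestronglyMeasurable_of_tendsto_ae atTop (f := fun (s : Finset ι) a ↦ ∑ i ∈ s, F i a)
      (fun s ↦ (Finset.aestronglyMeasurable_fun_sum s fun i _ ↦ (hF i).1)) h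
  have hfin : ∑' i, ∫⁻ a, ‖F i a‖ₑ ∂ν ≠ ∞ := by
    have (i : ι) : ∫⁻ a, ‖F i a‖ₑ ∂ν = ENNReal.ofReal (∫ a, ‖F i a‖ ∂ν) := by
      rw [ofReal_integral_norm_eq_lintegral_enorm (hF i)]
    rw [funext this]
    exact hs.tsum_ofReal_ne_top
  refine ⟨⟨hm, ?_⟩, ?_⟩
  · refine lt_of_le_of_lt ?_ hfin.lt_top
    rw [← lintegral_tsum (fun i ↦ (hF i).1.enorm)]
    refine lintegral_mono_ae (h.mono fun a ha ↦ ?_)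
    rw [← ha.tsum_eq]
    exact enorm_tsum_le_tsum_enorm
  · refine HasSum.of_eq (hasSum_integral_of_summable_integral_norm hF hs) (fun _ ↦ rfl) ?_
    exact integral_congr_ae (h.mono fun a ha ↦ ha.tsum_eq.symm)

lemma integrableOn_cpow_mul_exp {w : ℂ} (hw : 0 < w.re) {r : ℝ} (hr : 0 < r) :
    IntegrableOn (fun t : ℝ ↦ (t : ℂ) ^ (w - 1) * (Real.exp (-(r * t)) : ℂ)) (Set.Ioi 0) := by
  have h1 := integrableOn_rpow_mul_exp_neg_mul_rpow (p := 1) (s := w.re - 1) (b := r)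
    (by linarith) one_pos hr
  refine Integrable.mono' h1 ?_ ?_
  · refine Measurable.aestronglyMeasurable ?_
    exact ((Complex.measurable_ofReal).pow_const _).mul (by fun_prop)
  · filter_upwards [self_mem_ae_restrict measurableSet_Ioi] with t ht
    rw [norm_mul, Complex.norm_cpow_eq_rpow_re_of_pos ht, Complex.norm_real,
      Real.norm_of_nonneg (Real.exp_pos _).le, Real.rpow_one]
    simp

lemma integral_cpow_mul_exp {w : ℂ} (hw : 0 < w.re) {r : ℝ} (hr : 0 < r) :
    ∫ t in Set.Ioi (0 : ℝ), (t : ℂ) ^ (w - 1) * (Real.exp (-(r * t)) : ℂ) =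
      Gamma w * (r : ℂ) ^ (-w) := by
  have := integral_cpow_mul_exp_neg_mul_Ioi hw hr
  rw [one_div, inv_cpow _ _ (arg_ofReal_of_nonneg hr.le ▸ Real.pi_pos.ne), ← cpow_neg] at this
  rw [mul_comm, ← this]
  simp

lemma integral_norm_cpow_mul_exp {w : ℂ} (hw : 0 < w.re) {r : ℝ} (hr : 0 < r) :
    ∫ t in Set.Ioi (0 : ℝ), ‖(t : ℂ) ^ (w - 1) * (Real.exp (-(r * t)) : ℂ)‖ =
      Real.Gamma w.re * r ^ (-w.re) := by
  have := Real.integral_rpow_mul_exp_neg_mul_Ioi hw hr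
  rw [one_div, Real.inv_rpow hr.le, ← Real.rpow_neg hr.le] at this
  rw [mul_comm, ← this]
  refine setIntegral_congr_fun measurableSet_Ioi fun t ht ↦ ?_
  rw [norm_mul, Complex.norm_cpow_eq_rpow_re_of_pos ht, Complex.norm_real,
      Real.norm_of_nonneg (Real.exp_pos _).le]
  simp

/-- Integrating `t ^ (w - 1) Q(x) exp (-c t / y(x))` over `(0, ∞) × X`. -/
lemma integral_prod_cpow_mul_exp [SFinite ν] {Q : X → ℂ} {y : X → ℝ} (hQ : Measurable Q)
    (hy : Measurable y) (hy0 : ∀ x, 0 < y x) {w : ℂ} (hw : 0 < w.re) {c : ℝ} (hc : 0 < c)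
    (hInt : Integrable (fun x ↦ Q x * (y x : ℂ) ^ w) ν) :
    let F : ℝ × X → ℂ := fun p ↦ (p.1 : ℂ) ^ (w - 1) * (Q p.2 * Real.exp (-(c / y p.2 * p.1)))
    Integrable F ((volume.restrict (Set.Ioi 0)).prod ν) ∧
    ∫ p, ‖F p‖ ∂((volume.restrict (Set.Ioi 0)).prod ν) =
      Real.Gamma w.re * c ^ (-w.re) * ∫ x, ‖Q x * (y x : ℂ) ^ w‖ ∂ν ∧
    ∫ p, F p ∂((volume.restrict (Set.Ioi 0)).prod ν) =
      Gamma w * (c : ℂ) ^ (-w) * ∫ x, Q x * (y x : ℂ) ^ w ∂ν := by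
  intro F
  have hFm : Measurable F := by
    refine ((Complex.measurable_ofReal.comp measurable_fst).pow_const _).mul
      ((hQ.comp measurable_snd).mul (Complex.measurable_ofReal.comp ?_))
    exact Real.measurable_exp.comp
      (((hy.comp measurable_snd).const_div c).mul measurable_fst).neg
  have hF (x : X) (t : ℝ) : F (t, x) =
      Q x * ((t : ℂ) ^ (w - 1) * (Real.exp (-(c / y x * t)) : ℂ)) := by
    simp only [F]; ring
  have hcy (x : X) : 0 < c / y x := div_pos hc (hy0 x)
  have hn (x : X) : ∫ t in Set.Ioi (0 : ℝ), ‖F (t, x)‖ =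
      Real.Gamma w.re * c ^ (-w.re) * ‖Q x * (y x : ℂ) ^ w‖ := by
    simp only [hF, norm_mul (Q x)]
    rw [integral_const_mul, integral_norm_cpow_mul_exp hw (hcy x),
      Complex.norm_cpow_eq_rpow_re_of_pos (hy0 x), Real.div_rpow hc.le (hy0 x).le,
      Real.rpow_neg (hy0 x).le, div_inv_eq_mul]
    ring
  have hi (x : X) : ∫ t in Set.Ioi (0 : ℝ), F (t, x) =
      Gamma w * (c : ℂ) ^ (-w) * (Q x * (y x : ℂ) ^ w) := by
    simp only [hF]
    rw [integral_const_mul, integral_cpow_mul_exp hw (hcy x), Complex.ofReal_div,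
      div_cpow_ofReal_nonneg hc.le (hy0 x).le, cpow_neg (y x : ℂ), div_inv_eq_mul]
    ring
  have hI : Integrable F ((volume.restrict (Set.Ioi 0)).prod ν) := by
    rw [integrable_prod_iff' hFm.aestronglyMeasurable]
    refine ⟨Eventually.of_forall fun x ↦ ?_, ?_⟩
    · simp only [hF]
      exact (integrableOn_cpow_mul_exp hw (hcy x)).const_mul _
    · simp only [hn]
      exact hInt.norm.const_mul _
  refine ⟨hI, ?_, ?_⟩
  · rw [integral_prod_symm _ hI.norm]
    simp only [hn]
    exact integral_const_mul _ _
  · rw [integral_prod_symm _ hI]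
    simp only [hi]
    exact integral_const_mul _ _

end Measure

section Unfold

variable {k : ℤ} {h : ℕ} (f : CuspForm 𝒮ℒ k) (g : CuspForm 𝒮ℒ (k + h))

lemma continuous_im_cpow (w : ℂ) : Continuous fun z : ℍ ↦ (z.im : ℂ) ^ w :=
  Continuous.cpow (Complex.continuous_ofReal.comp UpperHalfPlane.continuous_im) continuous_const
    fun z ↦ Complex.ofReal_mem_slitPlane.2 z.im_pos

lemma norm_im_cpow (z : ℍ) (w : ℂ) : ‖(z.im : ℂ) ^ w‖ = z.im ^ w.re :=
  Complex.norm_cpow_eq_rpow_re_of_pos z.im_pos w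

lemma integrableOn_pet_cpow {w : ℂ} (hw : 1 + (h / 2 : ℝ) < w.re) :
    IntegrableOn (fun z ↦ pet f g z * (z.im : ℂ) ^ w) strip := by
  obtain ⟨N, hN⟩ := exists_nat_gt (w.re - (h / 2 : ℝ) - 1)
  obtain ⟨C, hC, hb⟩ := exists_pet_bound f g N
  refine integrableOn_strip (a := w.re - h / 2) (b := w.re - h / 2 - N) (C := C)
    ((continuous_pet f g).mul (continuous_im_cpow w)) (by linarith) (by linarith)
    (fun z ↦ ?_) (fun z ↦ ?_)
  · rw [norm_mul, norm_im_cpow, show w.re - (h / 2 : ℝ) = -(h / 2 : ℝ) + w.re by ring,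
      Real.rpow_add z.im_pos, ← mul_assoc]
    exact mul_le_mul_of_nonneg_right (hb z).1 (Real.rpow_nonneg z.im_pos.le _)
  · rw [norm_mul, norm_im_cpow, show w.re - (h / 2 : ℝ) - N = (-(h / 2 : ℝ) - N) + w.re by ring,
      Real.rpow_add z.im_pos, ← mul_assoc]
    exact mul_le_mul_of_nonneg_right (hb z).2 (Real.rpow_nonneg z.im_pos.le _)

/-- The contribution of `d` and of the coset representative `γ` to the Mellin integrand. -/
def unfoldTerm (w : ℂ) (d : ℕ+) (γ : SL(2, ℤ)) (p : ℝ × ℍ) : ℂ :=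
  (p.1 : ℂ) ^ (w - 1) * ((d : ℂ) ^ h * strip.indicator (pet f g) (γ • p.2) *
    Real.exp (-(π * (d : ℝ) ^ 2 / (γ • p.2).im * p.1)))

lemma unfoldTerm_eq (w : ℂ) (d : ℕ+) (γ : SL(2, ℤ)) (t : ℝ) (z : ℍ) :
    unfoldTerm f g w d γ (t, z) = (t : ℂ) ^ (w - 1) * pet f g z *
      strip.indicator (fun _ ↦ thetaTerm h z t (fun i ↦ (d : ℤ) * γ 1 i)) (γ • z) := by
  have hlin (x : ℂ) : lin (fun i ↦ (d : ℤ) * γ 1 i) x = d * lin (γ 1) x := by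
    simp only [lin]; push_cast; ring
  rw [unfoldTerm]
  by_cases hz : γ • z ∈ strip
  · rw [Set.indicator_of_mem hz, Set.indicator_of_mem hz, pet_smul, thetaTerm, hlin, hlin,
      im_sl_smul]
    have h1 : ‖lin (γ 1) z‖ ≠ 0 := norm_ne_zero_iff.2 (lin_row_ne_zero γ z)
    have h2 : -(π * (d : ℝ) ^ 2 / (z.im / ‖lin (γ 1) z‖ ^ 2) * t) =
        -π * t * ‖(d : ℂ) * lin (γ 1) z‖ ^ 2 / z.im := by
      rw [norm_mul, Complex.norm_natCast]
      have := z.im_ne_zero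
      field_simp
    rw [h2, mul_pow]
    ring
  · rw [Set.indicator_of_notMem hz, Set.indicator_of_notMem hz]; simp

lemma hasSum_unfoldTerm (w : ℂ) {t : ℝ} (ht : 0 < t) (z : ℍ) :
    HasSum (fun p : ℕ+ × SL(2, ℤ) ↦ unfoldTerm f g w p.1 p.2 (t, z))
      ((t : ℂ) ^ (w - 1) * (pet f g z * thetaTail h z t)) := by
  have h1 : HasSum (fun v ↦ if v = 0 then 0 else thetaTerm h z t v) (thetaTail h z t) := by
    refine Summable.hasSum ?_
    have h2 := (hasSum_genKernel 0 z ht).2 h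
    refine Summable.of_norm_bounded h2.norm fun v ↦ ?_
    split_ifs <;> simp
  have h2 := ((hasSum_strip_iff z (thetaTerm h z t) _).2 h1).mul_left
    ((t : ℂ) ^ (w - 1) * pet f g z)
  exact HasSum.of_eq h2 (fun p ↦ unfoldTerm_eq f g w p.1 p.2 t z) (by ring)

lemma integral_unfoldTerm {w : ℂ} (hw : 1 + (h / 2 : ℝ) < w.re) (d : ℕ+) (γ : SL(2, ℤ)) :
    let φ : ℍ → ℂ := strip.indicator (fun z ↦ pet f g z * (z.im : ℂ) ^ w)
    Integrable (unfoldTerm f g w d γ) ((volume.restrict (Set.Ioi 0)).prod nu) ∧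
    ∫ p, ‖unfoldTerm f g w d γ p‖ ∂((volume.restrict (Set.Ioi 0)).prod nu) =
      Real.Gamma w.re * π ^ (-w.re) * (d : ℝ) ^ ((h : ℝ) - 2 * w.re) * ∫ z, ‖φ (γ • z)‖ ∂nu ∧
    ∫ p, unfoldTerm f g w d γ p ∂((volume.restrict (Set.Ioi 0)).prod nu) =
      Gamma w * (π : ℂ) ^ (-w) * (1 / (d : ℂ) ^ (2 * w - h)) * ∫ z, φ (γ • z) ∂nu := by
  intro φ
  have hd : (0 : ℝ) < d := by exact_mod_cast d.pos
  have hd0 : (d : ℂ) ≠ 0 := by exact_mod_cast d.ne_zero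
  have hφ : Integrable φ := (integrable_indicator_iff measurableSet_strip).2
    (integrableOn_pet_cpow f g hw)
  have hφγ (z : ℍ) : strip.indicator (pet f g) (γ • z) * ((γ • z).im : ℂ) ^ w = φ (γ • z) := by
    by_cases hz : γ • z ∈ strip <;> simp only [φ, hz, Set.indicator_of_mem,
      Set.indicator_of_notMem, not_false_eq_true, zero_mul]
  have hmγ : Measurable fun z : ℍ ↦ γ • z := measurable_const_smul γ
  have hw0 : 0 < w.re := lt_of_le_of_lt (by positivity) hw
  have key := integral_prod_cpow_mul_exp (ν := nu)
    (Q := fun z ↦ (d : ℂ) ^ h * strip.indicator (pet f g) (γ • z)) (y := fun z ↦ (γ • z).im)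
    ((((continuous_pet f g).measurable.indicator measurableSet_strip).comp hmγ).const_mul _)
    (UpperHalfPlane.continuous_im.measurable.comp hmγ) (fun z ↦ (γ • z).im_pos) hw0
    (c := π * (d : ℝ) ^ 2) (by positivity)
  simp only [mul_assoc, hφγ] at key
  obtain ⟨k1, k2, k3⟩ := key ((integrable_smul_nu hφ γ).const_mul _)
  have hU : unfoldTerm f g w d γ = fun p : ℝ × ℍ ↦ (p.1 : ℂ) ^ (w - 1) * ((d : ℂ) ^ h *
    (strip.indicator (pet f g) (γ • p.2) *
    Real.exp (-(π * (d : ℝ) ^ 2 / (γ • p.2).im * p.1)))) := by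
    funext p; rw [unfoldTerm]; ring
  rw [hU]
  refine ⟨k1, ?_, ?_⟩
  · rw [k2]
    simp only [norm_mul, norm_pow, Complex.norm_natCast]
    rw [integral_const_mul, Real.mul_rpow Real.pi_pos.le (by positivity), Real.rpow_sub hd,
      ← Real.rpow_natCast_mul hd.le, Real.rpow_natCast, div_eq_mul_inv, ← Real.rpow_neg hd.le]
    push_cast
    rw [show (2 : ℝ) * -w.re = -(2 * w.re) by ring]
    ring
  · rw [k3, integral_const_mul]
    have e1 : ((π * (d : ℝ) ^ 2 : ℝ) : ℂ) ^ (-w) = (π : ℂ) ^ (-w) * (d : ℂ) ^ (-(2 * w)) := by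
      rw [Complex.ofReal_mul, mul_cpow_ofReal_nonneg Real.pi_pos.le (by positivity),
        Complex.ofReal_pow, Complex.ofReal_natCast, ← natCast_cpow_natCast_mul]
      push_cast
      rw [show (2 : ℂ) * -w = -(2 * w) by ring]
    rw [e1, one_div, ← cpow_neg, neg_sub, sub_eq_add_neg, cpow_add _ _ hd0, cpow_natCast]
    ring

/-- The part of the theta integral coming from nonzero lattice vectors. -/
def tailInt (t : ℝ) : ℂ := ∫ z, pet f g z * thetaTail h z t ∂nu

lemma pnat_zeta {s : ℂ} (hs : 1 < s.re) :
    HasSum (fun d : ℕ+ ↦ 1 / (d : ℂ) ^ s) (riemannZeta s) := by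
  have h0 : (0 : ℂ) ^ s = 0 := zero_cpow (by rintro rfl; simp at hs; linarith)
  have h1 : Summable fun n : ℕ ↦ 1 / (n : ℂ) ^ s := Complex.summable_one_div_nat_cpow.2 hs
  rw [zeta_eq_tsum_one_div_nat_cpow hs]
  have h2 := h1.hasSum
  have h3 := (PNat.coe_injective.hasSum_iff (f := fun n : ℕ ↦ 1 / (n : ℂ) ^ s)
    (a := ∑' n : ℕ, 1 / (n : ℂ) ^ s) ?_).2 h2
  · exact h3
  · intro x hx
    have : x = 0 := by
      by_contra h
      exact hx ⟨⟨x, Nat.pos_of_ne_zero h⟩, rfl⟩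
    simp [this, h0]

theorem hasMellin_tailInt {w : ℂ} (hw : 1 + (h / 2 : ℝ) < w.re) :
    HasMellin (tailInt f g) w (Gamma w * (π : ℂ) ^ (-w) * riemannZeta (2 * w - h) *
      ∫ z in strip, pet f g z * (z.im : ℂ) ^ w) := by
  set φ : ℍ → ℂ := strip.indicator (fun z ↦ pet f g z * (z.im : ℂ) ^ w) with hφdef
  have hφ : Integrable φ := (integrable_indicator_iff measurableSet_strip).2
    (integrableOn_pet_cpow f g hw)
  have hre : 1 < (2 * w - h).re := by simp; linarith
  have hz := pnat_zeta hre
  have hsum : Summable fun p : ℕ+ × SL(2, ℤ) ↦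
      ∫ q, ‖unfoldTerm f g w p.1 p.2 q‖ ∂((volume.restrict (Set.Ioi 0)).prod nu) := by
    have h1 : Summable fun d : ℕ+ ↦ Real.Gamma w.re * π ^ (-w.re) *
        (d : ℝ) ^ ((h : ℝ) - 2 * w.re) := by
      refine (hz.summable.norm.congr fun d ↦ ?_).mul_left _
      rw [norm_div, norm_one, Complex.norm_natCast_cpow_of_pos d.pos, one_div,
        ← Real.rpow_neg (by positivity)]
      congr 1
      simp
    have h2 : Summable fun γ : SL(2, ℤ) ↦ ∫ z, ‖φ (γ • z)‖ ∂nu := by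
      have := (hasSum_integral_unfold (φ := fun z ↦ ((‖φ z‖ : ℝ) : ℂ)) hφ.norm.ofReal).summable
      simp only [integral_complex_ofReal] at this
      exact Complex.summable_ofReal.1 this
    refine (h1.mul_of_nonneg h2 (fun d ↦ ?_) (fun γ ↦ integral_nonneg fun z ↦ norm_nonneg _)).congr
      fun p ↦ ((integral_unfoldTerm f g hw p.1 p.2).2.1).symm
    have : 0 < Real.Gamma w.re := Real.Gamma_pos_of_pos (lt_of_le_of_lt (by positivity) hw)
    exact mul_nonneg (mul_nonneg this.le (Real.rpow_nonneg Real.pi_pos.le _))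
      (Real.rpow_nonneg (by positivity) _)
  have hae : ∀ᵐ q ∂((volume.restrict (Set.Ioi (0 : ℝ))).prod nu),
      HasSum (fun p : ℕ+ × SL(2, ℤ) ↦ unfoldTerm f g w p.1 p.2 q)
        ((q.1 : ℂ) ^ (w - 1) * (pet f g q.2 * thetaTail h q.2 q.1)) := by
    have : ∀ᵐ q ∂((volume.restrict (Set.Ioi (0 : ℝ))).prod nu), q.1 ∈ Set.Ioi (0 : ℝ) :=
      Measure.quasiMeasurePreserving_fst.ae (self_mem_ae_restrict measurableSet_Ioi)
    filter_upwards [this] with q hq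
    exact hasSum_unfoldTerm f g w hq q.2
  obtain ⟨hI, hS⟩ := integrable_of_hasSum
    (fun p : ℕ+ × SL(2, ℤ) ↦ (integral_unfoldTerm f g hw p.1 p.2).1) hsum hae
  have hpt (t : ℝ) : ∫ z, (t : ℂ) ^ (w - 1) * (pet f g z * thetaTail h z t) ∂nu =
      (t : ℂ) ^ (w - 1) • tailInt f g t := by
    rw [integral_const_mul, tailInt, smul_eq_mul]
  refine ⟨?_, ?_⟩
  · have := hI.integral_prod_left
    simp only [hpt] at this
    exact this
  · have h3 := integral_prod _ hI
    simp only [hpt] at h3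
    rw [mellin, ← h3, ← integral_indicator measurableSet_strip]
    have h4 := (hz.mul_left (Gamma w * (π : ℂ) ^ (-w)))
    have h5 := hasSum_integral_unfold hφ
    have h6 := hasSum_mul_prod h4 h5
    exact hS.unique (HasSum.of_eq h6 (fun p ↦ (integral_unfoldTerm f g hw p.1 p.2).2.2) rfl)

end Unfold

end QMF

/-! ## The Rankin–Selberg functional equation -/

namespace QMF
open scoped Real Topology Modular MatrixGroups ENNReal ComplexConjugate
open UpperHalfPlane hiding I
open MeasureTheory

section Theta

variable {k : ℤ} {h : ℕ} (f : CuspForm 𝒮ℒ k) (g : CuspForm 𝒮ℒ (k + h))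

/-- The Petersson product, as a complex number, for forms of weights `k` and `k + h`. -/
def petInt : ℂ := ∫ z, pet f g z ∂nu

/-- The value of the theta integral at infinity. -/
def petIntZero : ℂ := if h = 0 then petInt f g else 0

/-- The theta integral. -/
def petTheta (t : ℝ) : ℂ := petIntZero f g + tailInt f g t

lemma exists_pet_bound_fd (N : ℕ) : ∃ C : ℝ, 0 < C ∧ ∀ z ∈ (𝒟 : Set ℍ),
    ‖pet f g z‖ * z.im ^ N ≤ C := by
  obtain ⟨C, hC, hb⟩ := exists_pet_bound f g N
  refine ⟨C * (1 / 2) ^ (-(h / 2 : ℝ)), by positivity, fun z hz ↦ ?_⟩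
  have h1 := half_le_im_of_mem_fd hz
  calc ‖pet f g z‖ * z.im ^ N ≤ C * z.im ^ (-(h / 2 : ℝ) - N) * z.im ^ N :=
        mul_le_mul_of_nonneg_right (hb z).2 (pow_nonneg z.im_pos.le _)
    _ = C * z.im ^ (-(h / 2 : ℝ)) := by
        rw [mul_assoc, ← Real.rpow_natCast, ← Real.rpow_add z.im_pos, sub_add_cancel]
    _ ≤ _ := by
        refine mul_le_mul_of_nonneg_left ?_ hC.le
        exact Real.rpow_le_rpow_of_nonpos (by norm_num) h1 (neg_nonpos.2 (by positivity))

lemma integrable_pet : Integrable (pet f g) nu := by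
  obtain ⟨C, hC, hb⟩ := exists_pet_bound_fd f g 0
  refine Integrable.of_bound (continuous_pet f g).aestronglyMeasurable C ?_
  filter_upwards [ae_mem_fd] with z hz
  simpa using hb z hz

lemma continuous_thetaTerm (h : ℕ) (t : ℝ) (v : Fin 2 → ℤ) :
    Continuous fun z : ℍ ↦ thetaTerm h z t v := by
  unfold thetaTerm lin
  have h1 : Continuous fun z : ℍ ↦ (z : ℂ) := UpperHalfPlane.continuous_coe
  have h2 : Continuous fun z : ℍ ↦ ((starRingEnd ℂ) (z : ℂ)) := Complex.continuous_conj.comp h1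
  refine ((((continuous_const.mul h2).add continuous_const)).pow h).mul
    (Complex.continuous_ofReal.comp (Real.continuous_exp.comp ?_))
  exact (continuous_const.mul (((continuous_const.mul h1).add continuous_const).norm.pow 2)).div
    UpperHalfPlane.continuous_im fun z ↦ z.im_ne_zero

lemma summable_tail (h : ℕ) (z : ℍ) {t : ℝ} (ht : 0 < t) :
    HasSum (fun v ↦ if v = 0 then 0 else thetaTerm h z t v) (thetaTail h z t) := by
  refine Summable.hasSum ?_
  have h2 := (hasSum_genKernel 0 z ht).2 h
  refine Summable.of_norm_bounded h2.norm fun v ↦ ?_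
  split_ifs <;> simp

lemma measurable_thetaTail (h : ℕ) {t : ℝ} (ht : 0 < t) :
    AEStronglyMeasurable (fun z : ℍ ↦ thetaTail h z t) nu := by
  refine aestronglyMeasurable_of_tendsto_ae atTop
    (f := fun (s : Finset (Fin 2 → ℤ)) z ↦ ∑ v ∈ s, if v = 0 then 0 else thetaTerm h z t v)
    (fun s ↦ (Continuous.aestronglyMeasurable ?_))
    (Eventually.of_forall fun z ↦ summable_tail h z ht)
  refine continuous_finsetSum _ fun v _ ↦ ?_
  split_ifs
  · exact continuous_const
  · exact continuous_thetaTerm h t v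

lemma exists_pet_mul_tail_bound (N : ℕ) (hN : h + 3 ≤ 2 * N) : ∃ C : ℝ, 0 < C ∧
    ∀ t : ℝ, 0 < t → ∀ᵐ z ∂nu, ‖pet f g z * thetaTail h z t‖ ≤ C / t ^ N := by
  obtain ⟨C, hC, hb⟩ := exists_pet_bound_fd f g N
  obtain ⟨C', hC', hb'⟩ := exists_thetaTail_bound h N hN
  refine ⟨C * C', by positivity, fun t ht ↦ ?_⟩
  filter_upwards [ae_mem_fd] with z hz
  calc ‖pet f g z * thetaTail h z t‖ ≤ ‖pet f g z‖ * (C' * (z.im ^ N / t ^ N)) := by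
        rw [norm_mul]; exact mul_le_mul_of_nonneg_left (hb' z hz t ht) (norm_nonneg _)
    _ = ‖pet f g z‖ * z.im ^ N * C' / t ^ N := by ring
    _ ≤ _ := by gcongr; exact hb z hz

lemma integrable_pet_mul_tail {t : ℝ} (ht : 0 < t) :
    Integrable (fun z ↦ pet f g z * thetaTail h z t) nu := by
  obtain ⟨C, hC, hb⟩ := exists_pet_mul_tail_bound f g (h + 3) (by omega)
  exact Integrable.of_bound ((continuous_pet f g).aestronglyMeasurable.mul
    (measurable_thetaTail h ht)) _ (hb t ht)

lemma exists_tailInt_bound (N : ℕ) (hN : h + 3 ≤ 2 * N) : ∃ C : ℝ, 0 < C ∧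
    ∀ t : ℝ, 0 < t → ‖tailInt f g t‖ ≤ C / t ^ N := by
  obtain ⟨C, hC, hb⟩ := exists_pet_mul_tail_bound f g N hN
  refine ⟨C * (nu.real Set.univ + 1), by positivity, fun t ht ↦ ?_⟩
  refine (norm_integral_le_of_norm_le_const (hb t ht)).trans ?_
  rw [div_mul_eq_mul_div]
  gcongr
  linarith

lemma petTheta_eq {t : ℝ} (ht : 0 < t) :
    petTheta f g t = ∫ z, pet f g z * thetaKernel h z t ∂nu := by
  simp only [thetaKernel_eq_tail h _ ht, mul_add]
  rw [integral_add ((integrable_pet f g).mul_const _) (integrable_pet_mul_tail f g ht),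
    integral_mul_const, petTheta, petIntZero, petInt, tailInt]
  split_ifs <;> simp

lemma petTheta_inv {t : ℝ} (ht : 0 < t) :
    petTheta f g (1 / t) = (t : ℂ) ^ (h + 1) * petTheta f g t := by
  rw [petTheta_eq f g ht, petTheta_eq f g (one_div_pos.2 ht), ← integral_const_mul]
  refine integral_congr_ae (Eventually.of_forall fun z ↦ ?_)
  simp only
  rw [thetaKernel_functional_equation h z (one_div_pos.2 ht), one_div_one_div]
  simp only [Complex.ofReal_div, Complex.ofReal_one, one_div_one_div]
  ring

lemma tailInt_isBigO (r : ℝ) : (fun t ↦ petTheta f g t - petIntZero f g) =O[atTop] (· ^ r) := by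
  obtain ⟨N, hN⟩ := exists_nat_gt (-r)
  obtain ⟨C, hC, hb⟩ := exists_tailInt_bound f g (N + h + 3) (by omega)
  refine Asymptotics.IsBigO.of_bound C ?_
  filter_upwards [eventually_ge_atTop 1] with t ht
  have ht0 : 0 < t := by linarith
  rw [petTheta, add_sub_cancel_left, Real.norm_of_nonneg (Real.rpow_nonneg ht0.le _)]
  refine (hb t ht0).trans ?_
  rw [div_eq_mul_inv, ← Real.rpow_natCast, ← Real.rpow_neg ht0.le]
  refine mul_le_mul_of_nonneg_left (Real.rpow_le_rpow_of_exponent_le ht ?_) hC.le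
  push_cast
  linarith

lemma petTheta_locallyIntegrableOn : LocallyIntegrableOn (petTheta f g) (Set.Ioi 0) := by
  have hw : 1 + (h / 2 : ℝ) < ((h + 2 : ℕ) : ℂ).re := by
    rw [Complex.natCast_re]; push_cast
    have : (0 : ℝ) ≤ h := by positivity
    linarith
  have h1 : IntegrableOn (fun t : ℝ ↦ (t : ℂ) ^ (((h + 2 : ℕ) : ℂ) - 1) • tailInt f g t)
    (Set.Ioi 0) := (hasMellin_tailInt f g hw).1
  have h2 : LocallyIntegrableOn (fun t : ℝ ↦ ((t : ℂ) ^ (h + 1))⁻¹ *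
      ((t : ℂ) ^ (((h + 2 : ℕ) : ℂ) - 1) • tailInt f g t)) (Set.Ioi 0) := by
    refine h1.locallyIntegrableOn.continuousOn_mul ?_ isOpen_Ioi.isLocallyClosed
    refine ContinuousOn.inv₀ (by fun_prop) fun t ht ↦ ?_
    exact pow_ne_zero _ (by exact_mod_cast (ne_of_gt ht))
  have h3 : LocallyIntegrableOn (tailInt f g) (Set.Ioi 0) := by
    intro x hx
    obtain ⟨s, hs, hi⟩ := h2 x hx
    refine ⟨s ∩ Set.Ioi 0, inter_mem hs self_mem_nhdsWithin, ?_⟩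
    refine (hi.mono_set Set.inter_subset_left).congr_fun_ae ?_
    filter_upwards [ae_restrict_of_ae_restrict_of_subset Set.inter_subset_right
      (self_mem_ae_restrict measurableSet_Ioi)] with t ht
    have ht0 : (t : ℂ) ≠ 0 := by exact_mod_cast (ne_of_gt ht)
    have e : ((h + 2 : ℕ) : ℂ) - 1 = (h + 1 : ℕ) := by push_cast; ring
    rw [e, cpow_natCast, smul_eq_mul, inv_mul_cancel_left₀ (pow_ne_zero _ ht0)]
  exact (locallyIntegrableOn_const _).add h3

def petPair : WeakFEPair ℂ where
  f := petTheta f g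
  g := petTheta f g
  k := h + 1
  ε := 1
  f₀ := petIntZero f g
  g₀ := petIntZero f g
  hf_int := petTheta_locallyIntegrableOn f g
  hg_int := petTheta_locallyIntegrableOn f g
  hk := by positivity
  hε := one_ne_zero
  h_feq x hx := by
    rw [petTheta_inv f g hx, smul_eq_mul, one_mul]
    congr 1
    rw [← Nat.cast_succ, Real.rpow_natCast]
    push_cast
    rfl
  hf_top := tailInt_isBigO f g
  hg_top := tailInt_isBigO f g

lemma petPair_eq {w : ℂ} (hw : (h : ℝ) + 1 < w.re) : (petPair f g).Λ w =
    Gamma w * (π : ℂ) ^ (-w) * riemannZeta (2 * w - h) *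
      ∫ z in strip, pet f g z * (z.im : ℂ) ^ w := by
  have h1 := (hasMellin_tailInt f g (w := w)
    (by have : (0 : ℝ) ≤ h := by positivity
        linarith)).2
  rw [← ((petPair f g).hasMellin hw).2, ← h1]
  congr 1
  funext t
  simp [petPair, petTheta]

lemma petPair_eq_of_zero (h0 : petIntZero f g = 0) {w : ℂ} (hw : 1 + (h / 2 : ℝ) < w.re) :
    (petPair f g).Λ w = Gamma w * (π : ℂ) ^ (-w) * riemannZeta (2 * w - h) *
      ∫ z in strip, pet f g z * (z.im : ℂ) ^ w := by
  have hP : IsStrongFEPair (petPair f g) := ⟨h0, h0⟩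
  rw [← (hasMellin_tailInt f g hw).2, ← (hP.hasMellin w).2]
  congr 1
  funext t
  simp [petPair, petTheta, h0]

lemma differentiable_petPair (h0 : petIntZero f g = 0) : Differentiable ℂ (petPair f g).Λ :=
  IsStrongFEPair.differentiable_Λ ⟨h0, h0⟩

/-! ### The Dirichlet series -/

lemma strip_inner (w : ℂ) {y : ℝ} (hy : 0 < y) :
    ((1 / y ^ 2 : ℝ) : ℂ) * ∫ x in Set.Ico (0 : ℝ) 1,
      pet f g (pt (x, y)) * ((pt (x, y)).im : ℂ) ^ w =
    (y : ℂ) ^ ((w + k - 1) - 1) * ∫ x in Set.Ico (0 : ℝ) 1, f (pt (x, y)) * conj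
        (g (pt (x, y))) := by
  have hy0 : (y : ℂ) ≠ 0 := by exact_mod_cast hy.ne'
  simp only [pet, im_pt hy]
  rw [← integral_const_mul, ← integral_const_mul]
  refine integral_congr_ae (Eventually.of_forall fun x ↦ ?_)
  have e : (w + k - 1) - 1 = w + k - (2 : ℕ) := by push_cast; ring
  simp only [e]
  rw [cpow_sub _ _ hy0, cpow_add _ _ hy0, cpow_natCast, cpow_intCast]
  push_cast
  ring

lemma integral_strip_pet {w : ℂ} (hw : 1 + (h / 2 : ℝ) < w.re) :
    MellinConvergent (fun y ↦ ∫ x in Set.Ico (0 : ℝ) 1, f (pt (x, y)) * conj (g (pt (x, y))))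
      (w + k - 1) ∧
    ∫ z in strip, pet f g z * (z.im : ℂ) ^ w =
      mellin (fun y ↦ ∫ x in Set.Ico (0 : ℝ) 1, f (pt (x, y)) * conj (g (pt (x, y))))
        (w + k - 1) := by
  obtain ⟨h1, h2⟩ := integral_strip_aux (integrableOn_pet_cpow f g hw)
  refine ⟨h1.congr_fun (fun y hy ↦ strip_inner f g w hy) measurableSet_Ioi, h2.trans ?_⟩
  exact setIntegral_congr_fun measurableSet_Ioi fun y hy ↦ strip_inner f g w hy

end Theta

/-- Transport of a cusp form along an equality of weights. -/
def castWt {k l : ℤ} (e : k = l) (f : CuspForm 𝒮ℒ k) : CuspForm 𝒮ℒ l := e ▸ f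

lemma castWt_apply {k l : ℤ} (e : k = l) (f : CuspForm 𝒮ℒ k) (z : ℍ) : castWt e f z = f z := by
  subst e; rfl

lemma cf_castWt {k l : ℤ} (e : k = l) (f : CuspForm 𝒮ℒ k) (n : ℕ) :
    cf (castWt e f) n = cf f n := by
  subst e; rfl

section Dirichlet

variable {k l : ℤ}

lemma summable_cf_sq (f : CuspForm 𝒮ℒ k) (hk : 0 < k) {σ : ℝ} (hσ : 1 < σ) :
    Summable fun n : ℕ ↦ ‖cf f n‖ ^ 2 * (n : ℝ) ^ (-(σ + k - 1)) := by
  have hk' : (0 : ℝ) < k := by exact_mod_cast hk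
  have hs0 : 0 < ((σ : ℂ) + k - 1).re := by simp; linarith
  obtain ⟨hInt, -⟩ := integral_strip_pet f (castWt (by simp) f : CuspForm 𝒮ℒ (k + (0 : ℕ)))
    (w := σ) (by simpa using hσ)
  set G : ℝ → ℂ := fun y ↦ ∫ x in Set.Ico (0 : ℝ) 1, f (pt (x, y)) *
    conj ((castWt (by simp) f : CuspForm 𝒮ℒ (k + (0 : ℕ))) (pt (x, y))) with hG
  have hGs {y : ℝ} (hy : 0 < y) : HasSum (fun n : ℕ ↦ ‖cf f n‖ ^ 2 * Real.exp (-(4 * π * n) * y))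
      (G y).re := by
    have := Complex.reCLM.hasSum (hasSum_parseval f
      (castWt (by simp) f : CuspForm 𝒮ℒ (k + (0 : ℕ))) hy)
    refine HasSum.of_eq this (fun n ↦ ?_) rfl
    rw [cf_castWt, Complex.mul_conj, Complex.normSq_eq_norm_sq, ← Complex.ofReal_mul]
    rfl
  have hterm (n : ℕ) (hn : n ≠ 0) : ‖cf f n‖ ^ 2 * (n : ℝ) ^ (-(σ + k - 1)) =
      (Real.Gamma (σ + k - 1))⁻¹ * (4 * π) ^ (σ + k - 1) *
      ∫ y in Set.Ioi (0 : ℝ), ‖cf f n‖ ^ 2 *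
        ‖(y : ℂ) ^ (((σ : ℂ) + k - 1) - 1) * (Real.exp (-((4 * π * n) * y)) : ℂ)‖ := by
    have hn0 : (0 : ℝ) < n := by positivity
    have hre : ((σ : ℂ) + k - 1).re = σ + k - 1 := by simp
    rw [integral_const_mul, integral_norm_cpow_mul_exp hs0 (by positivity), hre,
      Real.mul_rpow (by positivity) hn0.le, Real.rpow_neg (by positivity : (0 : ℝ) ≤ 4 * π)]
    have h1 : Real.Gamma (σ + k - 1) ≠ 0 := (Real.Gamma_pos_of_pos (by rwa [hre] at hs0)).ne'
    have h2 : (4 * π : ℝ) ^ (σ + k - 1) ≠ 0 := (Real.rpow_pos_of_pos (by positivity) _).ne'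
    field_simp
  have hi (n : ℕ) (hn : n ≠ 0) : IntegrableOn (fun y : ℝ ↦ ‖cf f n‖ ^ 2 *
        ‖(y : ℂ) ^ (((σ : ℂ) + k - 1) - 1) * (Real.exp (-((4 * π * n) * y)) : ℂ)‖) (Set.Ioi 0) :=
    ((integrableOn_cpow_mul_exp hs0 (r := 4 * π * n) (by positivity)).norm).const_mul _
  have hGam : 0 < Real.Gamma (σ + k - 1) := Real.Gamma_pos_of_pos (by linarith)
  refine summable_of_sum_le (c := (Real.Gamma (σ + k - 1))⁻¹ * (4 * π) ^ (σ + k - 1) *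
      ∫ y in Set.Ioi (0 : ℝ), ‖(y : ℂ) ^ (((σ : ℂ) + k - 1) - 1) • G y‖)
    (fun n ↦ by positivity) fun s ↦ ?_
  have hs1 : ∑ n ∈ s, ‖cf f n‖ ^ 2 * (n : ℝ) ^ (-(σ + k - 1)) =
      ∑ n ∈ s.erase 0, ‖cf f n‖ ^ 2 * (n : ℝ) ^ (-(σ + k - 1)) := by
    refine (Finset.sum_erase s ?_).symm
    simp [cf_zero]
  have hne {n : ℕ} (hn : n ∈ s.erase 0) : n ≠ 0 := (Finset.mem_erase.1 hn).1
  rw [hs1, Finset.sum_congr rfl fun n hn ↦ hterm n (hne hn), ← Finset.mul_sum,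
    ← integral_finsetSum _ fun n hn ↦ hi n (hne hn)]
  refine mul_le_mul_of_nonneg_left ?_ (by positivity)
  refine setIntegral_mono_on (integrable_finsetSum _ fun n hn ↦ hi n (hne hn)) hInt.norm
    measurableSet_Ioi fun y hy ↦ ?_
  simp only [norm_mul, norm_smul, Complex.norm_real, Real.norm_of_nonneg (Real.exp_pos _).le]
  calc _ = ‖(y : ℂ) ^ ((σ : ℂ) + k - 1 - 1)‖ *
        ∑ n ∈ s.erase 0, ‖cf f n‖ ^ 2 * Real.exp (-(4 * π * n) * y) := by
        rw [Finset.mul_sum]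
        refine Finset.sum_congr rfl fun n _ ↦ ?_
        rw [neg_mul]; ring
    _ ≤ _ := by
        refine mul_le_mul_of_nonneg_left ?_ (norm_nonneg _)
        refine (sum_le_hasSum _ (fun n _ ↦ by positivity) (hGs hy)).trans ?_
        exact Complex.re_le_norm _

end Dirichlet

end QMF

/-! ## Analytic properties of Rankin–Selberg series -/

namespace QMF
open scoped Real Topology Modular MatrixGroups ENNReal ComplexConjugate
open UpperHalfPlane hiding I
open MeasureTheory

section Dirichlet

variable {k l : ℤ}

/-- Normalized Fourier coefficients. -/
def lam (f : CuspForm 𝒮ℒ k) (n : ℕ) : ℂ := cf f n * ((n : ℝ) ^ (-((k : ℝ) - 1) / 2) : ℝ)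

lemma lam_castWt (e : k = l) (f : CuspForm 𝒮ℒ k) (n : ℕ) : lam (castWt e f) n = lam f n := by
  subst e; rfl

lemma norm_lam_sq (f : CuspForm 𝒮ℒ k) {n : ℕ} (hn : n ≠ 0) :
    ‖lam f n‖ ^ 2 = ‖cf f n‖ ^ 2 * (n : ℝ) ^ (-((k : ℝ) - 1)) := by
  have hn0 : (0 : ℝ) < n := by positivity
  rw [lam, norm_mul, mul_pow, Complex.norm_real, Real.norm_of_nonneg (by positivity),
    ← Real.rpow_mul_natCast hn0.le]
  congr 2
  push_cast
  ring

lemma lam_zero (f : CuspForm 𝒮ℒ k) : lam f 0 = 0 := by simp [lam, cf_zero]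

lemma summable_lam_sq (f : CuspForm 𝒮ℒ k) (hk : 0 < k) {σ : ℝ} (hσ : 1 < σ) :
    Summable fun n : ℕ ↦ ‖lam f n‖ ^ 2 * (n : ℝ) ^ (-σ) := by
  refine (summable_cf_sq f hk hσ).congr fun n ↦ ?_
  rcases eq_or_ne n 0 with rfl | hn
  · simp [lam_zero, cf_zero]
  · have hn0 : (0 : ℝ) < n := by positivity
    rw [norm_lam_sq f hn, mul_assoc, ← Real.rpow_add hn0]
    congr 2
    ring

lemma summable_lam_mul (f : CuspForm 𝒮ℒ k) (g : CuspForm 𝒮ℒ l) (hk : 0 < k) (hl : 0 < l)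
    {σ : ℝ} (hσ : 1 < σ) : Summable fun n : ℕ ↦ ‖lam f n * conj (lam g n)‖ * (n : ℝ) ^ (-σ) := by
  refine Summable.of_nonneg_of_le (fun n ↦ by positivity) (fun n ↦ ?_)
    ((summable_lam_sq f hk hσ).add (summable_lam_sq g hl hσ))
  rw [← add_mul, norm_mul, RCLike.norm_conj]
  refine mul_le_mul_of_nonneg_right ?_ (by positivity)
  nlinarith [sq_nonneg (‖lam f n‖ - ‖lam g n‖), sq_nonneg (‖lam f n‖), sq_nonneg (‖lam g n‖)]

lemma LSeriesSummable_lam (f : CuspForm 𝒮ℒ k) (g : CuspForm 𝒮ℒ l) (hk : 0 < k) (hl : 0 < l)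
    {s : ℂ} (hs : 1 < s.re) : LSeriesSummable (fun n ↦ lam f n * conj (lam g n)) s := by
  refine Summable.of_norm_bounded (summable_lam_mul f g hk hl hs) fun n ↦ ?_
  rcases eq_or_ne n 0 with rfl | hn
  · simp [lam_zero]
  · rw [LSeries.norm_term_eq, if_neg hn, div_eq_mul_inv, ← Real.rpow_neg (by positivity)]

/-- The Rankin–Selberg integral is a Dirichlet series. -/
lemma integral_strip_pet_eq {h : ℕ} (f : CuspForm 𝒮ℒ k) (g : CuspForm 𝒮ℒ (k + h)) (hk : 0 < k)
    {s : ℂ} (hs : 1 < s.re) :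
    ∫ z in strip, pet f g z * (z.im : ℂ) ^ (s + h / 2) =
      Gamma (s + h / 2 + k - 1) * (4 * π : ℂ) ^ (-(s + h / 2 + k - 1)) *
        LSeries (fun n ↦ lam f n * conj (lam g n)) s := by
  have hk' : (1 : ℝ) ≤ k := by exact_mod_cast hk
  have hw : 1 + (h / 2 : ℝ) < (s + h / 2).re := by simp; linarith
  have hre : (s + h / 2 + k - 1).re = s.re + h / 2 + k - 1 := by simp
  have hL := LSeriesSummable_lam f g hk (by omega) hs
  have hterm (n : ℕ) (hn : n ≠ 0) : cf f n * conj (cf g n) / (n : ℂ) ^ (s + h / 2 + k - 1) =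
      LSeries.term (fun n ↦ lam f n * conj (lam g n)) s n := by
    have hn0 : (0 : ℝ) < n := by positivity
    have hnc : (n : ℂ) ≠ 0 := by exact_mod_cast hn
    rw [LSeries.term_of_ne_zero hn, lam, lam, map_mul, Complex.conj_ofReal,
      Complex.ofReal_cpow hn0.le, Complex.ofReal_cpow hn0.le, Complex.ofReal_natCast,
      div_eq_mul_inv (_ * _) ((n : ℂ) ^ (s + h / 2 + k - 1)), ← cpow_neg,
      div_eq_mul_inv (_ * _) ((n : ℂ) ^ s), ← cpow_neg]
    rw [show -(s + h / 2 + k - 1) = (((-((k : ℝ) - 1) / 2 : ℝ) : ℂ) +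
      ((-(((k + h : ℤ) : ℝ) - 1) / 2 : ℝ) : ℂ)) + -s by push_cast; ring, cpow_add _ _ hnc,
      cpow_add _ _ hnc]
    ring
  rw [(integral_strip_pet f g hw).2]
  have hp (n : ℕ) (hn : n ≠ 0) : ((4 * π * n : ℝ) : ℂ) ^ (s + h / 2 + k - 1) =
      (4 * π : ℂ) ^ (s + h / 2 + k - 1) * (n : ℂ) ^ (s + h / 2 + k - 1) := by
    rw [Complex.ofReal_mul, mul_cpow_ofReal_nonneg (by positivity) (by positivity)]
    push_cast
    rfl
  have key := hasSum_mellin (a := fun n ↦ cf f n * conj (cf g n)) (p := fun n : ℕ ↦ 4 * π * n)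
    (s := s + h / 2 + k - 1) (F := fun y ↦ ∫ x in Set.Ico (0 : ℝ) 1, f (pt (x, y)) *
      conj (g (pt (x, y)))) (fun n ↦ ?_) ?_ (fun t ht ↦ hasSum_parseval f g ht) ?_
  · refine key.unique (HasSum.of_eq (hL.hasSum.mul_left (Gamma (s + h / 2 + k - 1) *
      (4 * π : ℂ) ^ (-(s + h / 2 + k - 1)))) (fun n ↦ ?_) rfl)
    rcases eq_or_ne n 0 with rfl | hn
    · simp [cf_zero]
    · rw [hp n hn, ← hterm n hn, cpow_neg]
      ring
  · rcases eq_or_ne n 0 with rfl | hn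
    · simp [cf_zero]
    · right; positivity
  · rw [hre]
    have : (0 : ℝ) ≤ h := by positivity
    linarith
  · rw [hre]
    refine ((hL.norm).mul_left (((4 * π) ^ (s.re + h / 2 + k - 1))⁻¹)).congr fun n ↦ ?_
    rcases eq_or_ne n 0 with rfl | hn
    · simp [cf_zero]
    · have hn0 : (0 : ℝ) < n := by positivity
      rw [← hterm n hn, norm_div, ← Complex.ofReal_natCast,
        Complex.norm_cpow_eq_rpow_re_of_pos hn0, hre, Real.mul_rpow (by positivity) hn0.le]
      field_simp

/-! ### The Petersson inner product -/

instance : (volume : Measure ℍ).IsOpenPosMeasure := by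
  refine ⟨fun U hU hne h0 ↦ ?_⟩
  have hac : (volume : Measure ℂ).comap UpperHalfPlane.coe ≪ (volume : Measure ℍ) := by
    rw [UpperHalfPlane.volume_def]
    refine withDensity_absolutelyContinuous' ?_ ?_
    · refine Measurable.aemeasurable ?_
      have hm : Measurable fun z : ℍ ↦ NNReal.mk z.im z.im_pos.le :=
        UpperHalfPlane.continuous_im.measurable.subtype_mk
      exact ((measurable_const.div hm).pow_const 2).coe_nnreal_ennreal
    · refine Eventually.of_forall fun z ↦ ?_
      rw [Ne, ENNReal.coe_eq_zero]
      exact pow_ne_zero 2 (one_div_ne_zero fun h ↦ z.im_ne_zero (congrArg NNReal.toReal h))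
  have h1 := hac h0
  rw [measurableEmbedding_coe.comap_apply] at h1
  exact (isOpenEmbedding_coe.isOpenMap U hU).measure_ne_zero volume (hne.image _) h1

/-- The Petersson inner product. -/
def petInner (f g : CuspForm 𝒮ℒ k) : ℂ := ∫ z, f z * conj (g z) * (z.im : ℂ) ^ k ∂nu

lemma petInt_castWt (f g : CuspForm 𝒮ℒ k) (e : k = k + (0 : ℕ)) :
    petInt f (castWt e g) = petInner f g := by
  simp only [petInt, pet, petInner, castWt_apply]

lemma integrable_petInner (f g : CuspForm 𝒮ℒ k) :
    Integrable (fun z : ℍ ↦ f z * conj (g z) * (z.im : ℂ) ^ k) nu := by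
  have := integrable_pet f (castWt (by simp) g : CuspForm 𝒮ℒ (k + (0 : ℕ)))
  unfold pet at this
  simpa only [castWt_apply] using this

lemma petInner_smul_invariant (f g : CuspForm 𝒮ℒ k) (γ : SL(2, ℤ)) (z : ℍ) :
    f (γ • z) * conj (g (γ • z)) * ((γ • z).im : ℂ) ^ k = f z * conj (g z) * (z.im : ℂ) ^ k := by
  have := pet_smul f (castWt (by simp) g : CuspForm 𝒮ℒ (k + (0 : ℕ))) γ z
  simpa only [pet, castWt_apply, pow_zero, one_mul] using this

lemma continuous_petInner (f g : CuspForm 𝒮ℒ k) :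
    Continuous (fun z : ℍ ↦ f z * conj (g z) * (z.im : ℂ) ^ k) := by
  have := continuous_pet f (castWt (by simp) g : CuspForm 𝒮ℒ (k + (0 : ℕ)))
  unfold pet at this
  simpa only [castWt_apply] using this

lemma petInner_self_eq (f : CuspForm 𝒮ℒ k) (z : ℍ) :
    f z * conj (f z) * (z.im : ℂ) ^ k = ((‖f z‖ ^ 2 * z.im ^ k : ℝ) : ℂ) := by
  rw [Complex.mul_conj, Complex.normSq_eq_norm_sq]; push_cast; rfl

lemma petInner_self (f : CuspForm 𝒮ℒ k) :
    petInner f f = ((∫ z, ‖f z‖ ^ 2 * z.im ^ k ∂nu : ℝ) : ℂ) := by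
  simp only [petInner, petInner_self_eq]
  exact integral_complex_ofReal

lemma petInner_self_re_nonneg (f : CuspForm 𝒮ℒ k) : 0 ≤ (petInner f f).re := by
  rw [petInner_self, Complex.ofReal_re]
  exact integral_nonneg fun z ↦ by have := z.im_pos; positivity

lemma petInner_definite (f : CuspForm 𝒮ℒ k) (h : petInner f f = 0) : f = 0 := by
  have hi := integrable_petInner f f
  rw [petInner_self, Complex.ofReal_eq_zero, integral_eq_zero_iff_of_nonneg] at h
  · have hc := continuous_petInner f f
    have hz : ∀ᵐ z ∂nu, f z * conj (f z) * (z.im : ℂ) ^ k = 0 := by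
      filter_upwards [h] with z hz
      rw [petInner_self_eq, hz]; simp
    have hv : ∀ᵐ z ∂(volume : Measure ℍ), f z * conj (f z) * (z.im : ℂ) ^ k = 0 := by
      rw [← sum_map_nu, Measure.ae_sum_iff]
      intro γ
      refine (ae_map_iff (measurable_const_smul γ).aemeasurable
        (hc.measurable (measurableSet_singleton 0))).2 ?_
      simp only [Set.mem_singleton_iff]
      filter_upwards [hz] with z hz
      rw [petInner_smul_invariant, hz]
    have h0 := Continuous.ae_eq_iff_eq volume hc continuous_const |>.1 hv
    ext z
    have h1 := congrFun h0 z
    rw [petInner_self_eq, Complex.ofReal_eq_zero] at h1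
    have h2 : z.im ^ k ≠ 0 := (zpow_pos z.im_pos _).ne'
    simpa [h2] using h1
  · exact fun z ↦ by have := z.im_pos; simp only [Pi.zero_apply]; positivity
  · refine hi.re.congr (Eventually.of_forall fun z ↦ ?_)
    simp only [petInner_self_eq]
    exact Complex.ofReal_re _

lemma petInner_conj (f g : CuspForm 𝒮ℒ k) : conj (petInner f g) = petInner g f := by
  rw [petInner, ← integral_conj, petInner]
  refine integral_congr_ae (Eventually.of_forall fun z ↦ ?_)
  simp only [map_mul, Complex.conj_conj, map_zpow₀, Complex.conj_ofReal]
  ring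

lemma petInner_add_left (f g e : CuspForm 𝒮ℒ k) :
    petInner (f + g) e = petInner f e + petInner g e := by
  simp only [petInner]
  rw [← integral_add (integrable_petInner f e) (integrable_petInner g e)]
  refine integral_congr_ae (Eventually.of_forall fun z ↦ ?_)
  simp only [add_apply]
  ring

lemma petInner_smul_left (c : ℂ) (f g : CuspForm 𝒮ℒ k) :
    petInner (c • f) g = c * petInner f g := by
  simp only [petInner]
  rw [← integral_const_mul]
  refine integral_congr_ae (Eventually.of_forall fun z ↦ ?_)
  simp only [smul_apply, smul_eq_mul]
  ring

/-! ### Analytic continuation of the Rankin–Selberg `L`-function -/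

lemma rankinSelberg_strong (f : CuspForm 𝒮ℒ k) (g : CuspForm 𝒮ℒ l) (hk : 0 < k) (hkl : k ≤ l)
    (horth : ∀ e : l = k, petInner f (castWt e g) = 0) :
    ∃ L : ℂ → ℂ, Differentiable ℂ L ∧ ∀ s : ℂ, 1 < s.re →
      L s = riemannZeta (2 * s) * LSeries (fun n ↦ lam f n * conj (lam g n)) s := by
  obtain ⟨h, rfl⟩ : ∃ h : ℕ, l = k + h := ⟨(l - k).toNat, by omega⟩
  have h0 : petIntZero f g = 0 := by
    rcases eq_or_ne h 0 with rfl | hh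
    · rw [petIntZero, if_pos rfl, ← horth (by simp), ← petInt_castWt _ _ (by simp)]
      congr 1
      ext z
      simp only [castWt_apply]
    · exact if_neg hh
  have hk' : (1 : ℝ) ≤ k := by exact_mod_cast hk
  have hπ : (π : ℂ) ≠ 0 := by exact_mod_cast Real.pi_ne_zero
  have h4π : (4 * π : ℂ) ≠ 0 := by simp [Real.pi_ne_zero]
  refine ⟨fun s ↦ (petPair f g).Λ (s + h / 2) * ((Gamma (s + h / 2))⁻¹ *
    (Gamma (s + h / 2 + k - 1))⁻¹) * ((π : ℂ) ^ (s + h / 2) *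
      (4 * π : ℂ) ^ (s + h / 2 + k - 1)), ?_, fun s hs ↦ ?_⟩
  · have hd1 : Differentiable ℂ fun s : ℂ ↦ s + h / 2 := by fun_prop
    have hd2 : Differentiable ℂ fun s : ℂ ↦ s + h / 2 + k - 1 := by fun_prop
    exact (((differentiable_petPair f g h0).comp hd1).mul
      ((differentiable_one_div_Gamma.comp hd1).mul (differentiable_one_div_Gamma.comp hd2))).mul
      ((hd1.const_cpow (.inl hπ)).mul (hd2.const_cpow (.inl h4π)))
  · have hw : 1 + (h / 2 : ℝ) < (s + h / 2).re := by simp; linarith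
    have hG1 : Gamma (s + h / 2) ≠ 0 := Gamma_ne_zero_of_re_pos (by
      have : (0 : ℝ) ≤ h / 2 := by positivity
      linarith)
    have hG2 : Gamma (s + h / 2 + k - 1) ≠ 0 := Gamma_ne_zero_of_re_pos (by
      have : (0 : ℝ) ≤ h / 2 := by positivity
      simp at hw ⊢; linarith)
    simp only [petPair_eq_of_zero f g h0 hw, integral_strip_pet_eq f g hk hs, cpow_neg]
    have h1 : (π : ℂ) ^ (s + h / 2) ≠ 0 := by simp [hπ]
    have h2 : (4 * π : ℂ) ^ (s + h / 2 + k - 1) ≠ 0 := by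
      rw [Ne, cpow_eq_zero_iff]; exact fun h ↦ h4π h.1
    rw [show 2 * (s + h / 2) - h = 2 * s by ring]
    generalize Gamma (s + h / 2) = G₁ at *
    generalize Gamma (s + h / 2 + k - 1) = G₂ at *
    generalize (4 * π : ℂ) ^ (s + h / 2 + k - 1) = x at *
    generalize (π : ℂ) ^ (s + h / 2) = y at *
    field_simp

lemma rankinSelberg_weak (f : CuspForm 𝒮ℒ k) (hk : 0 < k) (hf : f ≠ 0) :
    ∃ M : ℂ → ℂ, Differentiable ℂ M ∧ M (-1) = 0 ∧ M 1 ≠ 0 ∧ ∀ s : ℂ, 1 < s.re →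
      M s = (s - 1) * riemannZeta (2 * s) * LSeries (fun n ↦ lam f n * conj (lam f n)) s := by
  set g : CuspForm 𝒮ℒ (k + (0 : ℕ)) := castWt (by simp) f with hg
  have hlam : lam g = lam f := funext (lam_castWt _ f)
  set c : ℂ := petInner f f with hc
  have hc0 : c ≠ 0 := fun h ↦ hf (petInner_definite f h)
  have hpc : petIntZero f g = c := by
    rw [petIntZero, if_pos rfl, hg, petInt_castWt]
  have hk' : (1 : ℝ) ≤ k := by exact_mod_cast hk
  have hπ : (π : ℂ) ≠ 0 := by exact_mod_cast Real.pi_ne_zero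
  have h4π : (4 * π : ℂ) ≠ 0 := by simp [Real.pi_ne_zero]
  set P := petPair f g with hP
  have hΛ (s : ℂ) : P.Λ s = P.Λ₀ s - (1 / s) * c - (1 / (1 - s)) * c := by
    have : P.Λ s = P.Λ₀ s - (1 / s) • petIntZero f g -
      (1 / ((((0 : ℕ) : ℝ) + 1 : ℝ) - s : ℂ)) • petIntZero f g := rfl
    rw [this, hpc]
    simp
  refine ⟨fun s ↦ (((s - 1) * P.Λ₀ s + c) * (Gamma s)⁻¹ - c * (s - 1) * (Gamma (s + 1))⁻¹) *
    (Gamma (s + k - 1))⁻¹ * ((π : ℂ) ^ s * (4 * π : ℂ) ^ (s + k - 1)), ?_, ?_, ?_, fun s hs ↦ ?_⟩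
  · have hd2 : Differentiable ℂ fun s : ℂ ↦ s + k - 1 := by fun_prop
    have hd1 : Differentiable ℂ fun s : ℂ ↦ s + 1 := by fun_prop
    have hd3 : Differentiable ℂ fun s : ℂ ↦ s - 1 := by fun_prop
    exact (((((hd3.mul P.differentiable_Λ₀).add_const c).mul differentiable_one_div_Gamma).sub
      ((hd3.const_mul c).mul (differentiable_one_div_Gamma.comp hd1))).mul
        (differentiable_one_div_Gamma.comp hd2)).mul
      ((differentiable_id.const_cpow (.inl hπ)).mul (hd2.const_cpow (.inl h4π)))
  · have h1 : Gamma (-1) = 0 := by simpa using Gamma_neg_nat_eq_zero 1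
    have h2 : Gamma (-1 + 1) = 0 := by simp
    simp [h1]
  · have hG2 : Gamma (1 + k - 1) ≠ 0 := Gamma_ne_zero_of_re_pos (by simp; linarith)
    have h1 : (π : ℂ) ^ (1 : ℂ) ≠ 0 := by simp [hπ]
    have h2 : (4 * π : ℂ) ^ (1 + k - 1 : ℂ) ≠ 0 := by
      rw [Ne, cpow_eq_zero_iff]; exact fun h ↦ h4π h.1
    have : (((1 : ℂ) - 1) * P.Λ₀ 1 + c) * (Gamma 1)⁻¹ - c * (1 - 1) * (Gamma (1 + 1))⁻¹ = c := by
      simp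
    simp only [this]
    exact mul_ne_zero (mul_ne_zero hc0 (inv_ne_zero hG2)) (mul_ne_zero h1 h2)
  · have hs0 : s ≠ 0 := by rintro rfl; simp at hs; linarith
    have hs1 : 1 - s ≠ 0 := fun h ↦ by
      rw [← sub_eq_zero.1 h] at hs; simp at hs
    have key := petPair_eq f g (w := s) (by simpa using hs)
    have key2 := integral_strip_pet_eq f g hk hs
    simp only [Nat.cast_zero, zero_div, add_zero, sub_zero, hlam] at key key2
    rw [key2, ← hP, hΛ] at key
    have hG1 : Gamma s ≠ 0 := Gamma_ne_zero_of_re_pos (by linarith)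
    have hG2 : Gamma (s + k - 1) ≠ 0 := Gamma_ne_zero_of_re_pos (by simp; linarith)
    have h1 : (π : ℂ) ^ s ≠ 0 := by simp [hπ]
    have h2 : (4 * π : ℂ) ^ (s + k - 1) ≠ 0 := by
      rw [Ne, cpow_eq_zero_iff]; exact fun h ↦ h4π h.1
    have e1 : P.Λ₀ s = Gamma s * π ^ (-s) * riemannZeta (2 * s) * (Gamma (s + k - 1) *
        (4 * π) ^ (-(s + k - 1)) * LSeries (fun n ↦ lam f n * conj (lam f n)) s) +
        (1 / s) * c + (1 / (1 - s)) * c := by rw [← key]; ring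
    have hs2 : s - 1 ≠ 0 := fun h ↦ hs1 (by rw [← neg_sub, h, neg_zero])
    have e2 : 1 / (1 - s) = -(1 / (s - 1)) := by rw [← neg_sub, one_div_neg_eq_neg_one_div]
    simp only [Gamma_add_one s hs0, e1, e2, cpow_neg]
    generalize Gamma s = G₁ at *
    generalize Gamma (s + k - 1) = G₂ at *
    generalize (4 * π : ℂ) ^ (s + k - 1) = x at *
    generalize (π : ℂ) ^ s = y at *
    field_simp
    ring

end Dirichlet

end QMF

/-! ## Hecke operators -/

namespace QMF
open scoped Real Topology Modular MatrixGroups ENNReal ComplexConjugate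
open UpperHalfPlane hiding I
open MeasureTheory

section Hecke

open scoped ModularForm Manifold

variable {k : ℤ} {p : ℕ} [hp : Fact p.Prime]

/-- Integral matrices of determinant `p`. -/
local notation "Δ" => FixedDetMatrix (Fin 2) ℤ (p : ℤ)

/-- An integral matrix of determinant `p` as an element of `GL(2, ℝ)`. -/
def toGL (A : FixedDetMatrix (Fin 2) ℤ (p : ℤ)) : GL (Fin 2) ℝ :=
  Matrix.GeneralLinearGroup.mkOfDetNeZero (A.1.map (Int.cast : ℤ → ℝ)) <| by
    have h : (A.1.map (Int.cast : ℤ → ℝ)).det = (p : ℝ) := by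
      have := congrArg (Int.cast : ℤ → ℝ) A.2
      rwa [Int.cast_det, Int.cast_natCast] at this
    rw [h]
    exact_mod_cast hp.out.ne_zero

lemma toGL_val (A : Δ) : (toGL A).val = A.1.map (Int.cast : ℤ → ℝ) := rfl

lemma toGL_apply (A : Δ) (i j : Fin 2) : toGL A i j = A.1 i j := rfl

lemma toGL_det (A : Δ) : (toGL A).det.val = p := by
  have := congrArg (Int.cast : ℤ → ℝ) A.2
  rw [Int.cast_det, Int.cast_natCast] at this
  exact this

lemma prime_pos_real : (0 : ℝ) < p := by exact_mod_cast hp.out.pos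

lemma toGL_det_pos (A : Δ) : 0 < (toGL A).det.val := by
  rw [toGL_det]; exact prime_pos_real

lemma toGL_smul (γ : SL(2, ℤ)) (A : Δ) :
    toGL (γ • A) = Matrix.SpecialLinearGroup.mapGL ℝ γ * toGL A := by
  apply Units.ext
  rw [Units.val_mul, toGL_val, toGL_val, FixedDetMatrices.smul_coe]
  exact Matrix.map_mul (f := Int.castRingHom ℝ)

lemma toGL_injective : Function.Injective (toGL : Δ → GL (Fin 2) ℝ) := fun A B h ↦ by
  ext i j
  have : toGL A i j = toGL B i j := by rw [h]
  rw [toGL_apply, toGL_apply] at this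
  exact_mod_cast this

/-- Right translation of integral matrices. -/
def rtrans (A : FixedDetMatrix (Fin 2) ℤ (p : ℤ)) (δ : SL(2, ℤ)) :
    FixedDetMatrix (Fin 2) ℤ (p : ℤ) := ⟨A.1 * δ.1, by rw [Matrix.det_mul, A.2, δ.2, mul_one]⟩

lemma toGL_rtrans (A : Δ) (δ : SL(2, ℤ)) :
    toGL (rtrans A δ) = toGL A * Matrix.SpecialLinearGroup.mapGL ℝ δ := by
  apply Units.ext
  rw [Units.val_mul, toGL_val, toGL_val]
  exact Matrix.map_mul (f := Int.castRingHom ℝ)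

/-- Adjugate involution. -/
def adj (A : FixedDetMatrix (Fin 2) ℤ (p : ℤ)) : FixedDetMatrix (Fin 2) ℤ (p : ℤ) :=
  ⟨A.1.adjugate, by rw [Matrix.det_adjugate, A.2]; simp⟩

lemma adj_adj {p : ℕ} (A : FixedDetMatrix (Fin 2) ℤ (p : ℤ)) : adj (adj A) = A := by
  apply FixedDetMatrices.ext'
  have h : (adj (adj A)).1 = A.1.adjugate.adjugate := rfl
  rw [h, Matrix.adjugate_fin_two, Matrix.adjugate_fin_two]
  ext i j
  fin_cases i <;> fin_cases j <;> simp

lemma toGL_mul_adj (A : Δ) : (toGL A * toGL (adj A)).val = (p : ℝ) • (1 : Matrix _ _ ℝ) := by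
  rw [Units.val_mul, toGL_val, toGL_val]
  have h : A.1 * (adj A).1 = (p : ℤ) • (1 : Matrix _ _ ℤ) := by
    rw [adj, Matrix.mul_adjugate, A.2]
  have h2 := congrArg (fun B : Matrix (Fin 2) (Fin 2) ℤ ↦ B.map (Int.castRingHom ℝ)) h
  simp only [Matrix.map_mul] at h2
  refine h2.trans ?_
  ext i j
  rw [Matrix.map_apply, Matrix.smul_apply, Matrix.smul_apply, Matrix.one_apply, Matrix.one_apply]
  split_ifs <;> simp

/-- Representatives of the left cosets of integral matrices of determinant `p`. -/
def rep (p : ℕ) : Option (Fin p) → FixedDetMatrix (Fin 2) ℤ (p : ℤ)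
  | none => ⟨!![(p : ℤ), 0; 0, 1], by simp⟩
  | some b => ⟨!![1, (b : ℤ); 0, (p : ℤ)], by simp⟩

lemma mul_apply_two {p : ℕ} (γ : SL(2, ℤ)) (A : FixedDetMatrix (Fin 2) ℤ (p : ℤ)) (i j : Fin 2) :
    (γ • A).1 i j = γ i 0 * A.1 0 j + γ i 1 * A.1 1 j := by
  rw [FixedDetMatrices.smul_coe, Matrix.mul_apply, Fin.sum_univ_two]

lemma rep_unique {γ : SL(2, ℤ)} {i j : Option (Fin p)} (h : γ • rep p i = rep p j) : i = j := by
  have hp1 := hp.out.one_lt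
  have hm (a b : Fin 2) := congrArg (fun B : Δ ↦ B.1 a b) h
  simp only [mul_apply_two] at hm
  have h00 := hm 0 0
  have h01 := hm 0 1
  have h10 := hm 1 0
  have h11 := hm 1 1
  have hz : ¬ ∃ x : ℤ, (p : ℤ) * x = 1 := by
    rintro ⟨x, hx⟩
    have := Int.eq_one_or_neg_one_of_mul_eq_one hx
    omega
  rcases i with _ | b <;> rcases j with _ | b' <;> simp only [rep] at h00 h01 h10 h11 <;>
    simp at h00 h01 h10 h11
  · rfl
  · exact absurd ⟨γ 0 0, by linarith⟩ hz
  · rw [h10] at h11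
    exact absurd ⟨γ 1 1, by linarith⟩ hz
  · rw [h00] at h01
    congr 1
    ext
    have h1 : (b' : ℤ) - b = γ 0 1 * p := by linarith
    have hb := b.2
    have hb' := b'.2
    have : γ 0 1 = 0 := by
      by_contra h0
      rcases lt_or_gt_of_ne h0 with h | h <;> nlinarith
    rw [this] at h1
    omega

lemma exists_rep (A : Δ) : ∃ (γ : SL(2, ℤ)) (i : Option (Fin p)), γ • rep p i = A := by
  have hp0 : (p : ℤ) ≠ 0 := by exact_mod_cast hp.out.ne_zero
  induction A using FixedDetMatrices.induction_on hp0 with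
  | h0 A h10 h00 h01 h11 =>
    have hdet := A.2
    rw [Matrix.det_fin_two, h10, mul_zero, sub_zero] at hdet
    have hd : 0 < A.1 1 1 := by
      by_contra hd
      have : (0 : ℤ) < p := by exact_mod_cast hp.out.pos
      nlinarith
    rw [abs_of_nonneg h01, abs_of_pos hd] at h11
    obtain ⟨a, ha⟩ : ∃ a : ℕ, A.1 0 0 = a := ⟨(A.1 0 0).toNat, by omega⟩
    obtain ⟨d, hd'⟩ : ∃ d : ℕ, A.1 1 1 = d := ⟨(A.1 1 1).toNat, by omega⟩
    have had : a * d = p := by rw [ha, hd'] at hdet; exact_mod_cast hdet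
    rcases (Nat.dvd_prime hp.out).1 ⟨d, had.symm⟩ with rfl | h
    · rw [one_mul] at had
      refine ⟨1, some ⟨(A.1 0 1).toNat, by omega⟩, ?_⟩
      rw [one_smul]
      ext i j
      fin_cases i <;> fin_cases j <;> simp [rep, h10, ha, hd', had, h01]
    · have : d = 1 := by
        rw [h] at had
        exact Nat.eq_of_mul_eq_mul_left hp.out.pos (by rw [had, mul_one])
      refine ⟨1, none, ?_⟩
      rw [one_smul]
      have : A.1 0 1 = 0 := by omega
      ext i j
      fin_cases i <;> fin_cases j <;> simp [rep, *]
  | hS B h => obtain ⟨γ, i, rfl⟩ := h; exact ⟨_, i, mul_smul _ _ _⟩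
  | hT B h => obtain ⟨γ, i, rfl⟩ := h; exact ⟨_, i, mul_smul _ _ _⟩

lemma rep_bijective : Function.Bijective
    (fun x : Option (Fin p) × SL(2, ℤ) ↦ (x.2 • rep p x.1 : Δ)) := by
  refine ⟨?_, fun A ↦ ?_⟩
  · rintro ⟨i, γ⟩ ⟨j, γ'⟩ h
    have h : γ • rep p i = γ' • rep p j := h
    obtain rfl : i = j := rep_unique (γ := γ'⁻¹ * γ) (by rw [mul_smul, h, inv_smul_smul])
    have h2 := congrArg toGL h
    rw [toGL_smul, toGL_smul] at h2
    have := Matrix.SpecialLinearGroup.mapGL_injective (S := ℝ) (mul_right_cancel h2)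
    rw [this]
  · obtain ⟨γ, i, h⟩ := exists_rep A
    exact ⟨(i, γ), h⟩

lemma slash_toGL_smul (f : CuspForm 𝒮ℒ k) (γ : SL(2, ℤ)) (A : Δ) :
    (⇑f ∣[k] toGL (γ • A)) = (⇑f ∣[k] toGL A) := by
  rw [toGL_smul, SlashAction.slash_mul]
  congr 1
  exact SlashInvariantFormClass.slash_action_eq f _ ⟨γ, rfl⟩

/-- The function underlying the Hecke operator. -/
def heckeFun (p : ℕ) [Fact p.Prime] (f : CuspForm 𝒮ℒ k) : ℍ → ℂ := ∑ i, (⇑f ∣[k] toGL (rep p i))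

lemma heckeFun_slash (f : CuspForm 𝒮ℒ k) (δ : SL(2, ℤ)) :
    heckeFun p f ∣[k] δ = heckeFun p f := by
  have h (i : Option (Fin p)) := exists_rep (rtrans (rep p i) δ)
  choose γ σ hσ using h
  have hinj : Function.Injective σ := fun i j hij ↦ by
    have h1 := hσ i
    rw [hij] at h1
    have h2 : (γ j * (γ i)⁻¹) • rtrans (rep p i) δ = rtrans (rep p j) δ := by
      rw [← h1, ← hσ j, smul_smul, inv_mul_cancel_right]
    refine rep_unique (γ := γ j * (γ i)⁻¹) (toGL_injective ?_)
    have h3 := congrArg toGL h2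
    rw [toGL_smul, toGL_rtrans, toGL_rtrans, ← mul_assoc] at h3
    rw [toGL_smul]
    exact mul_right_cancel h3
  have hbij := Finite.injective_iff_bijective.1 hinj
  rw [heckeFun, ModularForm.SL_slash, SlashAction.sum_slash,
    ← hbij.sum_comp (fun i ↦ (⇑f ∣[k] toGL (rep p i)))]
  refine Finset.sum_congr rfl fun i _ ↦ ?_
  rw [← SlashAction.slash_mul, ← slash_toGL_smul f (γ i), hσ i, toGL_rtrans]
  rfl

lemma smul_slash_eq (f : CuspForm 𝒮ℒ k) (A : Δ) (z : ℍ) : (⇑f ∣[k] toGL A) z =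
    f (toGL A • z) * (p : ℂ) ^ (k - 1) * denom (toGL A) z ^ (-k) := by
  rw [ModularForm.slash_apply, σ, if_pos (toGL_det_pos A), toGL_det, abs_of_pos prime_pos_real]
  simp

lemma mdiff_slash (f : CuspForm 𝒮ℒ k) (A : Δ) : MDiff (⇑f ∣[k] toGL A) :=
  CuspFormClass.holo (CuspForm.translate f (toGL A))

lemma isZeroAtImInfty_slash (f : CuspForm 𝒮ℒ k) (i : Option (Fin p)) :
    IsZeroAtImInfty (⇑f ∣[k] toGL (rep p i)) := by
  have h : toGL (rep p i) • OnePoint.infty = (OnePoint.infty : OnePoint ℝ) := by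
    rw [OnePoint.smul_infty_eq_self_iff, toGL_apply]
    rcases i with _ | b <;> simp [rep]
  exact CuspFormClass.zero_at_cusps f (Fact.out : IsCusp OnePoint.infty 𝒮ℒ) _ h

/-- The Hecke operator. -/
def hecke (p : ℕ) [Fact p.Prime] (f : CuspForm 𝒮ℒ k) : CuspForm 𝒮ℒ k where
  toFun := heckeFun p f
  slash_action_eq' := by
    rintro _ ⟨γ, rfl⟩
    exact heckeFun_slash f γ
  holo' := by
    have := MDifferentiable.sum (t := Finset.univ) (f := fun i ↦ (⇑f ∣[k] toGL (rep p i)))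
      (fun i _ ↦ mdiff_slash f (rep p i))
    exact this
  zero_at_cusps' hc := by
    rw [OnePoint.isZeroAt_iff_forall_SL2Z hc]
    intro γ _
    change IsZeroAtImInfty (heckeFun p f ∣[k] γ)
    rw [heckeFun_slash]
    exact Submodule.sum_mem (zeroAtFilterSubmodule ℂ atImInfty) fun i _ ↦ isZeroAtImInfty_slash f i

lemma coe_hecke (f : CuspForm 𝒮ℒ k) : ⇑(hecke p f) = heckeFun p f := rfl

end Hecke

end QMF

/-! ## Fourier coefficients and self-adjointness of Hecke operators -/

namespace QMF
open scoped Real Topology Modular MatrixGroups ENNReal ComplexConjugate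
open UpperHalfPlane hiding I
open MeasureTheory

section Hecke

open scoped ModularForm Manifold

variable {k : ℤ} {p : ℕ} [hp : Fact p.Prime]

local notation "Δ" => FixedDetMatrix (Fin 2) ℤ (p : ℤ)

/-! ### Fourier coefficients of Hecke operators -/

lemma coe_rep_none_smul (z : ℍ) : ((toGL (rep p none) • z : ℍ) : ℂ) = p * z := by
  rw [coe_smul_of_det_pos (toGL_det_pos _), num, denom]
  simp only [toGL_apply]
  simp [rep]

lemma coe_rep_some_smul (b : Fin p) (z : ℍ) :
    ((toGL (rep p (some b)) • z : ℍ) : ℂ) = (z + b) / p := by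
  rw [coe_smul_of_det_pos (toGL_det_pos _), num, denom]
  simp only [toGL_apply]
  simp [rep]

lemma denom_rep_none (z : ℍ) : denom (toGL (rep p none)) z = 1 := by
  rw [denom]
  simp only [toGL_apply]
  simp [rep]

lemma denom_rep_some (b : Fin p) (z : ℍ) : denom (toGL (rep p (some b))) z = p := by
  rw [denom]
  simp only [toGL_apply]
  simp [rep]

lemma prime_ne_zero_complex : (p : ℂ) ≠ 0 := by exact_mod_cast hp.out.ne_zero

lemma sum_exp_fin (m : ℕ) : ∑ b : Fin p, cexp (2 * π * I * m * b / p) =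
    if p ∣ m then (p : ℂ) else 0 := by
  have hp0 : (p : ℂ) ≠ 0 := prime_ne_zero_complex
  have h (b : ℕ) : cexp (2 * π * I * m * b / p) = cexp (2 * π * I * m / p) ^ b := by
    rw [← Complex.exp_nat_mul]; congr 1; ring
  simp only [h]
  rw [Fin.sum_univ_eq_sum_range (fun b ↦ cexp (2 * π * I * m / p) ^ b)]
  split_ifs with hm
  · obtain ⟨c, rfl⟩ := hm
    have : cexp (2 * π * I * (p * c : ℕ) / p) = 1 := by
      rw [Complex.exp_eq_one_iff]
      refine ⟨c, ?_⟩
      push_cast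
      field_simp
    rw [this]
    simp
  · have hne : cexp (2 * π * I * m / p) ≠ 1 := by
      intro h1
      obtain ⟨n, hn⟩ := Complex.exp_eq_one_iff.1 h1
      have : (m : ℂ) = n * p := by
        have h2 : (2 * π * I : ℂ) ≠ 0 := Complex.two_pi_I_ne_zero
        field_simp at hn
        linear_combination hn
      apply hm
      have h3 : (m : ℤ) = n * p := by exact_mod_cast this
      exact Int.natCast_dvd_natCast.1 ⟨n, by rw [h3, mul_comm]⟩
    have h4 := mul_neg_geom_sum (cexp (2 * π * I * m / p)) p
    rw [← Complex.exp_nat_mul] at h4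
    have h5 : cexp ((p : ℂ) * (2 * π * I * m / p)) = 1 := by
      rw [Complex.exp_eq_one_iff]
      exact ⟨m, by push_cast; field_simp⟩
    rw [h5, sub_self] at h4
    exact (mul_eq_zero.1 h4).resolve_left (sub_ne_zero.2 hne.symm)

lemma mul_prime_injective : Function.Injective fun n : ℕ ↦ p * n :=
  fun _ _ h ↦ Nat.eq_of_mul_eq_mul_left hp.out.pos h

/-- Fourier coefficients of the Hecke operator. -/
lemma cf_hecke (f : CuspForm 𝒮ℒ k) (n : ℕ) :
    cf (hecke p f) n =
      cf f (p * n) + (p : ℂ) ^ (k - 1) * (if p ∣ n then cf f (n / p) else 0) := by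
  have hp0 : (p : ℂ) ≠ 0 := prime_ne_zero_complex
  symm
  refine cf_unique (c := fun n ↦ cf f (p * n) +
    (p : ℂ) ^ (k - 1) * (if p ∣ n then cf f (n / p) else 0)) (fun z ↦ ?_) n
  rw [coe_hecke, heckeFun, Finset.sum_apply, Fintype.sum_option, add_comm]
  have h1 : HasSum (fun n : ℕ ↦ (p : ℂ) ^ (k - 1) * (if p ∣ n then cf f (n / p) else 0) *
      cexp (2 * π * I * n * z)) ((⇑f ∣[k] toGL (rep p none)) z) := by
    refine (mul_prime_injective (p := p)).hasSum_iff (fun n hn ↦ ?_) |>.1 ?_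
    · rw [if_neg]
      · simp
      · rintro ⟨c, rfl⟩
        exact hn ⟨c, rfl⟩
    · rw [smul_slash_eq, denom_rep_none, one_zpow, mul_one]
      refine HasSum.of_eq ((hasSum_cf f (toGL (rep p none) • z)).mul_left ((p : ℂ) ^ (k - 1)))
        (fun n ↦ ?_) (mul_comm _ _)
      rw [Function.comp_apply, if_pos (dvd_mul_right p n), Nat.mul_div_cancel_left n hp.out.pos,
        coe_rep_none_smul]
      push_cast
      rw [mul_assoc]
      congr 3
      ring
  have h2 : HasSum (fun n : ℕ ↦ cf f (p * n) * cexp (2 * π * I * n * z))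
      (∑ b, (⇑f ∣[k] toGL (rep p (some b))) z) := by
    have h3 : HasSum (fun m : ℕ ↦ (if p ∣ m then cf f m else 0) * cexp (2 * π * I * m * (z / p)))
        (∑ b, (⇑f ∣[k] toGL (rep p (some b))) z) := by
      have h4 := hasSum_sum (s := Finset.univ) fun (b : Fin p) _ ↦
        (hasSum_cf f (toGL (rep p (some b)) • z)).mul_left ((p : ℂ)⁻¹)
      refine HasSum.of_eq h4 (fun m ↦ ?_) ?_
      · rw [← Finset.mul_sum, ← Finset.mul_sum]
        have h5 (b : Fin p) : cexp (2 * π * I * m * (toGL (rep p (some b)) • z : ℍ)) =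
            cexp (2 * π * I * m * (z / p)) * cexp (2 * π * I * m * b / p) := by
          rw [← Complex.exp_add, coe_rep_some_smul]
          congr 1
          ring
        simp only [h5]
        rw [← Finset.mul_sum, sum_exp_fin]
        split_ifs
        · field_simp
        · simp
      · refine Finset.sum_congr rfl fun b _ ↦ ?_
        rw [smul_slash_eq, denom_rep_some, mul_assoc, ← zpow_add₀ hp0, mul_comm]
        congr 1
        rw [show k - 1 + -k = -1 by ring, zpow_neg_one]
    refine HasSum.of_eq ((mul_prime_injective (p := p)).hasSum_iff (fun n hn ↦ ?_) |>.2 h3)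
      (fun n ↦ ?_) rfl
    · rw [if_neg, zero_mul]
      rintro ⟨c, rfl⟩
      exact hn ⟨c, rfl⟩
    · rw [Function.comp_apply, if_pos (dvd_mul_right p n)]
      push_cast
      congr 2
      field_simp
  exact HasSum.of_eq (h2.add h1) (fun n ↦ by ring) rfl

/-! ### Self-adjointness of Hecke operators -/

lemma hasSum_prod_fintype {ι κ : Type*} [Fintype ι] {F : ι × κ → ℂ} {a : ι → ℂ}
    (h : ∀ i, HasSum (fun j ↦ F (i, j)) (a i)) : HasSum F (∑ i, a i) := by
  classical
  have h1 (i : ι) : HasSum (fun x : ι × κ ↦ if x.1 = i then F x else 0) (a i) := by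
    have hinj : Function.Injective fun j : κ ↦ (i, j) := fun _ _ h ↦ (Prod.ext_iff.1 h).2
    refine hinj.hasSum_iff (fun x hx ↦ if_neg ?_) |>.1 ?_
    · rintro rfl; exact hx ⟨x.2, rfl⟩
    · refine HasSum.of_eq (h i) (fun j ↦ ?_) rfl
      simp
  refine HasSum.of_eq (hasSum_sum (s := Finset.univ) fun i _ ↦ h1 i) (fun x ↦ ?_) rfl
  simp

lemma wt_lt_top (z : ℍ) : wt z < ⊤ := by
  have h := ENNReal.le_tsum (f := fun γ : SL(2, ℤ) ↦ wt (γ • z)) 1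
  rw [tsum_wt_smul] at h
  simp only [one_smul] at h
  exact h.trans_lt ENNReal.one_lt_top

lemma hasSum_wt (z : ℍ) : HasSum (fun γ : SL(2, ℤ) ↦ (wt (γ • z)).toReal) 1 := by
  have h : ∑' γ : SL(2, ℤ), wt (γ • z) ≠ ⊤ := by rw [tsum_wt_smul]; exact ENNReal.one_ne_top
  have h1 := ENNReal.hasSum_toReal h
  rwa [← ENNReal.tsum_toReal_eq (fun γ ↦ (wt_lt_top _).ne), tsum_wt_smul] at h1

lemma exists_petersson_slash_bound (f g : CuspForm 𝒮ℒ k) (A : Δ) :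
    ∃ C : ℝ, ∀ z, ‖petersson k g (⇑f ∣[k] toGL A) z‖ ≤ C := by
  obtain ⟨C, hC⟩ := CuspFormClass.petersson_bounded_left k 𝒮ℒ f f
  obtain ⟨D, hD⟩ := CuspFormClass.petersson_bounded_left k 𝒮ℒ g g
  have hC0 := (norm_nonneg _).trans (hC UpperHalfPlane.I)
  have hD0 := (norm_nonneg _).trans (hD UpperHalfPlane.I)
  refine ⟨√(D * ((p : ℝ) ^ (k - 2) * C)), fun z ↦ Real.le_sqrt_of_sq_le ?_⟩
  have h1 : ‖petersson k (⇑f ∣[k] toGL A) (⇑f ∣[k] toGL A) z‖ ≤ (p : ℝ) ^ (k - 2) * C := by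
    rw [petersson_slash, toGL_det, norm_mul, norm_σ]
    refine mul_le_mul (le_of_eq ?_) (hC _) (norm_nonneg _) (by positivity)
    simp
  have h2 : ‖petersson k g (⇑f ∣[k] toGL A) z‖ ^ 2 =
      ‖petersson k g g z‖ * ‖petersson k (⇑f ∣[k] toGL A) (⇑f ∣[k] toGL A) z‖ := by
    simp only [petersson, norm_mul, RCLike.norm_conj]
    ring
  rw [h2]
  exact mul_le_mul (hD z) h1 (norm_nonneg _) hD0

/-- Contribution of one matrix to the Petersson product with a Hecke operator. -/
def heckeTerm (f g : CuspForm 𝒮ℒ k) (A : FixedDetMatrix (Fin 2) ℤ (p : ℤ)) : ℂ :=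
  ∫ z, petersson k g (⇑f ∣[k] toGL A) z * ((wt (toGL A • z)).toReal : ℂ) ∂nu

lemma continuous_petersson_slash (f g : CuspForm 𝒮ℒ k) (A : Δ) :
    Continuous (petersson k g (⇑f ∣[k] toGL A)) :=
  petersson_continuous k (cusp_continuous g) (mdiff_slash f A).continuous

lemma hasSum_heckeTerm_fiber (f g : CuspForm 𝒮ℒ k) (A : Δ) :
    HasSum (fun γ : SL(2, ℤ) ↦ heckeTerm f g (γ • A)) (∫ z,
        petersson k g (⇑f ∣[k] toGL A) z ∂nu) := by
  obtain ⟨C, hC⟩ := exists_petersson_slash_bound f g A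
  have hC0 := (norm_nonneg _).trans (hC UpperHalfPlane.I)
  simp only [heckeTerm, slash_toGL_smul]
  have hsm (γ : SL(2, ℤ)) (z : ℍ) : toGL (γ • A) • z = γ • (toGL A • z) := by
    rw [toGL_smul, mul_smul]; rfl
  simp only [hsm]
  refine hasSum_integral_of_dominated_convergence
    (fun γ z ↦ C * (wt (γ • (toGL A • z))).toReal) (fun γ ↦ ?_) (fun γ ↦ ?_) ?_ ?_ ?_
  · refine (continuous_petersson_slash f g A).aestronglyMeasurable.mul
      (Measurable.aestronglyMeasurable ?_)
    exact measurable_ofReal.comp ((measurable_wt.comp ((measurable_const_smul γ).comp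
      (measurable_const_smul (toGL A)))).ennreal_toReal)
  · refine Eventually.of_forall fun z ↦ ?_
    rw [norm_mul, Complex.norm_real, Real.norm_of_nonneg ENNReal.toReal_nonneg]
    exact mul_le_mul_of_nonneg_right (hC z) ENNReal.toReal_nonneg
  · exact Eventually.of_forall fun z ↦ ((hasSum_wt (toGL A • z)).mul_left C).summable
  · simp only [fun z ↦ ((hasSum_wt (toGL A • z)).mul_left C).tsum_eq]
    exact integrable_const _
  · refine Eventually.of_forall fun z ↦ ?_
    have := (Complex.hasSum_ofReal.2 (hasSum_wt (toGL A • z))).mul_left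
      (petersson k g (⇑f ∣[k] toGL A) z)
    exact HasSum.of_eq this (fun _ ↦ rfl) (by simp)

lemma petInner_hecke (f g : CuspForm 𝒮ℒ k) :
    HasSum (fun A : Δ ↦ heckeTerm f g A) (petInner (hecke p f) g) := by
  have h := hasSum_prod_fintype (F := fun x : Option (Fin p) × SL(2, ℤ) ↦
    heckeTerm f g (x.2 • rep p x.1)) (fun i ↦ hasSum_heckeTerm_fiber f g (rep p i))
  have h2 := (Equiv.ofBijective _ (rep_bijective (p := p))).hasSum_iff (f := heckeTerm f g)
    (a := petInner (hecke p f) g)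
  refine h2.1 (HasSum.of_eq h (fun _ ↦ rfl) ?_)
  rw [petInner, ← integral_finsetSum]
  · refine integral_congr_ae (Eventually.of_forall fun z ↦ ?_)
    simp only [petersson, coe_hecke, heckeFun, Finset.sum_apply, Finset.sum_mul]
    refine Finset.sum_congr rfl fun i _ ↦ by ring
  · intro i _
    obtain ⟨C, hC⟩ := exists_petersson_slash_bound f g (rep p i)
    exact (integrable_const C).mono' (continuous_petersson_slash f g _).aestronglyMeasurable
      (Eventually.of_forall hC)

lemma toGL_adj_smul (A : Δ) (z : ℍ) : toGL A • (toGL (adj A) • z) = z := by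
  have hp0 : (p : ℂ) ≠ 0 := prime_ne_zero_complex
  have hv := toGL_mul_adj A
  have e (i j : Fin 2) : (toGL A * toGL (adj A)) i j = (p : ℝ) *
      (1 : Matrix (Fin 2) (Fin 2) ℝ) i j :=
    congrFun₂ hv i j
  rw [smul_smul]
  ext
  rw [coe_smul_of_det_pos, num, denom]
  · simp only [e]
    simp
    field_simp
  · rw [map_mul, Units.val_mul]; exact mul_pos (toGL_det_pos _) (toGL_det_pos _)

lemma slash_mul_adj (f : CuspForm 𝒮ℒ k) (A : Δ) :
    (⇑f ∣[k] toGL A) ∣[k] toGL (adj A) = ((p : ℂ) ^ (k - 2)) • ⇑f := by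
  have hp0 : (p : ℂ) ≠ 0 := prime_ne_zero_complex
  have hv := toGL_mul_adj A
  have e (i j : Fin 2) : (toGL A * toGL (adj A)) i j = (p : ℝ) *
      (1 : Matrix (Fin 2) (Fin 2) ℝ) i j :=
    congrFun₂ hv i j
  have hd : (toGL A * toGL (adj A)).det.val = p * p := by
    rw [map_mul, Units.val_mul, toGL_det, toGL_det]
  rw [← SlashAction.slash_mul]
  ext z
  rw [ModularForm.slash_apply, mul_smul, toGL_adj_smul, denom, σ, hd, if_pos (by
    have := prime_pos_real (p := p); positivity), e, e]
  simp only [Matrix.one_apply, Pi.smul_apply, smul_eq_mul]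
  simp
  rw [mul_assoc, mul_comm, mul_zpow, ← zpow_neg, ← zpow_add₀ hp0, ← zpow_add₀ hp0]
  congr 2
  ring

lemma heckeTerm_adj (f g : CuspForm 𝒮ℒ k) (A : Δ) :
    heckeTerm f g A = conj (heckeTerm g f (adj A)) := by
  have hp0 : (p : ℂ) ≠ 0 := prime_ne_zero_complex
  simp only [heckeTerm]
  rw [← integral_conj, nu, integral_withDensity_eq_integral_toReal_smul measurable_wt
    (Eventually.of_forall wt_lt_top), integral_withDensity_eq_integral_toReal_smul measurable_wt
    (Eventually.of_forall wt_lt_top), ← integral_smul_eq_self _ (g := toGL (adj A))]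
  refine integral_congr_ae (Eventually.of_forall fun w ↦ ?_)
  simp only [toGL_adj_smul, map_mul, Complex.conj_ofReal, Complex.real_smul]
  have h := petersson_slash k g (⇑f ∣[k] toGL A) (toGL (adj A)) w
  rw [slash_mul_adj, toGL_det, σ, if_pos (toGL_det_pos _), abs_of_pos prime_pos_real] at h
  have h2 : petersson k (⇑g ∣[k] toGL (adj A)) ((p : ℂ) ^ (k - 2) • ⇑f) w =
      (p : ℂ) ^ (k - 2) * petersson k (⇑g ∣[k] toGL (adj A)) ⇑f w := by
    simp only [petersson, Pi.smul_apply, smul_eq_mul]; ring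
  rw [h2] at h
  have h3 : petersson k (⇑g ∣[k] toGL (adj A)) ⇑f w =
      petersson k g (⇑f ∣[k] toGL A) (toGL (adj A) • w) := by
    refine mul_left_cancel₀ (zpow_ne_zero (k - 2) hp0) (h.trans ?_)
    simp
  rw [← h3, petersson_symm k f]
  ring

/-- Hecke operators are self-adjoint. -/
lemma hecke_selfAdjoint (f g : CuspForm 𝒮ℒ k) :
    petInner (hecke p f) g = petInner f (hecke p g) := by
  have h1 := petInner_hecke (p := p) f g
  have h2 := petInner_hecke (p := p) g f
  let e : Δ ≃ Δ := ⟨adj, adj, adj_adj, adj_adj⟩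
  have h3 := Complex.hasSum_conj'.2 (e.hasSum_iff.2 h2)
  rw [petInner_conj] at h3
  exact h1.unique (HasSum.of_eq h3 (fun A ↦ heckeTerm_adj f g A) rfl)

end Hecke

end QMF

/-! ## Diagonalization of the Hecke algebra -/

namespace QMF
open scoped Real Topology Modular MatrixGroups ENNReal ComplexConjugate
open UpperHalfPlane hiding I
open MeasureTheory

section Diagonalization

open scoped Function

open Module.End in
theorem iSup_iInf_eigenspace_of_core {V ι : Type*} [AddCommGroup V] [Module ℂ V]
    [FiniteDimensional ℂ V] (core : InnerProductSpace.Core ℂ V) (T : ι → Module.End ℂ V)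
    (hT : ∀ i x y, core.inner (T i x) y = core.inner x (T i y))
    (hc : Pairwise (Commute on T)) : ⨆ χ : ι → ℂ, ⨅ i, eigenspace (T i) (χ i) = ⊤ := by
  let _ : NormedAddCommGroup V := core.toNormedAddCommGroup
  let _ : InnerProductSpace ℂ V := InnerProductSpace.ofCore core.toCore
  exact LinearMap.IsSymmetric.iSup_iInf_eq_top_of_commute (T := T) (fun i x y ↦ hT i x y) hc

variable {k : ℤ} {p : ℕ} [hp : Fact p.Prime]

instance : FiniteDimensional ℂ (CuspForm 𝒮ℒ k) :=
  Module.Finite.of_injective (CuspForm.toModularFormₗ (Γ := 𝒮ℒ) (k := k))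
    CuspForm.toModularFormₗ_injective

/-- The Petersson product as an inner product core, linear in the second variable. -/
abbrev petCore (k : ℤ) : InnerProductSpace.Core ℂ (CuspForm 𝒮ℒ k) where
  inner f g := petInner g f
  conj_inner_symm f g := petInner_conj f g
  re_inner_nonneg f := petInner_self_re_nonneg f
  add_left f g h := by
    rw [← petInner_conj (f + g) h, petInner_add_left, map_add, petInner_conj, petInner_conj]
  smul_left f g r := by
    rw [← petInner_conj (r • f) g, petInner_smul_left, map_mul, petInner_conj]
  definite f h := petInner_definite f h

/-- Hecke operators as linear maps. -/
def heckeₗ (k : ℤ) (p : ℕ) [Fact p.Prime] : Module.End ℂ (CuspForm 𝒮ℒ k) where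
  toFun f := hecke p f
  map_add' f g := cusp_ext_of_cf fun n ↦ by
    simp only [cf_hecke, cf_add]; split_ifs <;> ring
  map_smul' c f := cusp_ext_of_cf fun n ↦ by
    simp only [cf_hecke, cf_smul, RingHom.id_apply]; split_ifs <;> ring

lemma commute_heckeₗ (p q : ℕ) [hp : Fact p.Prime] [hq : Fact q.Prime] (hpq : p ≠ q) :
    Commute (heckeₗ k p) (heckeₗ k q) := by
  refine LinearMap.ext fun f ↦ cusp_ext_of_cf fun n ↦ ?_
  have hcop := (Nat.coprime_primes hp.out hq.out).2 hpq
  have h1 : q ∣ p * n ↔ q ∣ n := (Nat.Coprime.dvd_mul_left hcop.symm)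
  have h2 : p ∣ q * n ↔ p ∣ n := (Nat.Coprime.dvd_mul_left hcop)
  simp only [Module.End.mul_apply, heckeₗ, LinearMap.coe_mk, AddHom.coe_mk, cf_hecke, h1, h2]
  by_cases hpn : p ∣ n <;> by_cases hqn : q ∣ n
  · obtain ⟨m, rfl⟩ : p * q ∣ n := Nat.Coprime.mul_dvd_of_dvd_of_dvd hcop hpn hqn
    have hp0 := hp.out.pos
    have hq0 := hq.out.pos
    have e1 : p * (p * q * m) / q = p * (p * m) := Nat.div_eq_of_eq_mul_left hq0 (by ring)
    have e2 : q * (p * q * m) / p = q * (q * m) := Nat.div_eq_of_eq_mul_left hp0 (by ring)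
    have e3 : p * q * m / p = q * m := Nat.div_eq_of_eq_mul_left hp0 (by ring)
    have e4 : p * q * m / q = p * m := Nat.div_eq_of_eq_mul_left hq0 (by ring)
    rw [e1, e2, e3, e4, Nat.mul_div_cancel_left m hp0, Nat.mul_div_cancel_left m hq0,
      if_pos hpn, if_pos hqn, if_pos (dvd_mul_right _ _), if_pos (dvd_mul_right _ _),
      show q * (p * (p * q * m)) = p * (q * (p * q * m)) by ring]
    simp only [hpn, hqn, if_true]
    ring
  · obtain ⟨m, rfl⟩ := hpn
    have hp0 := hp.out.pos
    have hqm : ¬ q ∣ m := fun h ↦ hqn (h.mul_left p)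
    rw [show q * (p * m) / p = q * m from Nat.div_eq_of_eq_mul_left hp0 (by ring),
      Nat.mul_div_cancel_left m hp0, show q * (p * (p * m)) = p * (q * (p * m)) by ring]
    simp only [hqn, hqm, if_false, dvd_mul_right, if_true]
    ring
  · obtain ⟨m, rfl⟩ := hqn
    have hq0 := hq.out.pos
    have hpm : ¬ p ∣ m := fun h ↦ hpn (h.mul_left q)
    rw [show p * (q * m) / q = p * m from Nat.div_eq_of_eq_mul_left hq0 (by ring),
      Nat.mul_div_cancel_left m hq0, show q * (p * (q * m)) = p * (q * (q * m)) by ring]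
    simp only [hpn, hpm, if_false, dvd_mul_right, if_true]
    ring
  · simp only [hpn, hqn, if_false, mul_zero, add_zero]
    rw [show q * (p * n) = p * (q * n) by ring]

/-- Normalized joint eigenforms of all Hecke operators. -/
structure IsEigen (f : CuspForm 𝒮ℒ k) : Prop where
  one : cf f 1 = 1
  eigen : ∀ (p : ℕ) [Fact p.Prime], hecke p f = cf f p • f

lemma cf_mul_of_eigen {f : CuspForm 𝒮ℒ k} {μ : ℂ} (h : hecke p f = μ • f) (n : ℕ) :
    cf f (p * n) = μ * cf f n - (p : ℂ) ^ (k - 1) * (if p ∣ n then cf f (n / p) else 0) := by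
  have := cf_hecke (p := p) f n
  rw [h, cf_smul] at this
  rw [this]; ring

lemma eigenvalue_eq {f : CuspForm 𝒮ℒ k} {μ : ℂ} (h : hecke p f = μ • f) :
    cf f p = μ * cf f 1 := by
  have := cf_mul_of_eigen h 1
  rw [mul_one, if_neg (by rw [Nat.dvd_one]; exact hp.out.ne_one)] at this
  rw [this]; ring

lemma eq_of_eigen {f g : CuspForm 𝒮ℒ k} (h1 : cf f 1 = cf g 1) (μ : Nat.Primes → ℂ)
    (hf : ∀ p : Nat.Primes, haveI := Fact.mk p.2; hecke p f = μ p • f)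
    (hg : ∀ p : Nat.Primes, haveI := Fact.mk p.2; hecke p g = μ p • g) : f = g := by
  refine cusp_ext_of_cf fun n ↦ ?_
  induction n using Nat.strong_induction_on with
  | _ n ih =>
    rcases eq_or_ne n 0 with rfl | h0
    · rw [cf_zero, cf_zero]
    rcases eq_or_ne n 1 with rfl | hn1
    · exact h1
    obtain ⟨p, hp, m, rfl⟩ := Nat.exists_prime_and_dvd hn1
    have := Fact.mk hp
    have hm : m ≠ 0 := by rintro rfl; simp at h0
    have hlt : m < p * m := by
      have := hp.two_le
      nlinarith [Nat.pos_of_ne_zero hm]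
    rw [cf_mul_of_eigen (hf ⟨p, hp⟩), cf_mul_of_eigen (hg ⟨p, hp⟩), ih m hlt,
      ih (m / p) ((Nat.div_le_self m p).trans_lt hlt)]

open Module.End in
theorem span_isEigen : Submodule.span ℂ {f : CuspForm 𝒮ℒ k | IsEigen f} = ⊤ := by
  let T : Nat.Primes → Module.End ℂ (CuspForm 𝒮ℒ k) := fun p ↦
    have := Fact.mk p.2; heckeₗ k p
  have h := iSup_iInf_eigenspace_of_core (petCore k) T
    (fun p f g ↦ by have := Fact.mk p.2; exact (hecke_selfAdjoint g f).symm)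
    (fun p q hpq ↦ by
      have := Fact.mk p.2; have := Fact.mk q.2
      exact commute_heckeₗ _ _ (fun h ↦ hpq (Subtype.ext h)))
  rw [eq_top_iff, ← h, iSup_le_iff]
  intro χ f hf
  have hf' (p : Nat.Primes) : haveI := Fact.mk p.2; hecke p f = χ p • f :=
    mem_eigenspace_iff.1 ((Submodule.mem_iInf _).1 hf p)
  by_cases h1 : cf f 1 = 0
  · have : f = 0 := by
      refine eq_of_eigen (g := 0) (by rw [h1]; exact ((cfₗ k 1).map_zero).symm) χ hf' fun p ↦ ?_
      have := Fact.mk p.2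
      rw [smul_zero]; exact (heckeₗ k p).map_zero
    rw [this]; exact zero_mem _
  · rw [show f = cf f 1 • ((cf f 1)⁻¹ • f) by rw [smul_smul, mul_inv_cancel₀ h1, one_smul]]
    refine Submodule.smul_mem _ _ (Submodule.subset_span ?_)
    have h1' : cf ((cf f 1)⁻¹ • f) 1 = 1 := by rw [cf_smul, inv_mul_cancel₀ h1]
    refine ⟨h1', fun p hp ↦ ?_⟩
    have : hecke p ((cf f 1)⁻¹ • f) = χ ⟨p, hp.out⟩ • ((cf f 1)⁻¹ • f) := by
      rw [smul_comm, ← hf' ⟨p, hp.out⟩]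
      exact (heckeₗ k p).map_smul _ _
    rw [eigenvalue_eq this, h1', mul_one, this]

lemma IsEigen.cf_mul {f : CuspForm 𝒮ℒ k} (hf : IsEigen f) (n : ℕ) :
    cf f (p * n) =
      cf f p * cf f n - (p : ℂ) ^ (k - 1) * (if p ∣ n then cf f (n / p) else 0) :=
  cf_mul_of_eigen (hf.eigen p) n

lemma IsEigen.ne_zero {f : CuspForm 𝒮ℒ k} (hf : IsEigen f) : f ≠ 0 := by
  rintro rfl
  have := hf.one
  rw [show cf (0 : CuspForm 𝒮ℒ k) 1 = 0 from (cfₗ k 1).map_zero] at this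
  exact zero_ne_one this

lemma petInner_smul_right (c : ℂ) (f g : CuspForm 𝒮ℒ k) :
    petInner f (c • g) = conj c * petInner f g := (petCore k).smul_left g f c

lemma IsEigen.conj_cf_prime {f : CuspForm 𝒮ℒ k} (hf : IsEigen f) : conj (cf f p) = cf f p := by
  have h := hecke_selfAdjoint (p := p) f f
  rw [hf.eigen p, petInner_smul_left, petInner_smul_right] at h
  exact (mul_right_cancel₀ (fun h0 ↦ hf.ne_zero (petInner_definite f h0)) h).symm

lemma IsEigen.petInner_eq_zero {f g : CuspForm 𝒮ℒ k} (hf : IsEigen f) (hg : IsEigen g)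
    (hfg : f ≠ g) : petInner f g = 0 := by
  by_contra h0
  refine hfg (eq_of_eigen (hf.one.trans hg.one.symm) (fun p ↦ cf f p)
    (fun p ↦ by have := Fact.mk p.2; exact hf.eigen p) fun p ↦ ?_)
  have := Fact.mk p.2
  have h := hecke_selfAdjoint (p := p) f g
  rw [hf.eigen p, hg.eigen p, petInner_smul_left, petInner_smul_right, hg.conj_cf_prime] at h
  rw [mul_right_cancel₀ h0 h, hg.eigen p]

end Diagonalization

end QMF

/-! ## The Fejér kernel -/

namespace QMF
open scoped Real Topology Modular MatrixGroups ENNReal ComplexConjugate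
open UpperHalfPlane hiding I
open MeasureTheory

section FejerKernel

/-- The Fejér kernel on the line, as a Fourier transform of the triangle function. -/
def fejer (T y : ℝ) : ℝ := ∫ u in (0 : ℝ)..T, 2 * (1 - u / T) * Real.cos (u * y)

lemma fejer_zero {T : ℝ} (hT : 0 < T) : fejer T 0 = T := by
  have h : ∀ u ∈ Set.uIcc 0 T, HasDerivAt (fun u : ℝ ↦ 2 * u - u ^ 2 / T)
      (2 * (1 - u / T) * Real.cos (u * 0)) u := by
    intro u _
    refine (((hasDerivAt_id u).const_mul 2).sub ((hasDerivAt_pow 2 u).div_const T)).congr_deriv ?_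
    simp; ring
  rw [fejer, intervalIntegral.integral_eq_sub_of_hasDerivAt h
    (Continuous.intervalIntegrable (by fun_prop) _ _)]
  field_simp; ring

lemma fejer_eq {T y : ℝ} (hT : 0 < T) (hy : y ≠ 0) :
    fejer T y = 2 * (1 - Real.cos (T * y)) / (T * y ^ 2) := by
  have h : ∀ u ∈ Set.uIcc 0 T, HasDerivAt
      (fun u : ℝ ↦ 2 * ((1 - u / T) * (Real.sin (u * y) / y)) - 2 * (Real.cos (u * y) / (T *
          y ^ 2)))
      (2 * (1 - u / T) * Real.cos (u * y)) u := by
    intro u _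
    have h0 : HasDerivAt (fun u : ℝ ↦ u * y) y u := by simpa using (hasDerivAt_id u).mul_const y
    have h1 := (((hasDerivAt_id u).div_const T).const_sub 1).mul (h0.sin.div_const y)
    refine ((h1.const_mul 2).sub ((h0.cos.div_const (T * y ^ 2)).const_mul 2)).congr_deriv ?_
    simp only [id]
    field_simp; ring
  rw [fejer, intervalIntegral.integral_eq_sub_of_hasDerivAt h
    (Continuous.intervalIntegrable (by fun_prop) _ _)]
  simp
  field_simp; ring

lemma fejer_nonneg {T : ℝ} (hT : 0 < T) (y : ℝ) : 0 ≤ fejer T y := by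
  rcases eq_or_ne y 0 with rfl | hy
  · rw [fejer_zero hT]; exact hT.le
  · rw [fejer_eq hT hy]
    have := Real.cos_le_one (T * y)
    have : 0 ≤ 1 - Real.cos (T * y) := by linarith
    positivity

lemma fejer_le {T : ℝ} (hT : 0 < T) (y : ℝ) : fejer T y ≤ 5 * T * (1 + (T * y) ^ 2)⁻¹ := by
  rcases eq_or_ne y 0 with rfl | hy
  · rw [fejer_zero hT]; simp; linarith
  · rw [fejer_eq hT hy, ← div_eq_mul_inv, div_le_div_iff₀ (by positivity) (by positivity)]
    have h1 := Real.one_sub_sq_div_two_le_cos (x := T * y)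
    have h2 := Real.neg_one_le_cos (T * y)
    have h3 := Real.cos_le_one (T * y)
    have e : 5 * T * (T * y ^ 2) = 5 * (T * y) ^ 2 := by ring
    rw [e]
    generalize Real.cos (T * y) = c at *
    generalize T * y = x at *
    rcases le_total (x ^ 2) 4 with h | h
    · nlinarith [sq_nonneg x]
    · nlinarith

lemma continuous_triangle_exp (T y : ℝ) :
    Continuous fun u : ℝ ↦ ((1 - |u| / T : ℝ) : ℂ) * cexp (I * u * y) := by fun_prop

lemma integral_triangle {T : ℝ} (hT : 0 < T) (y : ℝ) :
    ∫ u in -T..T, ((1 - |u| / T : ℝ) : ℂ) * cexp (I * u * y) = fejer T y := by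
  have hc := continuous_triangle_exp T y
  rw [← intervalIntegral.integral_add_adjacent_intervals (b := 0) (hc.intervalIntegrable _ _)
    (hc.intervalIntegrable _ _)]
  have h := intervalIntegral.integral_comp_neg (a := 0) (b := T)
    fun u : ℝ ↦ ((1 - |u| / T : ℝ) : ℂ) * cexp (I * u * y)
  rw [neg_zero] at h
  rw [← h, ← intervalIntegral.integral_add]
  · rw [fejer, ← intervalIntegral.integral_ofReal]
    refine intervalIntegral.integral_congr fun u hu ↦ ?_
    rw [Set.uIcc_of_le hT.le] at hu
    simp only [abs_neg, abs_of_nonneg hu.1]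
    push_cast
    rw [Complex.cos]
    ring_nf
  · exact (hc.comp continuous_neg).intervalIntegrable _ _
  · exact hc.intervalIntegrable _ _

lemma integrable_fejer_bound {T : ℝ} (hT : 0 < T) (L : ℝ) :
    Integrable fun y : ℝ ↦ 5 * T * (1 + (T * (L - y)) ^ 2)⁻¹ := by
  have h1 : Integrable fun y : ℝ ↦ (1 + (T * y) ^ 2)⁻¹ :=
    integrable_inv_one_add_sq.comp_mul_left' hT.ne'
  exact (h1.comp_sub_left L).const_mul _

lemma integral_fejer_bound {T : ℝ} (hT : 0 < T) (L : ℝ) :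
    ∫ y : ℝ, 5 * T * (1 + (T * (L - y)) ^ 2)⁻¹ = 5 * π := by
  rw [integral_const_mul, integral_sub_left_eq_self (fun y : ℝ ↦ (1 + (T * y) ^ 2)⁻¹),
    Measure.integral_comp_mul_left (fun y : ℝ ↦ (1 + y ^ 2)⁻¹), integral_univ_inv_one_add_sq,
    abs_of_pos (by positivity), smul_eq_mul]
  field_simp

lemma norm_integral_triangle_pole_le {T : ℝ} (hT : 0 < T) {ε : ℝ} (hε : 0 < ε) (L : ℝ) :
    ‖∫ u in -T..T, ((1 - |u| / T : ℝ) : ℂ) * cexp (I * u * L) * (1 / (ε + I * u))‖ ≤ 5 * π := by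
  have hlt : -T ≤ T := by linarith
  have h1 (u : ℝ) : (1 : ℂ) / (ε + I * u) = ∫ y in Set.Ioi (0 : ℝ), cexp (-(ε + I * u) * y) := by
    rw [integral_exp_mul_complex_Ioi (by simp [hε])]
    simp only [Complex.ofReal_zero, mul_zero, Complex.exp_zero, neg_div_neg_eq]
  have hcont : Continuous fun x : ℝ × ℝ ↦
      ((1 - |x.1| / T : ℝ) : ℂ) * cexp (I * x.1 * L) * cexp (-(ε + I * x.1) * x.2) := by fun_prop
  have h2 : ∫ u in -T..T, ((1 - |u| / T : ℝ) : ℂ) * cexp (I * u * L) * (1 / (ε + I * u)) =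
      ∫ y in Set.Ioi (0 : ℝ), ((rexp (-ε * y) * fejer T (L - y) : ℝ) : ℂ) := by
    rw [intervalIntegral.integral_of_le hlt]
    simp only [h1, ← integral_const_mul]
    rw [integral_integral_swap]
    · refine integral_congr_ae (Eventually.of_forall fun y ↦ ?_)
      beta_reduce
      rw [← intervalIntegral.integral_of_le hlt, Complex.ofReal_mul, ← integral_triangle hT,
        ← intervalIntegral.integral_const_mul]
      refine intervalIntegral.integral_congr fun u _ ↦ ?_
      push_cast
      rw [mul_assoc, ← Complex.exp_add, mul_left_comm, ← Complex.exp_add]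
      congr 2
      ring
    · have hb : Integrable (fun x : ℝ × ℝ ↦ (1 : ℝ) * rexp (-ε * x.2))
          ((volume.restrict (Set.Ioc (-T) T)).prod (volume.restrict (Set.Ioi (0 : ℝ)))) :=
        Integrable.mul_prod (f := fun _ ↦ (1 : ℝ)) (integrable_const _)
          (exp_neg_integrableOn_Ioi 0 hε)
      refine hb.mono' hcont.aestronglyMeasurable ?_
      rw [Measure.prod_restrict]
      refine (ae_restrict_iff' (measurableSet_Ioc.prod measurableSet_Ioi)).2
        (Eventually.of_forall fun x hx ↦ ?_)
      have hx1 := hx.1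
      have ha : |x.1| ≤ T := abs_le.2 ⟨hx1.1.le, hx1.2⟩
      have h3 : |x.1| / T ≤ 1 := (div_le_one hT).2 ha
      have h4 : 0 ≤ |x.1| / T := by positivity
      rw [Function.uncurry, norm_mul, norm_mul, Complex.norm_real, Complex.norm_exp,
        Complex.norm_exp, Real.norm_of_nonneg (by linarith)]
      have e1 : (I * (x.1 : ℂ) * (L : ℂ)).re = 0 := by simp
      have e2 : (-((ε : ℂ) + I * (x.1 : ℂ)) * (x.2 : ℂ)).re = -ε * x.2 := by simp
      rw [e1, e2, Real.exp_zero, mul_one]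
      gcongr
      linarith
  rw [h2]
  refine (norm_integral_le_of_norm_le (integrable_fejer_bound hT L).integrableOn ?_).trans
    ((setIntegral_le_integral (integrable_fejer_bound hT L)
      (Eventually.of_forall fun y ↦ by positivity)).trans (integral_fejer_bound hT L).le)
  refine (ae_restrict_iff' measurableSet_Ioi).2 (Eventually.of_forall fun y hy ↦ ?_)
  rw [Complex.norm_real, Real.norm_of_nonneg (mul_nonneg (Real.exp_pos _).le (fejer_nonneg hT _))]
  have h5 : rexp (-ε * y) ≤ 1 := Real.exp_le_one_iff.2 (by nlinarith [Set.mem_Ioi.1 hy])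
  exact (mul_le_of_le_one_left (fejer_nonneg hT _) h5).trans (fejer_le hT _)

end FejerKernel

end QMF

/-! ## A Tauberian bound for nonnegative coefficients -/

namespace QMF
open scoped Real Topology Modular MatrixGroups ENNReal ComplexConjugate
open UpperHalfPlane hiding I
open MeasureTheory

section Tauberian

lemma triangle_mem {T : ℝ} (hT : 0 < T) {u : ℝ} (hu : u ∈ Set.uIoc (-T) T) :
    ‖((1 - |u| / T : ℝ) : ℂ)‖ ≤ 1 := by
  rw [Set.uIoc_of_le (by linarith)] at hu
  have h3 : |u| / T ≤ 1 := (div_le_one hT).2 (abs_le.2 ⟨hu.1.le, hu.2⟩)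
  have h4 : 0 ≤ |u| / T := by positivity
  rw [Complex.norm_real, Real.norm_of_nonneg (by linarith)]
  linarith

lemma hasSum_fejer {c : ℕ → ℝ} {T σ : ℝ} (hT : 0 < T) (hσ : 1 < σ)
    (hs : LSeriesSummable (fun n ↦ (c n : ℂ)) σ) (L : ℝ) :
    HasSum (fun n : ℕ ↦ ((c n * (n : ℝ) ^ (-σ) * fejer T (L - Real.log n) : ℝ) : ℂ))
      (∫ u in -T..T, ((1 - |u| / T : ℝ) : ℂ) * cexp (I * u * L) *
        LSeries (fun n ↦ (c n : ℂ)) (σ + I * u)) := by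
  have hre (u : ℝ) : ((σ : ℂ) + I * u).re = (σ : ℂ).re := by simp
  have hnorm (u : ℝ) (n : ℕ) : ‖LSeries.term (fun n ↦ (c n : ℂ)) (σ + I * u) n‖ =
      ‖LSeries.term (fun n ↦ (c n : ℂ)) σ n‖ := by
    rw [LSeries.norm_term_eq, LSeries.norm_term_eq, hre]
  have hsu (u : ℝ) : LSeriesSummable (fun n ↦ (c n : ℂ)) (σ + I * u) :=
    (LSeriesSummable_iff_of_re_eq_re (hre u)).2 hs
  have hcont (n : ℕ) : Continuous fun u : ℝ ↦ LSeries.term (fun n ↦ (c n : ℂ)) (σ + I * u) n := by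
    rcases eq_or_ne n 0 with rfl | hn
    · simp only [LSeries.term_zero]; exact continuous_const
    · have hn' : (n : ℂ) ≠ 0 := Nat.cast_ne_zero.2 hn
      simp only [LSeries.term_of_ne_zero hn, Complex.cpow_def_of_ne_zero hn']
      exact Continuous.div (by fun_prop) (by fun_prop) fun _ ↦ Complex.exp_ne_zero _
  have key := intervalIntegral.hasSum_integral_of_dominated_convergence (μ := volume)
    (a := -T) (b := T)
    (F := fun n u ↦ ((1 - |u| / T : ℝ) : ℂ) * cexp (I * u * L) *
        LSeries.term (fun n ↦ (c n : ℂ)) (σ + I * u) n)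
    (f := fun u ↦ ((1 - |u| / T : ℝ) : ℂ) * cexp (I * u * L) *
        LSeries (fun n ↦ (c n : ℂ)) (σ + I * u))
    (fun n _ ↦ ‖LSeries.term (fun n ↦ (c n : ℂ)) σ n‖)
    (fun n ↦ ((continuous_triangle_exp T L).mul (hcont n)).aestronglyMeasurable)
    (fun n ↦ Eventually.of_forall fun u hu ↦ ?_)
    (Eventually.of_forall fun u _ ↦ hs.norm) intervalIntegrable_const
    (Eventually.of_forall fun u _ ↦ (hsu u).hasSum.mul_left _)
  · refine HasSum.of_eq key (fun n ↦ ?_) rfl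
    rcases eq_or_ne n 0 with rfl | hn
    · simp [Real.zero_rpow (show -σ ≠ 0 by linarith)]
    · have hn' : (n : ℂ) ≠ 0 := Nat.cast_ne_zero.2 hn
      rw [Complex.ofReal_mul, ← integral_triangle hT, ← intervalIntegral.integral_const_mul]
      refine intervalIntegral.integral_congr fun u _ ↦ ?_
      have e1 : ((c n * (n : ℝ) ^ (-σ) : ℝ) : ℂ) = (c n : ℂ) * cexp (-(σ * Real.log n)) := by
        rw [Complex.ofReal_mul, Real.rpow_def_of_pos (by positivity)]
        push_cast
        congr 2; ring
      simp only [LSeries.term_of_ne_zero hn, Complex.cpow_def_of_ne_zero hn']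
      rw [e1, div_eq_mul_inv (c n : ℂ), ← Complex.exp_neg, ← Complex.natCast_log]
      rw [show ∀ a b x y : ℂ, a * cexp x * (b * cexp y) = a * b * (cexp x * cexp y) by
        intros; ring, show ∀ a b x y : ℂ, b * cexp x * (a * cexp y) = a * b * (cexp x * cexp y) by
        intros; ring, ← Complex.exp_add, ← Complex.exp_add]
      congr 2
      push_cast
      ring
  · rw [norm_mul, norm_mul, Complex.norm_exp, hnorm]
    have e1 : (I * (u : ℂ) * (L : ℂ)).re = 0 := by simp
    rw [e1, Real.exp_zero, mul_one]
    exact mul_le_of_le_one_left (norm_nonneg _) (triangle_mem hT hu)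

lemma coeff_le_of_pole {c : ℕ → ℝ} (hc : ∀ n, 0 ≤ c n) {T σ κ : ℝ} (hT : 0 < T) (hσ : 1 < σ)
    (hs : LSeriesSummable (fun n ↦ (c n : ℂ)) σ) {G : ℂ → ℂ} (hG : Continuous G)
    (hD : ∀ s : ℂ, 1 < s.re → LSeries (fun n ↦ (c n : ℂ)) s = κ / (s - 1) + G s)
    (N : ℕ) : c N * (N : ℝ) ^ (-σ) * T ≤ |κ| * (5 * π) +
      ‖∫ u in -T..T, ((1 - |u| / T : ℝ) : ℂ) * cexp (I * u * Real.log N) * G (σ + I * u)‖ := by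
  have h := hasSum_fejer hT hσ hs (Real.log N)
  have h1 : ∫ u in -T..T, ((1 - |u| / T : ℝ) : ℂ) * cexp (I * u * Real.log N) *
        LSeries (fun n ↦ (c n : ℂ)) (σ + I * u) =
      κ * (∫ u in -T..T, ((1 - |u| / T : ℝ) : ℂ) * cexp (I * u * Real.log N) *
        (1 / ((σ - 1 : ℝ) + I * u))) +
      ∫ u in -T..T, ((1 - |u| / T : ℝ) : ℂ) * cexp (I * u * Real.log N) * G (σ + I * u) := by
    rw [← intervalIntegral.integral_const_mul, ← intervalIntegral.integral_add]
    · refine intervalIntegral.integral_congr fun u _ ↦ ?_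
      rw [hD _ (by simpa using hσ)]
      push_cast
      ring
    · refine Continuous.intervalIntegrable (continuous_const.mul
        ((continuous_triangle_exp T _).mul (Continuous.div (by fun_prop) (by fun_prop) ?_))) _ _
      intro u h0
      have := congrArg Complex.re h0
      simp at this
      linarith
    · exact ((continuous_triangle_exp T _).mul (hG.comp (by fun_prop))).intervalIntegrable _ _
  have h2 : c N * (N : ℝ) ^ (-σ) * T ≤ ‖∫ u in -T..T, ((1 - |u| / T : ℝ) : ℂ) *
      cexp (I * u * Real.log N) * LSeries (fun n ↦ (c n : ℂ)) (σ + I * u)‖ := by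
    have h3 := (Complex.hasSum_iff _ _).1 h |>.1
    simp only [Complex.ofReal_re] at h3
    have h4 := le_hasSum h3 N fun n _ ↦ mul_nonneg (mul_nonneg (hc n) (by positivity))
      (fejer_nonneg hT _)
    rw [sub_self, fejer_zero hT] at h4
    exact h4.trans (Complex.re_le_norm _)
  rw [h1] at h2
  refine h2.trans ((norm_add_le _ _).trans (add_le_add_left ?_ _))
  rw [norm_mul, Complex.norm_real, Real.norm_eq_abs]
  exact mul_le_mul_of_nonneg_left (norm_integral_triangle_pole_le hT (by linarith) _) (abs_nonneg _)

lemma tendsto_riemannLebesgue_log {T : ℝ} (hT : 0 < T) (g : ℝ → ℂ) :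
    Tendsto (fun N : ℕ ↦ ∫ u in -T..T, ((1 - |u| / T : ℝ) : ℂ) * cexp (I * u * Real.log N) * g u)
      atTop (𝓝 0) := by
  have h := Real.tendsto_integral_exp_smul_cocompact
    ((Set.Ioc (-T) T).indicator fun u ↦ ((1 - |u| / T : ℝ) : ℂ) * g u)
  have h2 : Tendsto (fun N : ℕ ↦ -(Real.log N / (2 * π))) atTop (cocompact ℝ) := by
    refine Tendsto.mono_right ?_ atBot_le_cocompact
    exact tendsto_neg_atTop_atBot.comp ((Real.tendsto_log_atTop.comp
      tendsto_natCast_atTop_atTop).atTop_div_const (by positivity))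
  refine (h.comp h2).congr fun N ↦ ?_
  rw [intervalIntegral.integral_of_le (by linarith), ← integral_indicator measurableSet_Ioc]
  refine integral_congr_ae (Eventually.of_forall fun u ↦ ?_)
  by_cases hu : u ∈ Set.Ioc (-T) T
  · simp only [Set.indicator_of_mem hu]
    rw [Circle.smul_def, Real.fourierChar_apply, smul_eq_mul]
    rw [show 2 * π * -(u * -(Real.log N / (2 * π))) = u * Real.log N by field_simp]
    have e : cexp (((u * Real.log N : ℝ) : ℂ) * I) = cexp (I * u * Real.log N) := by
      congr 1; push_cast; ring
    rw [e]
    ring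
  · simp only [Set.indicator_of_notMem hu, smul_zero]

/-- A Tauberian theorem: nonnegative coefficients of a Dirichlet series with only a simple pole
at `1` on the line `re s = 1` are `o(n)`. -/
theorem tendsto_coeff_div {c : ℕ → ℝ} (hc : ∀ n, 0 ≤ c n) {κ : ℝ}
    (hs : ∀ s : ℂ, 1 < s.re → LSeriesSummable (fun n ↦ (c n : ℂ)) s) {G : ℂ → ℂ}
    (hG : Continuous G)
    (hD : ∀ s : ℂ, 1 < s.re → LSeries (fun n ↦ (c n : ℂ)) s = κ / (s - 1) + G s) :
    Tendsto (fun n : ℕ ↦ c n / n) atTop (𝓝 0) := by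
  have key (T : ℝ) (hT : 0 < T) (N : ℕ) (hN : N ≠ 0) : c N / N * T ≤ |κ| * (5 * π) +
      ‖∫ u in -T..T, ((1 - |u| / T : ℝ) : ℂ) * cexp (I * u * Real.log N) * G (1 + I * u)‖ := by
    have hN' : (0 : ℝ) < N := by positivity
    have hl : Tendsto (fun σ : ℝ ↦ c N * (N : ℝ) ^ (-σ) * T) (𝓝[>] 1) (𝓝 (c N / N * T)) := by
      have : Continuous fun σ : ℝ ↦ c N * (N : ℝ) ^ (-σ) * T := by
        have := Real.continuous_const_rpow hN'.ne'
        fun_prop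
      have h := (this.tendsto 1).mono_left (nhdsWithin_le_nhds (s := Set.Ioi 1))
      rwa [Real.rpow_neg_one, ← div_eq_mul_inv] at h
    have hr : Tendsto (fun σ : ℝ ↦ |κ| * (5 * π) +
        ‖∫ u in -T..T, ((1 - |u| / T : ℝ) : ℂ) * cexp (I * u * Real.log N) * G (σ + I * u)‖)
        (𝓝[>] 1) (𝓝 (|κ| * (5 * π) +
        ‖∫ u in -T..T, ((1 - |u| / T : ℝ) : ℂ) * cexp (I * u * Real.log N) * G (1 + I * u)‖)) := by
      have h1 : Continuous fun σ : ℝ ↦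
          ∫ u in -T..T, ((1 - |u| / T : ℝ) : ℂ) * cexp (I * u * Real.log N) * G (σ + I * u) := by
        refine intervalIntegral.continuous_parametric_intervalIntegral_of_continuous' ?_ (-T) T
        simp only [Function.uncurry_def]
        have := hG.comp (show Continuous fun p : ℝ × ℝ ↦ (p.1 : ℂ) + I * p.2 by fun_prop)
        exact Continuous.mul (by fun_prop) this
      have h2 := (h1.tendsto 1).mono_left (nhdsWithin_le_nhds (s := Set.Ioi 1))
      simp only [Complex.ofReal_one] at h2
      exact h2.norm.const_add _
    exact le_of_tendsto_of_tendsto hl hr (eventually_nhdsWithin_of_forall fun σ hσ ↦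
      coeff_le_of_pole hc hT hσ (hs σ (by simpa using hσ)) hG hD N)
  refine tendsto_order.2 ⟨fun a ha ↦ Eventually.of_forall fun n ↦ ha.trans_le
    (div_nonneg (hc n) n.cast_nonneg), fun ε hε ↦ ?_⟩
  set A := |κ| * (5 * π) + 1
  have hA : 0 < A := by positivity
  have hT : 0 < A / ε := by positivity
  have h0 := (tendsto_riemannLebesgue_log hT fun u ↦ G (1 + I * u)).norm
  rw [norm_zero] at h0
  filter_upwards [h0.eventually_lt_const one_pos, eventually_ne_atTop 0] with N h1 hN
  have h2 := key _ hT N hN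
  have h3 : c N / N * (A / ε) < A := h2.trans_lt (by simp only [A]; linarith)
  rw [mul_div_assoc', div_lt_iff₀ hε, mul_comm] at h3
  exact lt_of_mul_lt_mul_left h3 hA.le

end Tauberian

end QMF

/-! ## Local Euler factors -/

namespace QMF
open scoped Real Topology Modular MatrixGroups ENNReal ComplexConjugate
open UpperHalfPlane hiding I
open MeasureTheory

section Local

/-- A root of `X ^ 2 - a X + 1`. -/
def satake (a : ℝ) : ℂ := (a + ((a ^ 2 - 4 : ℂ)) ^ (1 / 2 : ℂ)) / 2

/-- The other root of `X ^ 2 - a X + 1`. -/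
def satake' (a : ℝ) : ℂ := (a - ((a ^ 2 - 4 : ℂ)) ^ (1 / 2 : ℂ)) / 2

lemma cpow_half_sq (z : ℂ) : (z ^ (1 / 2 : ℂ)) ^ 2 = z := by
  rw [← Complex.cpow_nat_mul]
  simp

lemma satake_add (a : ℝ) : satake a + satake' a = a := by
  unfold satake satake'
  ring

lemma satake_mul (a : ℝ) : satake a * satake' a = 1 := by
  have h := cpow_half_sq (a ^ 2 - 4 : ℂ)
  unfold satake satake'
  linear_combination (-1 / 4 : ℂ) * h

/-- The larger of the two squared absolute values of the roots of `X ^ 2 - a X + 1`. -/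
def satakeBd (a : ℝ) : ℝ := max (‖satake a‖ ^ 2) (‖satake' a‖ ^ 2)

lemma satakeBd_nonneg (a : ℝ) : 0 ≤ satakeBd a := le_max_of_le_left (by positivity)

lemma satakeBd_le (a : ℝ) : satakeBd a ≤ a ^ 2 + 2 := by
  have h := parallelogram_law_with_norm ℝ (satake a) (satake' a)
  have h1 : (satake a - satake' a) ^ 2 = ((a ^ 2 - 4 : ℝ) : ℂ) := by
    have h3 := satake_add a
    have h4 := satake_mul a
    push_cast
    linear_combination (satake a + satake' a + a) * h3 - 4 * h4
  have h2 : ‖satake a - satake' a‖ ^ 2 = |a ^ 2 - 4| := by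
    rw [← norm_pow, h1, Complex.norm_real, Real.norm_eq_abs]
  have h3 : |a ^ 2 - 4| ≤ a ^ 2 + 4 := abs_le.2 ⟨by nlinarith [sq_nonneg a], by linarith⟩
  have h4 : ‖satake a + satake' a‖ ^ 2 = a ^ 2 := by
    rw [satake_add, Complex.norm_real, Real.norm_eq_abs, sq_abs]
  have h5 := sq_nonneg ‖satake a‖
  have h6 := sq_nonneg ‖satake' a‖
  exact max_le (by nlinarith) (by nlinarith)

/-- The power sums of the roots of `X ^ 2 - a X + 1`. -/
def tr (a : ℝ) : ℕ → ℝ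
  | 0 => 2
  | 1 => a
  | (m + 2) => a * tr a (m + 1) - tr a m

lemma tr_one (a : ℝ) : tr a 1 = a := rfl

lemma ofReal_tr (a : ℝ) (m : ℕ) : (tr a m : ℂ) = satake a ^ m + satake' a ^ m := by
  induction m using Nat.twoStepInduction with
  | zero => simp [tr]; norm_num
  | one => simp [tr, satake_add]
  | more m h0 h1 =>
    have h3 := satake_add a
    have h4 := satake_mul a
    rw [tr]
    push_cast
    rw [h0, h1, ← h3]
    linear_combination (satake a ^ m + satake' a ^ m) * h4

lemma tr_sq_le (a : ℝ) (m : ℕ) : tr a m ^ 2 ≤ 4 * satakeBd a ^ m := by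
  have h1 : (‖satake a‖ ^ m) ^ 2 ≤ satakeBd a ^ m := by
    rw [← pow_mul, mul_comm, pow_mul]
    exact pow_le_pow_left₀ (by positivity) (le_max_left _ _) _
  have h2 : (‖satake' a‖ ^ m) ^ 2 ≤ satakeBd a ^ m := by
    rw [← pow_mul, mul_comm, pow_mul]
    exact pow_le_pow_left₀ (by positivity) (le_max_right _ _) _
  have h3 : |tr a m| ≤ ‖satake a‖ ^ m + ‖satake' a‖ ^ m := by
    rw [← Real.norm_eq_abs, ← Complex.norm_real, ofReal_tr, ← norm_pow, ← norm_pow]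
    exact norm_add_le _ _
  rw [← sq_abs]
  have h4 := pow_le_pow_left₀ (abs_nonneg _) h3 2
  nlinarith [sq_nonneg (‖satake a‖ ^ m - ‖satake' a‖ ^ m)]

lemma sub_satake_mul {U : ℕ → ℝ} {a : ℝ} (h0 : U 0 = 1) (h1 : U 1 = a)
    (h2 : ∀ e, U (e + 2) = a * U (e + 1) - U e) {α β : ℂ} (hs : α + β = a) (hm : α * β = 1)
    (e : ℕ) : (U (e + 1) : ℂ) - β * U e = α ^ (e + 1) := by
  induction e with
  | zero => simp [h0, h1, ← hs]
  | succ e ih =>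
    rw [h2, pow_succ, ← ih]
    push_cast
    rw [← hs]
    linear_combination (U e : ℂ) * hm

lemma root_norm_sq_lt {U : ℕ → ℝ} {a : ℝ} (h0 : U 0 = 1) (h1 : U 1 = a)
    (h2 : ∀ e, U (e + 2) = a * U (e + 1) - U e) {α β : ℂ} (hs : α + β = a) (hm : α * β = 1)
    {q : ℝ} (hq : 0 < q) (hU : Tendsto (fun e ↦ U e ^ 2 / q ^ e) atTop (𝓝 0)) :
    ‖α‖ ^ 2 < q := by
  have hU' : Tendsto (fun e ↦ |U e| / √q ^ e) atTop (𝓝 0) := by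
    have := (Real.continuous_sqrt.tendsto 0).comp hU
    rw [Real.sqrt_zero] at this
    refine this.congr fun e ↦ ?_
    have : q ^ e = (√q ^ e) ^ 2 := by rw [← pow_mul, mul_comm, pow_mul, Real.sq_sqrt hq.le]
    rw [Function.comp_apply, Real.sqrt_div (by positivity), Real.sqrt_sq_eq_abs, this,
      Real.sqrt_sq (by positivity)]
  have hlim : Tendsto (fun e ↦ |U (e + 1)| / √q ^ (e + 1) + ‖β‖ / √q * (|U e| / √q ^ e)) atTop
      (𝓝 0) := by
    simpa using ((tendsto_add_atTop_iff_nat 1).2 hU').add (hU'.const_mul (‖β‖ / √q))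
  have hsq : 0 < √q := Real.sqrt_pos.2 hq
  have h3 : Tendsto (fun e ↦ (‖α‖ / √q) ^ (e + 1)) atTop (𝓝 0) := by
    refine squeeze_zero (fun e ↦ by positivity) (fun e ↦ ?_) hlim
    have h4 := sub_satake_mul h0 h1 h2 hs hm e
    have h5 : ‖α‖ ^ (e + 1) ≤ |U (e + 1)| + ‖β‖ * |U e| := by
      rw [← norm_pow, ← h4, ← Real.norm_eq_abs, ← Real.norm_eq_abs, ← Complex.norm_real,
        ← Complex.norm_real (U e), ← norm_mul]
      exact norm_sub_le _ _
    rw [div_pow]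
    calc ‖α‖ ^ (e + 1) / √q ^ (e + 1) ≤ (|U (e + 1)| + ‖β‖ * |U e|) / √q ^ (e + 1) := by gcongr
      _ = _ := by
        rw [pow_succ]
        field_simp
  have h4 : Tendsto (fun e ↦ (‖α‖ / √q) ^ e) atTop (𝓝 0) := (tendsto_add_atTop_iff_nat 1).1 h3
  rw [tendsto_pow_atTop_nhds_zero_iff, abs_of_nonneg (by positivity), div_lt_one hsq] at h4
  calc ‖α‖ ^ 2 < √q ^ 2 := by gcongr
    _ = q := Real.sq_sqrt hq.le

lemma satakeBd_lt {U : ℕ → ℝ} {a : ℝ} (h0 : U 0 = 1) (h1 : U 1 = a)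
    (h2 : ∀ e, U (e + 2) = a * U (e + 1) - U e)
    {q : ℝ} (hq : 0 < q) (hU : Tendsto (fun e ↦ U e ^ 2 / q ^ e) atTop (𝓝 0)) :
    satakeBd a < q :=
  max_lt (root_norm_sq_lt h0 h1 h2 (satake_add a) (satake_mul a) hq hU)
    (root_norm_sq_lt h0 h1 h2 (by rw [add_comm, satake_add]) (by rw [mul_comm, satake_mul]) hq hU)

lemma local_factor {U V : ℕ → ℝ} {a b : ℝ} (hU0 : U 0 = 1) (hU1 : U 1 = a)
    (hU : ∀ e, U (e + 2) = a * U (e + 1) - U e) (hV0 : V 0 = 1) (hV1 : V 1 = b)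
    (hV : ∀ e, V (e + 2) = b * V (e + 1) - V e) {x A : ℂ}
    (hA : HasSum (fun e ↦ (U e : ℂ) * V e * x ^ e) A) :
    A * ((1 - satake a * satake b * x) * (1 - satake a * satake' b * x) *
      (1 - satake' a * satake b * x) * (1 - satake' a * satake' b * x)) = 1 - x ^ 2 := by
  have s1 := (hasSum_nat_add_iff' 1).2 hA
  have s2 := (hasSum_nat_add_iff' 2).2 hA
  have s3 := (hasSum_nat_add_iff' 3).2 hA
  have s4 := (hasSum_nat_add_iff' 4).2 hA
  have s5 := (((s3.mul_left (a * b * x : ℂ)).sub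
    (s2.mul_left ((a ^ 2 + b ^ 2 - 2) * x ^ 2 : ℂ))).add (s1.mul_left (a * b * x ^ 3 : ℂ))).sub
    (hA.mul_left (x ^ 4))
  have s6 := s4.unique (HasSum.of_eq s5 (fun e ↦ by
    have u3 : U (e + 3) = a * U (e + 2) - U (e + 1) := hU (e + 1)
    have u4 : U (e + 4) = a * U (e + 3) - U (e + 2) := hU (e + 2)
    have v3 : V (e + 3) = b * V (e + 2) - V (e + 1) := hV (e + 1)
    have v4 : V (e + 4) = b * V (e + 3) - V (e + 2) := hV (e + 2)
    rw [u4, v4, u3, v3, hU, hV]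
    push_cast
    ring) rfl)
  have hU2 : U 2 = a * U 1 - U 0 := hU 0
  have hU3 : U 3 = a * U 2 - U 1 := hU 1
  have hV2 : V 2 = b * V 1 - V 0 := hV 0
  have hV3 : V 3 = b * V 2 - V 1 := hV 1
  simp only [Finset.sum_range_succ, Finset.sum_range_zero, hU3, hV3, hU2, hV2, hU1, hV1, hU0,
    hV0] at s6
  push_cast at s6
  have e1 := satake_add a
  have e2 := satake_mul a
  have e3 := satake_add b
  have e4 := satake_mul b
  have key : (1 - satake a * satake b * x) * (1 - satake a * satake' b * x) *
      (1 - satake' a * satake b * x) * (1 - satake' a * satake' b * x) =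
      1 - a * b * x + (a ^ 2 + b ^ 2 - 2) * x ^ 2 - a * b * x ^ 3 + x ^ 4 := by
    have k1 : (1 - satake a * satake b * x) * (1 - satake a * satake' b * x) =
        1 - satake a * b * x + satake a ^ 2 * x ^ 2 := by
      rw [← e3]
      linear_combination (satake a ^ 2 * x ^ 2) * e4
    have k2 : (1 - satake' a * satake b * x) * (1 - satake' a * satake' b * x) =
        1 - satake' a * b * x + satake' a ^ 2 * x ^ 2 := by
      rw [← e3]
      linear_combination (satake' a ^ 2 * x ^ 2) * e4
    rw [k1, mul_assoc, k2, ← e1]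
    generalize satake a = α at *
    generalize satake' a = β at *
    linear_combination (b ^ 2 * x ^ 2 - 2 * x ^ 2 - b * (α + β) * x ^ 3 + (α * β + 1) * x ^ 4) * e2
  rw [key]
  linear_combination s6

lemma local_log {a b : ℝ} {x : ℂ} {q : ℝ} (hq : 0 < q) (ha : satakeBd a < q) (hb : satakeBd b < q)
    (hx : ‖x‖ ≤ q⁻¹) :
    ∃ l : ℂ, HasSum (fun m : ℕ ↦ (tr a (m + 1) * tr b (m + 1) / (m + 1 : ℝ) : ℝ) * x ^ (m + 1)) l ∧
      cexp l * ((1 - satake a * satake b * x) * (1 - satake a * satake' b * x) *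
      (1 - satake' a * satake b * x) * (1 - satake' a * satake' b * x)) = 1 := by
  have hbd {α β : ℂ} (h1 : ‖α‖ ^ 2 < q) (h2 : ‖β‖ ^ 2 < q) : ‖α * β * x‖ < 1 := by
    rw [norm_mul, norm_mul]
    have : ‖α‖ * ‖β‖ < q := by nlinarith [sq_nonneg (‖α‖ - ‖β‖)]
    calc ‖α‖ * ‖β‖ * ‖x‖ ≤ ‖α‖ * ‖β‖ * q⁻¹ := by gcongr
      _ < q * q⁻¹ := by gcongr
      _ = 1 := mul_inv_cancel₀ hq.ne'
  have hsum {z : ℂ} (hz : ‖z‖ < 1) :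
      HasSum (fun m : ℕ ↦ z ^ (m + 1) / ((m : ℂ) + 1)) (-Complex.log (1 - z)) := by
    simpa using (hasSum_nat_add_iff' 1).2 (Complex.hasSum_taylorSeries_neg_log hz)
  have hexp {z : ℂ} (hz : ‖z‖ < 1) : cexp (-Complex.log (1 - z)) * (1 - z) = 1 := by
    have : 1 - z ≠ 0 := by
      intro h
      rw [← sub_eq_zero.1 h, norm_one] at hz
      exact lt_irrefl _ hz
    rw [Complex.exp_neg, Complex.exp_log this, inv_mul_cancel₀ this]
  have a1 := (le_max_left _ _).trans_lt ha
  have a2 := (le_max_right _ _).trans_lt ha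
  have b1 := (le_max_left _ _).trans_lt hb
  have b2 := (le_max_right _ _).trans_lt hb
  have z1 := hbd a1 b1
  have z2 := hbd a1 b2
  have z3 := hbd a2 b1
  have z4 := hbd a2 b2
  refine ⟨_, HasSum.of_eq ((((hsum z1).add (hsum z2)).add (hsum z3)).add (hsum z4))
    (fun m ↦ ?_) rfl, ?_⟩
  · push_cast
    rw [ofReal_tr, ofReal_tr]
    simp only [mul_pow]
    ring
  · rw [Complex.exp_add, Complex.exp_add, Complex.exp_add]
    calc _ = (cexp (-Complex.log (1 - satake a * satake b * x)) * (1 - satake a * satake b * x)) *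
        (cexp (-Complex.log (1 - satake a * satake' b * x)) * (1 - satake a * satake' b * x)) *
        (cexp (-Complex.log (1 - satake' a * satake b * x)) * (1 - satake' a * satake b * x)) *
        (cexp (-Complex.log (1 - satake' a * satake' b * x)) *
          (1 - satake' a * satake' b * x)) := by ring
      _ = 1 := by rw [hexp z1, hexp z2, hexp z3, hexp z4]; norm_num

end Local

end QMF

/-! ## Global Euler products -/

namespace QMF
open scoped Real Topology Modular MatrixGroups ENNReal ComplexConjugate
open UpperHalfPlane hiding I
open MeasureTheory

/-- Normalized Hecke eigenvalue sequences. -/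
structure HeckeSeq (u : ℕ → ℝ) : Prop where
  zero : u 0 = 0
  one : u 1 = 1
  prime_mul : ∀ p : ℕ, p.Prime → ∀ n, u (p * n) = u p * u n - if p ∣ n then u (n / p) else 0
  little : Tendsto (fun n : ℕ ↦ u n ^ 2 / n) atTop (𝓝 0)
  summ : ∀ σ : ℝ, 1 < σ → Summable (fun n : ℕ ↦ u n ^ 2 * (n : ℝ) ^ (-σ))

section Global

variable {u v : ℕ → ℝ}

lemma HeckeSeq.coprime_mul (hu : HeckeSeq u) (m : ℕ) : ∀ n, m.Coprime n →
    u (m * n) = u m * u n := by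
  induction m using Nat.strong_induction_on with
  | _ m ih =>
    intro n hmn
    rcases eq_or_ne m 0 with rfl | hm0
    · simp [hu.zero]
    rcases eq_or_ne m 1 with rfl | hm1
    · simp [hu.one]
    obtain ⟨p, hp, k, rfl⟩ := Nat.exists_prime_and_dvd hm1
    have hk0 : 0 < k := Nat.pos_of_ne_zero (right_ne_zero_of_mul hm0)
    have hkn : k.Coprime n := Nat.Coprime.coprime_mul_left hmn
    have hpn : p.Coprime n := Nat.Coprime.coprime_mul_right hmn
    have hlt : k < p * k := by nlinarith [hp.two_le]
    have hdvd : p ∣ k * n ↔ p ∣ k :=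
      ⟨fun h ↦ hpn.dvd_of_dvd_mul_right h, fun h ↦ Dvd.dvd.mul_right h n⟩
    rw [mul_assoc, hu.prime_mul p hp, hu.prime_mul p hp, ih k hlt n hkn]
    by_cases hpk : p ∣ k
    · obtain ⟨l, rfl⟩ := hpk
      have hl : l < p * (p * l) := by nlinarith [hp.two_le, Nat.pos_of_mul_pos_left hk0]
      rw [if_pos (hdvd.2 (dvd_mul_right _ _)), if_pos (dvd_mul_right _ _), mul_assoc,
        Nat.mul_div_cancel_left _ hp.pos, Nat.mul_div_cancel_left _ hp.pos,
        ih l hl n (Nat.Coprime.coprime_mul_left hkn)]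
      ring
    · rw [if_neg (hdvd.not.2 hpk), if_neg hpk]
      ring

lemma HeckeSeq.pow_add_two (hu : HeckeSeq u) {p : ℕ} (hp : p.Prime) (e : ℕ) :
    u (p ^ (e + 2)) = u p * u (p ^ (e + 1)) - u (p ^ e) := by
  rw [show p ^ (e + 2) = p * p ^ (e + 1) by ring, hu.prime_mul p hp, if_pos ⟨p ^ e, by ring⟩,
    show p ^ (e + 1) = p * p ^ e by ring, Nat.mul_div_cancel_left _ hp.pos]

lemma HeckeSeq.satakeBd_lt (hu : HeckeSeq u) {p : ℕ} (hp : p.Prime) : satakeBd (u p) < p := by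
  refine QMF.satakeBd_lt (U := fun e ↦ u (p ^ e)) (by simp [hu.one]) (by simp)
    (hu.pow_add_two hp) (by exact_mod_cast hp.pos) ?_
  exact (hu.little.comp (tendsto_pow_atTop_atTop_of_one_lt hp.one_lt)).congr fun e ↦ by simp

lemma norm_term_mul_le (u v : ℕ → ℝ) (s : ℂ) (n : ℕ) :
    ‖LSeries.term (fun n ↦ (u n * v n : ℝ)) s n‖ ≤
      (u n ^ 2 * (n : ℝ) ^ (-s.re) + v n ^ 2 * (n : ℝ) ^ (-s.re)) := by
  rw [LSeries.norm_term_eq]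
  split_ifs with h
  · positivity
  · rw [Complex.norm_real, norm_mul, Real.norm_eq_abs, Real.norm_eq_abs, Real.rpow_neg (by simp),
      div_eq_mul_inv, ← add_mul]
    gcongr
    rw [← sq_abs, ← sq_abs (v n)]
    nlinarith [sq_nonneg (|u n| - |v n|), sq_nonneg (|u n|), sq_nonneg (|v n|)]

lemma HeckeSeq.lseriesSummable (hu : HeckeSeq u) (hv : HeckeSeq v) {s : ℂ} (hs : 1 < s.re) :
    LSeriesSummable (fun n ↦ (u n * v n : ℝ)) s :=
  Summable.of_norm_bounded ((hu.summ _ hs).add (hv.summ _ hs)) (norm_term_mul_le u v s)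

lemma pow_cpow_neg (p e : ℕ) (s : ℂ) : (((p ^ e : ℕ) : ℂ) ^ s)⁻¹ = ((p : ℂ) ^ (-s)) ^ e := by
  rw [← Complex.cpow_neg, Nat.cast_pow, ← Complex.cpow_nat_mul, ← Complex.natCast_cpow_natCast_mul]

/-- The terms of the logarithm of the Rankin–Selberg Euler product. -/
def ellTerm (u v : ℕ → ℝ) (s : ℂ) (p : Nat.Primes × ℕ) : ℂ :=
  (tr (u p.1) (p.2 + 1) * tr (v p.1) (p.2 + 1) / (p.2 + 1 : ℝ) : ℝ) *
    (((p.1 : ℕ) : ℂ) ^ (-s)) ^ (p.2 + 1)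

lemma norm_prime_cpow_le (p : Nat.Primes) {s : ℂ} (hs : 1 < s.re) :
    ‖((p : ℕ) : ℂ) ^ (-s)‖ ≤ ((p : ℕ) : ℝ)⁻¹ := by
  rw [Complex.norm_natCast_cpow_of_pos p.2.pos, ← Real.rpow_neg_one, neg_re]
  exact Real.rpow_le_rpow_of_exponent_le (by exact_mod_cast p.2.one_lt.le) (by linarith)

lemma HeckeSeq.local_euler (hu : HeckeSeq u) (hv : HeckeSeq v) {s : ℂ} (hs : 1 < s.re)
    (p : Nat.Primes) :
    Summable (fun m ↦ ellTerm u v s (p, m)) ∧ cexp (∑' m, ellTerm u v s (p, m)) =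
      (1 - ((p : ℕ) : ℂ) ^ (-(2 * s)))⁻¹ *
        ∑' e, LSeries.term (fun n ↦ (u n * v n : ℝ)) s ((p : ℕ) ^ e) := by
  set x : ℂ := ((p : ℕ) : ℂ) ^ (-s) with hx
  have hxn := norm_prime_cpow_le p hs
  have hp0 : (0 : ℝ) < (p : ℕ) := by exact_mod_cast p.2.pos
  obtain ⟨l, hl, he⟩ := local_log hp0 (hu.satakeBd_lt p.2) (hv.satakeBd_lt p.2) hxn
  have hA : HasSum (fun e ↦ (u ((p : ℕ) ^ e) : ℂ) * v ((p : ℕ) ^ e) * x ^ e)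
      (∑' e, LSeries.term (fun n ↦ (u n * v n : ℝ)) s ((p : ℕ) ^ e)) := by
    have h1 : Summable (fun e ↦ LSeries.term (fun n ↦ (u n * v n : ℝ)) s ((p : ℕ) ^ e)) :=
      (hu.lseriesSummable hv hs).comp_injective (Nat.pow_right_injective p.2.two_le)
    refine HasSum.of_eq h1.hasSum (fun e ↦ ?_) rfl
    rw [LSeries.term_of_ne_zero (pow_ne_zero _ p.2.ne_zero), div_eq_mul_inv, pow_cpow_neg]
    push_cast
    rfl
  have hloc := local_factor (U := fun e ↦ u ((p : ℕ) ^ e)) (V := fun e ↦ v ((p : ℕ) ^ e))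
    (by simp [hu.one]) (by simp) (hu.pow_add_two p.2) (by simp [hv.one]) (by simp)
    (hv.pow_add_two p.2) hA
  have hx2 : ((p : ℕ) : ℂ) ^ (-(2 * s)) = x ^ 2 := by
    rw [hx, ← Complex.cpow_nat_mul]
    congr 1
    push_cast
    ring
  have hx1 : 1 - x ^ 2 ≠ 0 := by
    intro h
    have h2 : ‖x‖ ^ 2 = 1 := by rw [← norm_pow, ← sub_eq_zero.1 h, norm_one]
    have h3 : ‖x‖ < 1 := hxn.trans_lt (inv_lt_one_of_one_lt₀ (by exact_mod_cast p.2.one_lt))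
    nlinarith [norm_nonneg x]
  refine ⟨hl.summable, ?_⟩
  rw [show (∑' m, ellTerm u v s (p, m)) = l from hl.tsum_eq, hx2]
  rw [eq_inv_mul_iff_mul_eq₀ hx1, ← hloc, mul_assoc, mul_comm _ (cexp l), he, mul_one]

lemma HeckeSeq.hasProd_exp (hu : HeckeSeq u) (hv : HeckeSeq v) {s : ℂ} (hs : 1 < s.re) :
    HasProd (fun p : Nat.Primes ↦ cexp (∑' m, ellTerm u v s (p, m)))
      (riemannZeta (2 * s) * LSeries (fun n ↦ (u n * v n : ℝ)) s) := by
  have h1 := riemannZeta_eulerProduct_hasProd (s := 2 * s) (by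
    rw [mul_re]; norm_num; linarith)
  have h2 : HasProd (fun p : Nat.Primes ↦
      ∑' e, LSeries.term (fun n ↦ (u n * v n : ℝ)) s ((p : ℕ) ^ e))
      (∑' n, LSeries.term (fun n ↦ (u n * v n : ℝ)) s n) := by
    refine EulerProduct.eulerProduct_hasProd ?_ ?_ (hu.lseriesSummable hv hs).norm (by simp)
    · simp [LSeries.term, hu.one, hv.one]
    · intro m n hmn
      rcases eq_or_ne m 0 with rfl | hm
      · simp
      rcases eq_or_ne n 0 with rfl | hn
      · simp
      rw [LSeries.term_of_ne_zero (mul_ne_zero hm hn), LSeries.term_of_ne_zero hm,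
        LSeries.term_of_ne_zero hn, hu.coprime_mul m n hmn, hv.coprime_mul m n hmn, Nat.cast_mul,
        Complex.natCast_mul_natCast_cpow]
      push_cast
      rw [div_mul_div_comm]
      ring_nf
  refine (h1.mul h2).congr_fun ?_
  exact fun p ↦ (hu.local_euler hv hs p).2

end Global

end QMF

/-! ## Logarithms of Euler products and Landau's lemma -/

namespace QMF
open scoped Real Topology Modular MatrixGroups ENNReal ComplexConjugate
open UpperHalfPlane hiding I
open MeasureTheory

section LogSeries

variable {u v : ℕ → ℝ}

lemma summable_of_hasProd_exp {ι : Type*} {f : ι → ℝ} (hf : ∀ i, 0 ≤ f i) {L : ℝ}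
    (h : HasProd (fun i ↦ Real.exp (f i)) L) : Summable f := by
  refine summable_of_sum_le hf (c := L) fun F ↦ ?_
  have h1 : ∏ i ∈ F, Real.exp (f i) ≤ L := by
    refine Monotone.ge_of_tendsto (f := fun F ↦ ∏ i ∈ F, Real.exp (f i)) ?_ h F
    intro s t hst
    simp only [← Real.exp_sum]
    exact Real.exp_le_exp.2 (Finset.sum_le_sum_of_subset_of_nonneg hst fun i _ _ ↦ hf i)
  rw [← Real.exp_sum] at h1
  linarith [Real.add_one_le_exp (∑ i ∈ F, f i)]

lemma ellTerm_self (u : ℕ → ℝ) (σ : ℝ) (p : Nat.Primes × ℕ) : ellTerm u u σ p =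
    ((tr (u p.1) (p.2 + 1) ^ 2 / (p.2 + 1 : ℝ) * (((p.1 : ℕ) : ℝ) ^ (-σ)) ^ (p.2 +
        1) : ℝ) : ℂ) := by
  rw [ellTerm, ← sq]
  push_cast
  rw [Complex.ofReal_cpow (by positivity)]
  push_cast
  rfl

lemma HeckeSeq.summable_ellTerm_self (hu : HeckeSeq u) {σ : ℝ} (hσ : 1 < σ) :
    Summable (ellTerm u u σ) := by
  have h0 (p : Nat.Primes × ℕ) : 0 ≤ tr (u p.1) (p.2 + 1) ^ 2 / (p.2 + 1 : ℝ) *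
      (((p.1 : ℕ) : ℝ) ^ (-σ)) ^ (p.2 + 1) := by positivity
  rw [funext (ellTerm_self u σ), Complex.summable_ofReal]
  refine (summable_prod_of_nonneg h0).2 ⟨fun p ↦ ?_, ?_⟩
  · rw [← Complex.summable_ofReal]
    exact (hu.local_euler hu (s := σ) (by simpa using hσ) p).1.congr fun m ↦
      ellTerm_self u σ (p, m)
  · refine summable_of_hasProd_exp (fun p ↦ tsum_nonneg fun m ↦ h0 (p, m))
      (L := ‖riemannZeta (2 * σ) * LSeries (fun n ↦ (u n * u n : ℝ)) σ‖) ?_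
    refine (hu.hasProd_exp hu (s := σ) (by simpa using hσ)).norm.congr_fun fun p ↦ ?_
    rw [tsum_congr fun m ↦ ellTerm_self u σ (p, m), ← Complex.ofReal_tsum, ← Complex.ofReal_exp,
      Complex.norm_real, Real.norm_of_nonneg (Real.exp_pos _).le]

lemma norm_ellTerm_le (u v : ℕ → ℝ) (s : ℂ) (p : Nat.Primes × ℕ) :
    ‖ellTerm u v s p‖ ≤ ‖ellTerm u u s.re p‖ + ‖ellTerm v v s.re p‖ := by
  simp only [ellTerm, norm_mul, norm_pow, Complex.norm_real, Complex.norm_natCast_cpow_of_pos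
    p.1.2.pos, neg_re, ofReal_re, ← add_mul]
  gcongr
  simp only [norm_mul, norm_div, ← add_div]
  gcongr
  nlinarith [sq_nonneg (‖tr (u p.1) (p.2 + 1)‖ - ‖tr (v p.1) (p.2 + 1)‖),
    sq_nonneg ‖tr (u p.1) (p.2 + 1)‖, sq_nonneg ‖tr (v p.1) (p.2 + 1)‖]

lemma HeckeSeq.summable_ellTerm (hu : HeckeSeq u) (hv : HeckeSeq v) {s : ℂ} (hs : 1 < s.re) :
    Summable (ellTerm u v s) :=
  Summable.of_norm_bounded ((hu.summable_ellTerm_self hs).norm.add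
    (hv.summable_ellTerm_self hs).norm) (norm_ellTerm_le u v s)

lemma HeckeSeq.exp_tsum_ellTerm (hu : HeckeSeq u) (hv : HeckeSeq v) {s : ℂ} (hs : 1 < s.re) :
    cexp (∑' p, ellTerm u v s p) =
      riemannZeta (2 * s) * LSeries (fun n ↦ (u n * v n : ℝ)) s := by
  have h1 := (hu.summable_ellTerm hv hs).hasSum.prod_fiberwise
    fun p ↦ (hu.local_euler hv hs p).1.hasSum
  exact h1.cexp.unique (hu.hasProd_exp hv hs)

/-- The coefficients of the logarithm of the Rankin–Selberg Euler product. -/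
def logCoeff (u v : ℕ → ℝ) (n : ℕ) : ℝ :=
  if IsPrimePow n then tr (u n.minFac) (n.factorization n.minFac) *
    tr (v n.minFac) (n.factorization n.minFac) / (n.factorization n.minFac : ℝ) else 0

lemma logCoeff_prime_pow (u v : ℕ → ℝ) {p : ℕ} (hp : p.Prime) (m : ℕ) :
    logCoeff u v (p ^ (m + 1)) = tr (u p) (m + 1) * tr (v p) (m + 1) / (m + 1 : ℝ) := by
  have h1 : IsPrimePow (p ^ (m + 1)) := hp.isPrimePow.pow (Nat.succ_ne_zero m)
  rw [logCoeff, if_pos h1, hp.pow_minFac (Nat.succ_ne_zero m), Nat.factorization_pow]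
  simp [hp.factorization_self]

lemma term_logCoeff (u v : ℕ → ℝ) (s : ℂ) (p : Nat.Primes × ℕ) :
    LSeries.term (fun n ↦ (logCoeff u v n : ℂ)) s (Nat.Primes.prodNatEquiv p) =
      ellTerm u v s p := by
  obtain ⟨p, m⟩ := p
  rw [Nat.Primes.prodNatEquiv_apply, LSeries.term_of_ne_zero (pow_ne_zero _ p.2.ne_zero),
    logCoeff_prime_pow u v p.2, div_eq_mul_inv, pow_cpow_neg, ellTerm]

lemma HeckeSeq.hasSum_logCoeff (hu : HeckeSeq u) (hv : HeckeSeq v) {s : ℂ} (hs : 1 < s.re) :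
    HasSum (LSeries.term (fun n ↦ (logCoeff u v n : ℂ)) s) (∑' p, ellTerm u v s p) := by
  have h1 : HasSum (fun p ↦ LSeries.term (fun n ↦ (logCoeff u v n : ℂ)) s
      (Nat.Primes.prodNatEquiv p)) (∑' p, ellTerm u v s p) :=
    (hu.summable_ellTerm hv hs).hasSum.congr_fun (term_logCoeff u v s)
  have h2 := (Equiv.hasSum_iff Nat.Primes.prodNatEquiv (f := fun n : {n : ℕ // IsPrimePow n} ↦
    LSeries.term (fun n ↦ (logCoeff u v n : ℂ)) s n)).1 h1
  refine (hasSum_subtype_iff_of_support_subset (s := {n | IsPrimePow n}) ?_).1 h2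
  intro n hn
  by_contra h
  refine hn ?_
  rcases eq_or_ne n 0 with rfl | h0
  · simp
  · have : ¬ IsPrimePow n := h
    rw [LSeries.term_of_ne_zero h0]
    simp [logCoeff, this]

lemma HeckeSeq.lseriesSummable_logCoeff (hu : HeckeSeq u) (hv : HeckeSeq v) {s : ℂ}
    (hs : 1 < s.re) : LSeriesSummable (fun n ↦ (logCoeff u v n : ℂ)) s :=
  (hu.hasSum_logCoeff hv hs).summable

lemma HeckeSeq.exp_lseries_logCoeff (hu : HeckeSeq u) (hv : HeckeSeq v) {s : ℂ}
    (hs : 1 < s.re) : cexp (LSeries (fun n ↦ (logCoeff u v n : ℂ)) s) =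
      riemannZeta (2 * s) * LSeries (fun n ↦ (u n * v n : ℝ)) s := by
  rw [LSeries, (hu.hasSum_logCoeff hv hs).tsum_eq, hu.exp_tsum_ellTerm hv hs]

lemma logCoeff_add_nonneg (u v : ℕ → ℝ) (n : ℕ) :
    0 ≤ logCoeff u u n + logCoeff v v n + 2 * logCoeff u v n := by
  unfold logCoeff
  split_ifs
  · rw [← mul_div_assoc, ← add_div, ← add_div]
    refine div_nonneg ?_ (by positivity)
    nlinarith [sq_nonneg (tr (u n.minFac) (n.factorization n.minFac) +
      tr (v n.minFac) (n.factorization n.minFac))]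
  · simp

end LogSeries

section Landau

open scoped ComplexOrder

/-- Leibniz induction: if `Z' = ℓ' Z` and the derivatives of `ℓ'` alternate, so do those of `Z`. -/
lemma alternating_of_deriv_eq_mul {Z h : ℂ → ℂ} (hZ : Differentiable ℂ Z) {U : Set ℂ}
    (hU : IsOpen U) (hh : DifferentiableOn ℂ h U) (hd : ∀ s ∈ U, deriv Z s = h s * Z s) {x : ℂ}
    (hx : x ∈ U) (hh0 : ∀ n, 0 ≤ (-1) ^ (n + 1) * iteratedDeriv n h x) (hZ0 : 0 ≤ Z x) (n : ℕ) :
    0 ≤ (-1) ^ n * iteratedDeriv n Z x := by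
  induction n using Nat.strong_induction_on with
  | _ n ih =>
    rcases n with _ | n
    · simpa using hZ0
    have hev : deriv Z =ᶠ[𝓝 x] h * Z := by
      filter_upwards [hU.mem_nhds hx] with s hs using hd s hs
    have hh' : ContDiffAt ℂ n h x :=
      ((hh.contDiffOn hU).contDiffAt (hU.mem_nhds hx))
    rw [iteratedDeriv_succ', (hev.iteratedDeriv_eq n),
      iteratedDeriv_mul hh' hZ.contDiff.contDiffAt, Finset.mul_sum]
    refine Finset.sum_nonneg fun i hi ↦ ?_
    have hi' : i ≤ n := by simpa [Nat.lt_succ_iff] using hi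
    have h1 := mul_nonneg (hh0 i) (ih (n - i) (by omega))
    have h2 : (-1 : ℂ) ^ (n + 1) = (-1) ^ (i + 1) * (-1) ^ (n - i) := by
      rw [← pow_add]
      congr 1
      omega
    rw [h2]
    have h3 : (0 : ℂ) ≤ (n.choose i : ℂ) := by exact_mod_cast Nat.zero_le _
    calc (0 : ℂ) ≤ (n.choose i : ℂ) * ((-1) ^ (i + 1) * iteratedDeriv i h x *
          ((-1) ^ (n - i) * iteratedDeriv (n - i) Z x)) := mul_nonneg h3 h1
      _ = _ := by ring

/-- Landau's lemma for exponentials of Dirichlet series with nonnegative coefficients. -/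
lemma landau_ne_zero {c : ℕ → ℝ} (hc : ∀ n, 0 ≤ c n)
    (hs : ∀ s : ℂ, 1 < s.re → LSeriesSummable (fun n ↦ (c n : ℂ)) s) {Z : ℂ → ℂ}
    (hZ : Differentiable ℂ Z) (he : ∀ s : ℂ, 1 < s.re → Z s = cexp (LSeries (fun n ↦
        (c n : ℂ)) s)) :
    Z (-1) ≠ 0 := by
  set a : ℕ → ℂ := fun n ↦ (c n : ℂ) with ha
  have ha0 : 0 ≤ a := fun n ↦ by simpa [ha] using hc n
  have habs : LSeries.abscissaOfAbsConv a ≤ 1 :=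
    LSeries.abscissaOfAbsConv_le_of_forall_lt_LSeriesSummable' fun y hy ↦
      hs y (by simpa using (by exact_mod_cast hy : (1 : ℝ) < y))
  set U : Set ℂ := {s | 1 < s.re} with hUdef
  have hU : IsOpen U := isOpen_lt continuous_const continuous_re
  have hUabs {s : ℂ} (h : s ∈ U) : LSeries.abscissaOfAbsConv a < s.re :=
    habs.trans_lt (by exact_mod_cast h)
  have hdiff : DifferentiableOn ℂ (LSeries a) U := fun s h ↦
    (LSeries_hasDerivAt (hUabs h)).differentiableAt.differentiableWithinAt
  have h2 : (2 : ℂ) ∈ U := by simp [hUdef]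
  have hreal : LSeries a 2 = ((LSeries a 2).re : ℂ) := by
    have := LSeries.iteratedDeriv_alternating ha0 (x := 2) (by
      simpa using hUabs h2) 0
    simp only [pow_zero, iteratedDeriv_zero, one_mul, ofReal_ofNat] at this
    exact (Complex.conj_eq_iff_re.1 (Complex.conj_eq_iff_im.2 (Complex.le_def.1 this).2.symm)).symm
  have hZ2 : 0 < Z 2 := by
    rw [he 2 h2, hreal, ← Complex.ofReal_exp]
    exact_mod_cast Real.exp_pos _
  have key := Differentiable.apply_le_of_iteratedDeriv_alternating hZ (c := ((2 : ℝ) : ℂ)) ?_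
    (z := -1) ?_
  · intro h
    rw [h] at key
    exact absurd (hZ2.trans_le (by simpa using key)) (lt_irrefl _)
  · intro n _
    simp only [ofReal_ofNat]
    refine alternating_of_deriv_eq_mul hZ hU (hdiff.deriv hU) (fun s h ↦ ?_) h2 (fun n ↦ ?_)
      hZ2.le n
    · have hev : Z =ᶠ[𝓝 s] fun s ↦ cexp (LSeries a s) := by
        filter_upwards [hU.mem_nhds h] with t ht using he t ht
      rw [hev.deriv_eq, hev.self_of_nhds,
        (LSeries_hasDerivAt (hUabs h)).differentiableAt.hasDerivAt.cexp.deriv, mul_comm]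
    · rw [← iteratedDeriv_succ']
      have := LSeries.iteratedDeriv_alternating ha0 (x := 2) (by simpa using hUabs h2) (n + 1)
      simpa using this
  · rw [Complex.le_def]
    norm_num [Complex.neg_re]

end Landau

end QMF

/-! ## Hecke eigenforms -/

namespace QMF
open scoped Real Topology Modular MatrixGroups ENNReal ComplexConjugate
open UpperHalfPlane hiding I
open MeasureTheory

lemma tendsto_coeff_div_of_entire {c : ℕ → ℝ} (hc : ∀ n, 0 ≤ c n)
    (hs : ∀ s : ℂ, 1 < s.re → LSeriesSummable (fun n ↦ (c n : ℂ)) s) {M : ℂ → ℂ}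
    (hM : Differentiable ℂ M) (hD : ∀ s : ℂ, 1 < s.re →
      M s = (s - 1) * riemannZeta (2 * s) * LSeries (fun n ↦ (c n : ℂ)) s) :
    Tendsto (fun n ↦ c n / n) atTop (𝓝 0) := by
  set U : Set ℂ := {s | 1 / 2 < s.re} with hUdef
  have hU : IsOpen U := isOpen_lt continuous_const continuous_re
  have hre (s : ℂ) (h : s ∈ U) : 1 < (2 * s).re := by
    have : 1 / 2 < s.re := h
    rw [mul_re]
    norm_num
    linarith
  have hz (s : ℂ) (h : s ∈ U) : riemannZeta (2 * s) ≠ 0 :=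
    riemannZeta_ne_zero_of_one_le_re (hre s h).le
  set H : ℂ → ℂ := fun s ↦ M s / riemannZeta (2 * s) with hH
  have hHd : DifferentiableOn ℂ H U := by
    intro s h
    refine (DifferentiableAt.div (hM s) ?_ (hz s h)).differentiableWithinAt
    have h1 : 2 * s ≠ 1 := by
      intro h2
      have := hre s h
      rw [h2] at this
      simp at this
    exact DifferentiableAt.comp s (differentiableAt_riemannZeta h1)
      (differentiableAt_id.const_mul 2)
  have h1U : (1 : ℂ) ∈ U := by
    rw [hUdef, Set.mem_ofPred_eq]
    norm_num
  have hds : DifferentiableOn ℂ (dslope H 1) U :=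
    (Complex.differentiableOn_dslope (hU.mem_nhds h1U)).2 hHd
  set G : ℂ → ℂ := fun s ↦ dslope H 1 (((max s.re 1 : ℝ) : ℂ) + I * (s.im : ℂ)) with hG
  have hcont : Continuous G := by
    refine hds.continuousOn.comp_continuous (by fun_prop) fun s ↦ ?_
    rw [hUdef, Set.mem_ofPred_eq]
    simp
    right
    norm_num
  have hlim : Tendsto (fun x : ℝ ↦ H x) (𝓝[>] 1) (𝓝 (H 1)) := by
    have h1 : Tendsto H (𝓝 1) (𝓝 (H 1)) := (hHd.differentiableAt (hU.mem_nhds h1U)).continuousAt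
    have h2 : Tendsto (fun x : ℝ ↦ (x : ℂ)) (𝓝[>] 1) (𝓝 1) := by
      have := (Complex.continuous_ofReal.tendsto 1).mono_left (nhdsWithin_le_nhds (s := Set.Ioi 1))
      simpa using this
    exact h1.comp h2
  have hHs (s : ℂ) (h : 1 < s.re) : H s = (s - 1) * LSeries (fun n ↦ (c n : ℂ)) s := by
    have h2 : s ∈ U := by
      rw [hUdef, Set.mem_ofPred_eq]
      linarith
    rw [hH]
    simp only
    rw [hD s h, mul_right_comm, mul_div_cancel_right₀ _ (hz s h2)]
  have hκ : H 1 = ((H 1).re : ℂ) := by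
    have him : Tendsto (fun x : ℝ ↦ (H x).im) (𝓝[>] 1) (𝓝 (H 1).im) :=
      (Complex.continuous_im.tendsto _).comp hlim
    have h0 : (H 1).im = 0 := by
      refine tendsto_nhds_unique him ((tendsto_const_nhds (x := (0 : ℝ))).congr' ?_)
      filter_upwards [self_mem_nhdsWithin] with x hx
      have hx : 1 < x := hx
      rw [hHs x (by simpa using hx)]
      have h3 : LSeries (fun n ↦ (c n : ℂ)) x =
          ((∑' n : ℕ, if n = 0 then 0 else c n / (n : ℝ) ^ x : ℝ) : ℂ) := by
        rw [LSeries, Complex.ofReal_tsum]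
        refine tsum_congr fun n ↦ ?_
        rw [LSeries.term_def]
        split_ifs
        · simp
        · push_cast
          rw [Complex.ofReal_cpow (by positivity)]
          simp
      rw [h3, ← Complex.ofReal_one, ← Complex.ofReal_sub, ← Complex.ofReal_mul, Complex.ofReal_im]
    exact (Complex.conj_eq_iff_re.1 (Complex.conj_eq_iff_im.2 h0)).symm
  refine tendsto_coeff_div hc (κ := (H 1).re) hs hcont fun s h ↦ ?_
  have hs1 : s ≠ 1 := by
    rintro rfl
    simp at h
  have hcl : ((max s.re 1 : ℝ) : ℂ) + I * (s.im : ℂ) = s := by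
    rw [max_eq_left h.le, mul_comm, Complex.re_add_im]
  simp only [hG, hcl]
  have hs1' : s - 1 ≠ 0 := sub_ne_zero.2 hs1
  rw [dslope_of_ne _ hs1, slope_def_field, ← hκ, hHs s h]
  field_simp
  ring

section Eigen

variable {k l : ℤ}

lemma IsEigen.conj_cf {f : CuspForm 𝒮ℒ k} (hf : IsEigen f) (n : ℕ) :
    conj (cf f n) = cf f n := by
  induction n using Nat.strong_induction_on with
  | _ n ih =>
    rcases eq_or_ne n 0 with rfl | h0
    · simp [cf_zero]
    rcases eq_or_ne n 1 with rfl | hn1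
    · simp [hf.one]
    obtain ⟨p, hp, m, rfl⟩ := Nat.exists_prime_and_dvd hn1
    have := Fact.mk hp
    have hm : m ≠ 0 := by rintro rfl; simp at h0
    have hlt : m < p * m := by
      have := hp.two_le
      nlinarith [Nat.pos_of_ne_zero hm]
    rw [hf.cf_mul, map_sub, map_mul, map_mul, ih m hlt, hf.conj_cf_prime, apply_ite conj,
      ih (m / p) ((Nat.div_le_self m p).trans_lt hlt), map_zero, map_zpow₀, Complex.conj_natCast]

/-- The normalized real coefficients of an eigenform. -/
def ev (f : CuspForm 𝒮ℒ k) (n : ℕ) : ℝ := (lam f n).re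

lemma IsEigen.ofReal_ev {f : CuspForm 𝒮ℒ k} (hf : IsEigen f) (n : ℕ) :
    (ev f n : ℂ) = lam f n := by
  rw [ev, Complex.conj_eq_iff_re.1]
  rw [lam, map_mul, hf.conj_cf, Complex.conj_ofReal]

lemma IsEigen.lam_mul {f : CuspForm 𝒮ℒ k} (hf : IsEigen f) {p : ℕ} (hp : p.Prime) (n : ℕ) :
    lam f (p * n) = lam f p * lam f n - if p ∣ n then lam f (n / p) else 0 := by
  have := Fact.mk hp
  rcases eq_or_ne n 0 with rfl | hn
  · simp [lam_zero]
  have hp0 : (0 : ℝ) < p := by exact_mod_cast hp.pos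
  have hpc : (p : ℂ) ≠ 0 := by exact_mod_cast hp.ne_zero
  set w : ℝ := -((k : ℝ) - 1) / 2 with hw
  have key : (p : ℂ) ^ (k - 1) * ((p : ℝ) ^ w : ℝ) * ((p : ℝ) ^ w : ℝ) = 1 := by
    have h1 : (p : ℂ) ^ (k - 1) = (((p : ℝ) ^ ((k : ℝ) - 1) : ℝ) : ℂ) := by
      rw [show ((k : ℝ) - 1) = ((k - 1 : ℤ) : ℝ) by push_cast; ring, Real.rpow_intCast]
      push_cast
      rfl
    rw [h1, ← Complex.ofReal_mul, ← Complex.ofReal_mul, ← Real.rpow_add hp0, ← Real.rpow_add hp0,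
      hw, show (k : ℝ) - 1 + -((k : ℝ) - 1) / 2 + -((k : ℝ) - 1) / 2 = 0 by ring, Real.rpow_zero,
      Complex.ofReal_one]
  have hmul (a b : ℕ) : (((((a * b : ℕ) : ℝ)) ^ w : ℝ) : ℂ) = ((a : ℝ) ^ w : ℝ) *
      ((b : ℝ) ^ w : ℝ) := by
    rw [Nat.cast_mul, Real.mul_rpow (by positivity) (by positivity), Complex.ofReal_mul]
  simp only [lam, ← hw]
  rw [hf.cf_mul, hmul]
  by_cases h : p ∣ n
  · obtain ⟨m, rfl⟩ := h
    rw [if_pos (dvd_mul_right _ _), if_pos (dvd_mul_right _ _), Nat.mul_div_cancel_left _ hp.pos,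
      hmul]
    linear_combination (-(cf f m * ((m : ℝ) ^ w : ℝ))) * key
  · rw [if_neg h, if_neg h]
    ring

lemma IsEigen.ev_mul_ev {f : CuspForm 𝒮ℒ k} {g : CuspForm 𝒮ℒ l} (hf : IsEigen f) (hg : IsEigen g) :
    (fun n ↦ lam f n * conj (lam g n)) = fun n ↦ ((ev f n * ev g n : ℝ) : ℂ) := by
  funext n
  rw [Complex.ofReal_mul, hf.ofReal_ev, hg.ofReal_ev, ← hg.ofReal_ev, Complex.conj_ofReal]

lemma IsEigen.heckeSeq {f : CuspForm 𝒮ℒ k} (hf : IsEigen f) (hk : 0 < k) : HeckeSeq (ev f) where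
  zero := by simp [ev, lam_zero]
  one := by simp [ev, lam, hf.one]
  prime_mul p hp n := by
    apply Complex.ofReal_injective
    have := hf.lam_mul hp n
    push_cast [apply_ite Complex.ofReal]
    simp only [hf.ofReal_ev, this]
  little := by
    obtain ⟨M, hM, -, -, hD⟩ := rankinSelberg_weak f hk hf.ne_zero
    rw [hf.ev_mul_ev hf] at hD
    simp only [← sq] at hD
    refine tendsto_coeff_div_of_entire (fun n ↦ sq_nonneg _) (fun s hs ↦ ?_) hM hD
    have := LSeriesSummable_lam f f hk hk hs
    rw [hf.ev_mul_ev hf] at this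
    simpa only [← sq] using this
  summ σ hσ := by
    refine (summable_lam_sq f hk hσ).congr fun n ↦ ?_
    rw [← hf.ofReal_ev, Complex.norm_real, Real.norm_eq_abs, sq_abs]

/-- Hecke sequences with the analytic properties of their Rankin–Selberg convolutions. -/
structure HeckeFamily {ι : Type*} (u : ι → ℕ → ℝ) : Prop where
  seq : ∀ i, HeckeSeq (u i)
  diag : ∀ i, ∃ M : ℂ → ℂ, Differentiable ℂ M ∧ M (-1) = 0 ∧ M 1 ≠ 0 ∧ ∀ s : ℂ, 1 < s.re →
    M s = (s - 1) * (riemannZeta (2 * s) * LSeries (fun n ↦ (u i n * u i n : ℝ)) s)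
  off : ∀ i j, i ≠ j → ∃ L : ℂ → ℂ, Differentiable ℂ L ∧ ∀ s : ℂ, 1 < s.re →
    L s = riemannZeta (2 * s) * LSeries (fun n ↦ (u i n * u j n : ℝ)) s

lemma IsEigen.off_diag {f : CuspForm 𝒮ℒ k} {g : CuspForm 𝒮ℒ l} (hf : IsEigen f) (hg : IsEigen g)
    (hk : 0 < k) (hkl : k ≤ l) (hfg : ∀ e : l = k, f ≠ castWt e g) :
    ∃ L : ℂ → ℂ, Differentiable ℂ L ∧ ∀ s : ℂ, 1 < s.re →
      L s = riemannZeta (2 * s) * LSeries (fun n ↦ (ev f n * ev g n : ℝ)) s := by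
  rw [← hf.ev_mul_ev hg]
  refine rankinSelberg_strong f g hk hkl ?_
  rintro rfl
  exact hf.petInner_eq_zero hg (hfg rfl)

/-- Eigenforms of positive weight, the weight being part of the data. -/
abbrev EigenForm : Type := {f : Σ k : ℤ, CuspForm 𝒮ℒ k // 0 < f.1 ∧ IsEigen f.2}

theorem heckeFamily_eigenForm : HeckeFamily fun f : EigenForm ↦ ev f.1.2 where
  seq f := f.2.2.heckeSeq f.2.1
  diag f := by
    obtain ⟨M, hM, h1, h2, hD⟩ := rankinSelberg_weak f.1.2 f.2.1 f.2.2.ne_zero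
    rw [f.2.2.ev_mul_ev f.2.2] at hD
    exact ⟨M, hM, h1, h2, fun s hs ↦ by rw [hD s hs, mul_assoc]⟩
  off := by
    rintro ⟨⟨k, f⟩, hk, hf⟩ ⟨⟨l, g⟩, hl, hg⟩ hne
    rcases le_total k l with hkl | hkl
    · refine hf.off_diag hg hk hkl ?_
      intro e
      change l = k at e
      subst e
      intro h
      have h' : f = g := h
      exact hne (by subst h'; rfl)
    · obtain ⟨L, hL, h⟩ := hg.off_diag hf hl hkl (by
        intro e
        change k = l at e
        subst e
        intro h
        have h' : g = f := h
        exact hne (by subst h'; rfl))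
      refine ⟨L, hL, fun s hs ↦ ?_⟩
      rw [h s hs]
      simp only [mul_comm]

end Eigen

end QMF

/-! ## Asymptotics of logarithms of Euler products -/

namespace QMF
open scoped Real Topology Modular MatrixGroups ENNReal ComplexConjugate
open UpperHalfPlane hiding I
open MeasureTheory

section Asymptotics

/-- The terms `ellTerm` at a real point, as real numbers. -/
def logTerm (u v : ℕ → ℝ) (σ : ℝ) (p : Nat.Primes × ℕ) : ℝ :=
  tr (u p.1) (p.2 + 1) * tr (v p.1) (p.2 + 1) / (p.2 + 1 : ℝ) *
    (((p.1 : ℕ) : ℝ) ^ (-σ)) ^ (p.2 + 1)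

lemma ellTerm_ofReal (u v : ℕ → ℝ) (σ : ℝ) (p : Nat.Primes × ℕ) :
    ellTerm u v σ p = (logTerm u v σ p : ℂ) := by
  rw [ellTerm, logTerm]
  push_cast
  rw [Complex.ofReal_cpow (by positivity)]
  push_cast
  rfl

variable {u v : ℕ → ℝ}

lemma HeckeSeq.summable_logTerm (hu : HeckeSeq u) (hv : HeckeSeq v) {σ : ℝ} (hσ : 1 < σ) :
    Summable (logTerm u v σ) := by
  rw [← Complex.summable_ofReal, ← funext (ellTerm_ofReal u v σ)]
  exact hu.summable_ellTerm hv (by simpa using hσ)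

lemma HeckeSeq.exp_tsum_logTerm (hu : HeckeSeq u) (hv : HeckeSeq v) {σ : ℝ} (hσ : 1 < σ) :
    Real.exp (∑' p, logTerm u v σ p) =
      ‖riemannZeta (2 * σ) * LSeries (fun n ↦ (u n * v n : ℝ)) σ‖ := by
  rw [← hu.exp_tsum_ellTerm hv (by simpa using hσ), Complex.norm_exp,
    tsum_congr (ellTerm_ofReal u v σ), ← Complex.ofReal_tsum, Complex.ofReal_re]

variable {ι : Type*} {w : ι → ℕ → ℝ}

lemma HeckeFamily.off_ne_zero (hw : HeckeFamily w) {i j : ι} {L : ℂ → ℂ}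
    (hL : Differentiable ℂ L) (hD : ∀ s : ℂ, 1 < s.re →
      L s = riemannZeta (2 * s) * LSeries (fun n ↦ (w i n * w j n : ℝ)) s) : L 1 ≠ 0 := by
  intro h0
  obtain ⟨M₁, hM₁, hz₁, -, hD₁⟩ := hw.diag i
  obtain ⟨M₂, hM₂, -, -, hD₂⟩ := hw.diag j
  have hN : Differentiable ℂ (dslope L 1) := by
    rw [← differentiableOn_univ] at hL ⊢
    exact (Complex.differentiableOn_dslope Filter.univ_mem).2 hL
  have hsum (s : ℂ) (hs : 1 < s.re) := (((hw.seq i).lseriesSummable_logCoeff (hw.seq i) hs).add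
    ((hw.seq j).lseriesSummable_logCoeff (hw.seq j) hs)).add
    (((hw.seq i).lseriesSummable_logCoeff (hw.seq j) hs).smul 2)
  have hfun : (fun n ↦ ((logCoeff (w i) (w i) n + logCoeff (w j) (w j) n +
      2 * logCoeff (w i) (w j) n : ℝ) : ℂ)) = (fun n ↦ (logCoeff (w i) (w i) n : ℂ)) +
      (fun n ↦ (logCoeff (w j) (w j) n : ℂ)) + (2 : ℂ) • fun n ↦ (logCoeff (w i) (w j) n : ℂ) := by
    funext n
    simp
  refine landau_ne_zero (logCoeff_add_nonneg (w i) (w j)) (fun s hs ↦ ?_)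
    (Z := fun s ↦ M₁ s * M₂ s * dslope L 1 s ^ 2) ((hM₁.mul hM₂).mul (hN.pow 2)) (fun s hs ↦ ?_)
    (by simp [hz₁])
  · rw [hfun]
    exact hsum s hs
  · have h1 := (hw.seq i).lseriesSummable_logCoeff (hw.seq i) hs
    have h2 := (hw.seq j).lseriesSummable_logCoeff (hw.seq j) hs
    have h3 := (hw.seq i).lseriesSummable_logCoeff (hw.seq j) hs
    have hs1 : s ≠ 1 := by
      rintro rfl
      simp at hs
    have hs1' : s - 1 ≠ 0 := sub_ne_zero.2 hs1
    rw [hfun, LSeries_add (h1.add h2) (h3.smul 2), LSeries_add h1 h2, LSeries_smul,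
      Complex.exp_add, Complex.exp_add, two_mul, Complex.exp_add,
      (hw.seq i).exp_lseries_logCoeff (hw.seq i) hs, (hw.seq j).exp_lseries_logCoeff (hw.seq j) hs,
      (hw.seq i).exp_lseries_logCoeff (hw.seq j) hs, ← hD s hs, hD₁ s hs, hD₂ s hs,
      dslope_of_ne _ hs1, slope_def_field, h0]
    field_simp
    ring

lemma exists_bound_log_norm {L : ℂ → ℂ} (hL : Continuous L)
    (h0 : ∀ σ : ℝ, 1 ≤ σ → L σ ≠ 0) : ∃ C, ∀ σ : ℝ, σ ∈ Set.Icc 1 2 → |Real.log ‖L σ‖| ≤ C := by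
  have : ContinuousOn (fun σ : ℝ ↦ Real.log ‖L σ‖) (Set.Icc 1 2) := by
    refine ContinuousOn.log (hL.comp Complex.continuous_ofReal).norm.continuousOn fun σ hσ ↦ ?_
    exact norm_ne_zero_iff.2 (h0 σ hσ.1)
  obtain ⟨C, hC⟩ := isCompact_Icc.exists_bound_of_continuousOn this
  exact ⟨C, hC⟩

lemma HeckeFamily.bounded_off (hw : HeckeFamily w) {i j : ι} (hij : i ≠ j) :
    ∃ C, ∀ σ : ℝ, 1 < σ → σ ≤ 2 → |∑' p, logTerm (w i) (w j) σ p| ≤ C := by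
  obtain ⟨L, hL, hD⟩ := hw.off i j hij
  have key (σ : ℝ) (hσ : 1 < σ) : ‖L σ‖ = Real.exp (∑' p, logTerm (w i) (w j) σ p) := by
    rw [(hw.seq i).exp_tsum_logTerm (hw.seq j) hσ, hD σ (by simpa using hσ)]
  obtain ⟨C, hC⟩ := exists_bound_log_norm hL.continuous fun σ hσ ↦ by
    rcases hσ.eq_or_lt with rfl | hσ
    · simpa using hw.off_ne_zero hL hD
    · rw [← norm_ne_zero_iff, key σ hσ]
      exact (Real.exp_pos _).ne'
  refine ⟨C, fun σ h1 h2 ↦ ?_⟩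
  have := hC σ ⟨h1.le, h2⟩
  rwa [key σ h1, Real.log_exp] at this

lemma HeckeFamily.bounded_diag (hw : HeckeFamily w) (i : ι) :
    ∃ C, ∀ σ : ℝ, 1 < σ → σ ≤ 2 →
      |∑' p, logTerm (w i) (w i) σ p - Real.log (σ - 1)⁻¹| ≤ C := by
  obtain ⟨M, hM, -, hM1, hD⟩ := hw.diag i
  have key (σ : ℝ) (hσ : 1 < σ) :
      ‖M σ‖ = (σ - 1) * Real.exp (∑' p, logTerm (w i) (w i) σ p) := by
    rw [(hw.seq i).exp_tsum_logTerm (hw.seq i) hσ, hD σ (by simpa using hσ), norm_mul]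
    rw [← Complex.ofReal_one, ← Complex.ofReal_sub, Complex.norm_real,
      Real.norm_of_nonneg (by linarith)]
  obtain ⟨C, hC⟩ := exists_bound_log_norm hM.continuous fun σ hσ ↦ by
    rcases hσ.eq_or_lt with rfl | hσ
    · simpa using hM1
    · rw [← norm_ne_zero_iff, key σ hσ]
      exact (mul_pos (by linarith) (Real.exp_pos _)).ne'
  refine ⟨C, fun σ h1 h2 ↦ ?_⟩
  have := hC σ ⟨h1.le, h2⟩
  rw [key σ h1, Real.log_mul (by linarith) (Real.exp_pos _).ne', Real.log_exp] at this
  rwa [Real.log_inv, sub_neg_eq_add, add_comm]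

end Asymptotics

end QMF

/-! ## Linear independence at primes -/

namespace QMF
open scoped Real Topology Modular MatrixGroups ENNReal ComplexConjugate
open UpperHalfPlane hiding I
open MeasureTheory

section Tail

variable {u : ℕ → ℝ}

lemma logTerm_self_nonneg (u : ℕ → ℝ) (σ : ℝ) (p : Nat.Primes × ℕ) : 0 ≤ logTerm u u σ p := by
  rw [logTerm, ← sq]
  positivity

lemma prime_rpow_neg_le (p : Nat.Primes) {σ : ℝ} (hσ : 1 < σ) :
    ((p : ℕ) : ℝ) ^ (-σ) ≤ ((p : ℕ) : ℝ)⁻¹ := by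
  rw [← Real.rpow_neg_one]
  exact Real.rpow_le_rpow_of_exponent_le (by exact_mod_cast p.2.one_lt.le) (by linarith)

lemma HeckeSeq.tail_le (hu : HeckeSeq u) {σ : ℝ} (hσ : 1 < σ) (p : Nat.Primes) :
    satakeBd (u p) * ((p : ℕ) : ℝ) ^ (-σ) ≤ satakeBd (u p) / (p : ℕ) ∧
    satakeBd (u p) / (p : ℕ) < 1 ∧
    ∑' m, logTerm u u σ (p, m + 1) ≤ 2 * (satakeBd (u p) * ((p : ℕ) : ℝ) ^ (-σ)) ^ 2 /
      (1 - satakeBd (u p) * ((p : ℕ) : ℝ) ^ (-σ)) := by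
  have hp0 : (0 : ℝ) < (p : ℕ) := by exact_mod_cast p.2.pos
  have hq := satakeBd_nonneg (u p)
  have h1 : satakeBd (u p) * ((p : ℕ) : ℝ) ^ (-σ) ≤ satakeBd (u p) / (p : ℕ) := by
    rw [div_eq_mul_inv]
    exact mul_le_mul_of_nonneg_left (prime_rpow_neg_le p hσ) hq
  have h2 : satakeBd (u p) / (p : ℕ) < 1 := (div_lt_one hp0).2 (hu.satakeBd_lt p.2)
  refine ⟨h1, h2, ?_⟩
  set x : ℝ := ((p : ℕ) : ℝ) ^ (-σ) with hx
  have hx0 : 0 ≤ x := by positivity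
  have hr0 : 0 ≤ satakeBd (u p) * x := mul_nonneg hq hx0
  have hgeo := ((hasSum_geometric_of_lt_one hr0 (h1.trans_lt h2)).mul_left
    (2 * (satakeBd (u p) * x) ^ 2))
  rw [div_eq_mul_inv, ← hgeo.tsum_eq]
  have hsum : Summable fun m ↦ logTerm u u σ (p, m + 1) := by
    refine (hu.summable_logTerm hu hσ).comp_injective (i := fun m : ℕ ↦ (p, m + 1)) ?_
    intro a b hab
    simpa using hab
  refine hsum.tsum_le_tsum (fun m ↦ ?_) hgeo.summable
  have h3 := tr_sq_le (u p) (m + 2)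
  have h4 : tr (u p) (m + 2) ^ 2 / ((m + 1 : ℕ) + 1 : ℝ) ≤ 4 * satakeBd (u p) ^ (m + 2) / 2 := by
    refine div_le_div₀ (by positivity) h3 (by norm_num) ?_
    push_cast
    linarith [Nat.cast_nonneg (α := ℝ) m]
  calc logTerm u u σ (p, m + 1) = tr (u p) (m + 2) ^ 2 / ((m + 1 : ℕ) + 1 : ℝ) * x ^ (m + 2) := by
        rw [logTerm, ← sq]
    _ ≤ 4 * satakeBd (u p) ^ (m + 2) / 2 * x ^ (m + 2) := by gcongr
    _ = _ := by ring

lemma summable_primes_sq : Summable fun p : Nat.Primes ↦ (((p : ℕ) : ℝ) ^ 2)⁻¹ :=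
  (Real.summable_nat_pow_inv.2 one_lt_two).comp_injective Nat.Primes.coe_nat_injective

lemma HeckeSeq.tail_bound (hu : HeckeSeq u) {δ : ℝ} (hδ : 0 < δ) :
    ∃ K : Nat.Primes → ℝ, Summable K ∧ ∀ σ : ℝ, 1 < σ → ∀ p,
      ∑' m, logTerm u u σ (p, m + 1) ≤ δ * logTerm u u σ (p, 0) + K p := by
  set d : ℝ := min (δ / 8) (1 / 4) with hd
  have hd0 : 0 < d := lt_min (by positivity) (by norm_num)
  obtain ⟨N, hN⟩ := eventually_atTop.1 (hu.little.eventually_le_const hd0)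
  set N₀ := max N 8 with hN₀
  refine ⟨fun p ↦ 32 * (((p : ℕ) : ℝ) ^ 2)⁻¹ +
    if (p : ℕ) < N₀ then 2 / (1 - satakeBd (u p) / (p : ℕ)) else 0, ?_, ?_⟩
  · refine (summable_primes_sq.mul_left 32).add (summable_of_hasFiniteSupport ?_)
    refine Set.Finite.subset (Set.Finite.preimage Nat.Primes.coe_nat_injective.injOn
      (Set.finite_lt_nat N₀)) fun p hp ↦ ?_
    by_contra h
    exact hp (if_neg h)
  · intro σ hσ p
    obtain ⟨h1, h2, h3⟩ := hu.tail_le hσ p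
    refine h3.trans ?_
    have hp0 : (0 : ℝ) < (p : ℕ) := by exact_mod_cast p.2.pos
    have hQ := satakeBd_nonneg (u p)
    have hQle := satakeBd_le (u p)
    have hxle := prime_rpow_neg_le p hσ
    have h0 : logTerm u u σ (p, 0) = u p ^ 2 * ((p : ℕ) : ℝ) ^ (-σ) := by
      rw [logTerm]
      simp [tr_one, sq]
    have h0' := logTerm_self_nonneg u σ (p, 0)
    rw [h0] at h0' ⊢
    set x : ℝ := ((p : ℕ) : ℝ) ^ (-σ) with hx
    have hx0 : 0 ≤ x := by positivity
    set r : ℝ := satakeBd (u p) * x with hr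
    have hr0 : 0 ≤ r := mul_nonneg hQ hx0
    beta_reduce
    split_ifs with hpN
    · have h4 : 2 * r ^ 2 / (1 - r) ≤ 2 / (1 - satakeBd (u p) / (p : ℕ)) := by
        refine div_le_div₀ (by norm_num) ?_ (by linarith) (by linarith)
        nlinarith
      have h5 : 0 ≤ 32 * (((p : ℕ) : ℝ) ^ 2)⁻¹ := by positivity
      nlinarith
    · push Not at hpN
      have hp8 : (8 : ℝ) ≤ (p : ℕ) := by exact_mod_cast (le_max_right N 8).trans hpN
      have hud := hN p ((le_max_left N 8).trans hpN)
      have hud1 : u p ^ 2 / (p : ℕ) ≤ 1 / 4 := hud.trans (min_le_right _ _)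
      have hud2 : u p ^ 2 / (p : ℕ) ≤ δ / 8 := hud.trans (min_le_left _ _)
      have hr2 : r ≤ 1 / 2 := by
        refine h1.trans ?_
        rw [div_le_iff₀ hp0] at hud1 ⊢
        linarith
      have h4 : 2 * r ^ 2 / (1 - r) ≤ 4 * r ^ 2 := by
        rw [div_le_iff₀ (by linarith)]
        nlinarith [sq_nonneg r]
      have h5 : satakeBd (u p) ^ 2 ≤ 2 * (u p ^ 2) ^ 2 + 8 := by
        nlinarith [sq_nonneg (u p ^ 2 - 2), sq_nonneg (u p)]
      have h6 : r ^ 2 ≤ 2 * (u p ^ 2 * x) ^ 2 + 8 * x ^ 2 := by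
        rw [hr, mul_pow, mul_pow]
        nlinarith [sq_nonneg x]
      have h7 : u p ^ 2 * x ≤ δ / 8 := by
        refine le_trans ?_ hud2
        rw [div_eq_mul_inv]
        exact mul_le_mul_of_nonneg_left hxle (sq_nonneg _)
      have h8 : x ^ 2 ≤ (((p : ℕ) : ℝ) ^ 2)⁻¹ := by
        rw [← inv_pow]
        exact pow_le_pow_left₀ hx0 hxle 2
      nlinarith

end Tail

section Core

variable {ι : Type*} [Fintype ι] {w : ι → ℕ → ℝ}

lemma norm_sum_mul_sq_le (A : ι → ℂ) (t : ι → ℝ) :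
    ‖∑ i, A i * t i‖ ^ 2 ≤ (∑ i, ‖A i‖ ^ 2) * ∑ i, t i ^ 2 := by
  have h1 : ‖∑ i, A i * t i‖ ≤ ∑ i, ‖A i‖ * |t i| := by
    refine (norm_sum_le _ _).trans (Finset.sum_le_sum fun i _ ↦ ?_)
    rw [norm_mul, Complex.norm_real, Real.norm_eq_abs]
  calc _ ≤ (∑ i, ‖A i‖ * |t i|) ^ 2 := by gcongr
    _ ≤ (∑ i, ‖A i‖ ^ 2) * ∑ i, |t i| ^ 2 := Finset.sum_mul_sq_le_sq_mul_sq _ _ _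
    _ = _ := by simp only [sq_abs]

lemma norm_sum_mul_sq (A : ι → ℂ) (t : ι → ℝ) :
    ‖∑ i, A i * t i‖ ^ 2 = ∑ i, ∑ j, (A i * conj (A j)).re * (t i * t j) := by
  have h1 : ((‖∑ i, A i * t i‖ ^ 2 : ℝ) : ℂ) = ∑ i, ∑ j, A i * conj (A j) * ((t i *
      t j : ℝ) : ℂ) := by
    rw [Complex.ofReal_pow, ← Complex.mul_conj', map_sum, Finset.sum_mul_sum]
    refine Finset.sum_congr rfl fun i _ ↦ Finset.sum_congr rfl fun j _ ↦ ?_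
    rw [map_mul, Complex.conj_ofReal]
    push_cast
    ring
  have h2 := congrArg Complex.re h1
  rw [Complex.ofReal_re] at h2
  rw [h2, Complex.re_sum]
  refine Finset.sum_congr rfl fun i _ ↦ ?_
  rw [Complex.re_sum]
  refine Finset.sum_congr rfl fun j _ ↦ ?_
  rw [Complex.re_mul_ofReal]

theorem HeckeFamily.eq_zero_of_le (hw : HeckeFamily w) (A : ι → ℂ) {C : ℝ} (hC0 : 0 ≤ C)
    (hC : ∀ p : ℕ, p.Prime → ‖∑ i, A i * w i p‖ ^ 2 ≤ C / p * (1 + ∑ i, w i p ^ 2)) :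
    ∀ i, A i = 0 := by
  classical
  set S : ℝ := ∑ i, ‖A i‖ ^ 2 with hS
  have hS0 : 0 ≤ S := Finset.sum_nonneg fun i _ ↦ by positivity
  set δ : ℝ := 1 / (2 * ((Fintype.card ι : ℝ) + 1)) with hδ
  have hδ0 : 0 < δ := by positivity
  have hδn : δ * Fintype.card ι ≤ 1 / 2 := by
    rw [hδ, div_mul_eq_mul_div, div_le_div_iff₀ (by positivity) (by norm_num)]
    linarith
  have hbd (i j : ι) : ∃ B, ∀ σ : ℝ, 1 < σ → σ ≤ 2 →
      |∑' p, logTerm (w i) (w j) σ p - if i = j then Real.log (σ - 1)⁻¹ else 0| ≤ B := by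
    by_cases hij : i = j
    · subst hij
      simpa using hw.bounded_diag i
    · simpa [hij] using hw.bounded_off hij
  choose B hB using hbd
  choose K hK hKle using fun i ↦ (hw.seq i).tail_bound hδ0
  set K₀ : Nat.Primes → ℝ := fun p ↦ C * ((((p : ℕ) : ℝ) ^ 2)⁻¹ +
    ∑ i, w i p ^ 2 * ((p : ℕ) : ℝ) ^ (-2 : ℝ)) with hK₀
  have hK₀s : Summable K₀ := by
    refine (summable_primes_sq.add (summable_sum fun i _ ↦ ?_)).mul_left C
    exact ((hw.seq i).summ 2 one_lt_two).comp_injective Nat.Primes.coe_nat_injective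
  set C₁ : ℝ := ∑ i, ∑ j, |(A i * conj (A j)).re| * B i j with hC₁
  set C₂ : ℝ := ∑' p, K₀ p + S * ∑ i, (δ * B i i + ∑' p, K i p) with hC₂
  have main (σ : ℝ) (h1 : 1 < σ) (h2 : σ ≤ 2) :
      S * Real.log (σ - 1)⁻¹ - C₁ ≤ C₂ + S * (δ * Fintype.card ι) * Real.log (σ - 1)⁻¹ := by
    set ℓ : ℝ := Real.log (σ - 1)⁻¹ with hℓ
    set W : Nat.Primes × ℕ → ℝ := fun p ↦ ‖∑ i, A i * tr (w i p.1) (p.2 + 1)‖ ^ 2 / (p.2 + 1 : ℝ) *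
      (((p.1 : ℕ) : ℝ) ^ (-σ)) ^ (p.2 + 1) with hW
    have hls (i j : ι) := (hw.seq i).summable_logTerm (hw.seq j) h1
    have hWsum : HasSum W (∑ i, ∑ j, (A i * conj (A j)).re * ∑' p, logTerm (w i) (w j) σ p) := by
      refine HasSum.of_eq (hasSum_sum fun i _ ↦ hasSum_sum fun j _ ↦
        (hls i j).hasSum.mul_left _) (fun p ↦ ?_) rfl
      rw [hW]
      simp only [norm_sum_mul_sq, logTerm, Finset.sum_div, Finset.sum_mul]
      refine Finset.sum_congr rfl fun i _ ↦ Finset.sum_congr rfl fun j _ ↦ by ring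
    have hlow : S * ℓ - C₁ ≤ ∑ i, ∑ j, (A i * conj (A j)).re * ∑' p, logTerm (w i) (w j) σ p := by
      have e1 : S * ℓ = ∑ i, ∑ j, (A i * conj (A j)).re * if i = j then ℓ else 0 := by
        rw [hS, Finset.sum_mul]
        refine Finset.sum_congr rfl fun i _ ↦ ?_
        have e0 : (A i * conj (A i)).re = ‖A i‖ ^ 2 := by
          rw [Complex.mul_conj, Complex.normSq_eq_norm_sq, Complex.ofReal_re]
        rw [Finset.sum_eq_single i (fun j _ hj ↦ by rw [if_neg hj.symm, mul_zero]) (by simp),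
          if_pos rfl, e0]
      rw [e1, hC₁, ← Finset.sum_sub_distrib]
      refine Finset.sum_le_sum fun i _ ↦ ?_
      rw [← Finset.sum_sub_distrib]
      refine Finset.sum_le_sum fun j _ ↦ ?_
      have e2 := hB i j σ h1 h2
      have e3 := mul_le_mul_of_nonneg_left e2 (abs_nonneg (A i * conj (A j)).re)
      rw [← abs_mul] at e3
      have e4 := (abs_le.1 e3).1
      rw [mul_sub] at e4
      linarith
    have hW0 (p : Nat.Primes) : Summable fun m ↦ W (p, m) :=
      hWsum.summable.prod_factor p
    have hfib := hWsum.prod_fiberwise fun p ↦ (hW0 p).hasSum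
    have hdiag (i : ι) := (hls i i).hasSum.prod_fiberwise fun p ↦ ((hls i i).prod_factor p).hasSum
    have hup : HasSum (fun p ↦ K₀ p + S * ∑ i, (δ * (∑' m, logTerm (w i) (w i) σ (p, m)) + K i p))
        (∑' p, K₀ p + S * ∑ i, (δ * (∑' p, logTerm (w i) (w i) σ p) + ∑' p, K i p)) :=
      hK₀s.hasSum.add ((hasSum_sum fun i _ ↦ ((hdiag i).mul_left δ).add (hK i).hasSum).mul_left S)
    have hle : ∑ i, ∑ j, (A i * conj (A j)).re * ∑' p, logTerm (w i) (w j) σ p ≤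
        ∑' p, K₀ p + S * ∑ i, (δ * (∑' p, logTerm (w i) (w i) σ p) + ∑' p, K i p) := by
      refine hasSum_le (fun p ↦ ?_) hfib hup
      have hp0 : (0 : ℝ) < (p : ℕ) := by exact_mod_cast p.2.pos
      rw [(hW0 p).tsum_eq_zero_add]
      refine add_le_add ?_ ?_
      · have e1 : W (p, 0) = ‖∑ i, A i * w i p‖ ^ 2 * ((p : ℕ) : ℝ) ^ (-σ) := by
          rw [hW]
          simp [tr_one]
        rw [e1]
        calc _ ≤ C / (p : ℕ) * (1 + ∑ i, w i p ^ 2) * ((p : ℕ) : ℝ)⁻¹ :=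
              mul_le_mul (hC p p.2) (prime_rpow_neg_le p h1) (by positivity) (by positivity)
          _ = K₀ p := by
            rw [hK₀]
            simp only
            rw [← Finset.sum_mul, Real.rpow_neg hp0.le, Real.rpow_ofNat]
            field_simp
      · have hs' (i : ι) : Summable fun m ↦ logTerm (w i) (w i) σ (p, m + 1) :=
          (summable_nat_add_iff 1).2 ((hls i i).prod_factor p)
        have e1 : HasSum (fun m ↦ S * ∑ i, logTerm (w i) (w i) σ (p, m + 1))
            (S * ∑ i, ∑' m, logTerm (w i) (w i) σ (p, m + 1)) :=
          (hasSum_sum fun i _ ↦ (hs' i).hasSum).mul_left S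
        refine (hasSum_le (fun m ↦ ?_) ((summable_nat_add_iff 1).2 (hW0 p)).hasSum e1).trans ?_
        · rw [hW]
          simp only [logTerm, ← sq, ← Finset.sum_mul, ← Finset.sum_div]
          rw [← mul_assoc, ← mul_div_assoc]
          gcongr
          exact norm_sum_mul_sq_le _ _
        · refine mul_le_mul_of_nonneg_left (Finset.sum_le_sum fun i _ ↦ ?_) hS0
          refine (hKle i σ h1 p).trans ?_
          gcongr
          exact ((hls i i).prod_factor p).le_tsum 0 fun m _ ↦ logTerm_self_nonneg _ _ _
    refine (hlow.trans hle).trans ?_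
    have e5 : ∑ i, (δ * (∑' p, logTerm (w i) (w i) σ p) + ∑' p, K i p) ≤
        ∑ i, (δ * B i i + ∑' p, K i p) + δ * Fintype.card ι * ℓ := by
      have : δ * Fintype.card ι * ℓ = ∑ _i : ι, δ * ℓ := by
        rw [Finset.sum_const, Finset.card_univ, nsmul_eq_mul]
        ring
      rw [this, ← Finset.sum_add_distrib]
      refine Finset.sum_le_sum fun i _ ↦ ?_
      have e6 := (abs_le.1 (hB i i σ h1 h2)).2
      rw [if_pos rfl] at e6
      nlinarith
    rw [hC₂]
    nlinarith
  have hfin (t : ℝ) (ht : 0 ≤ t) : S * t / 2 ≤ C₁ + C₂ := by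
    have h1 := main (1 + Real.exp (-t)) (by linarith [Real.exp_pos (-t)])
      (by linarith [Real.exp_le_one_iff.2 (neg_nonpos.2 ht)])
    rw [add_sub_cancel_left, ← Real.exp_neg, neg_neg, Real.log_exp] at h1
    have h2 : S * (δ * Fintype.card ι) * t ≤ S * (1 / 2) * t := by gcongr
    linarith
  have hSz : S = 0 := by
    by_contra hne
    have hpos : 0 < S := lt_of_le_of_ne hS0 (Ne.symm hne)
    have h1 := hfin (2 * (|C₁ + C₂| + 1) / S) (by positivity)
    have h2 : S * (2 * (|C₁ + C₂| + 1) / S) / 2 = |C₁ + C₂| + 1 := by field_simp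
    rw [h2] at h1
    linarith [le_abs_self (C₁ + C₂)]
  intro i
  have h3 := (Finset.sum_eq_zero_iff_of_nonneg fun i _ ↦ by positivity).1 hSz i (Finset.mem_univ i)
  simpa using h3

end Core

end QMF

/-! ## Quasimodular forms vanishing at primes -/

namespace QMF
open scoped Real Topology Modular MatrixGroups ENNReal ComplexConjugate
open UpperHalfPlane hiding I
open MeasureTheory

open Polynomial in
lemma exists_norm_eval_sub_le (Q : ℂ[X]) {D : ℕ} (hD : ∀ n, D < n → Q.coeff n = 0) :
    ∃ C : ℝ, 0 ≤ C ∧ ∀ x : ℝ, 1 ≤ x →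
      x * ‖Q.eval (x : ℂ) - Q.coeff D * (x : ℂ) ^ D‖ ≤ C * x ^ D := by
  refine ⟨∑ n ∈ range D, ‖Q.coeff n‖, Finset.sum_nonneg fun _ _ ↦ norm_nonneg _, fun x hx ↦ ?_⟩
  have hx0 : (0 : ℝ) ≤ x := by linarith
  have hlt : Q.natDegree < D + 1 := by
    by_contra! h
    refine absurd (hD _ h) ?_
    rw [coeff_natDegree, leadingCoeff_eq_zero]
    rintro rfl
    simp at h
  rw [eval_eq_sum_range' hlt, Finset.sum_range_succ, add_sub_cancel_right, Finset.sum_mul]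
  refine (mul_le_mul_of_nonneg_left (norm_sum_le _ _) hx0).trans ?_
  rw [Finset.mul_sum]
  refine Finset.sum_le_sum fun n hn ↦ ?_
  have h1 : x * x ^ n ≤ x ^ D := by
    rw [← pow_succ']
    exact pow_le_pow_right₀ hx (Finset.mem_range.1 hn)
  rw [norm_mul, norm_pow, Complex.norm_real, Real.norm_of_nonneg hx0]
  nlinarith [norm_nonneg (Q.coeff n)]

lemma HeckeFamily.comp {ι κ : Type*} {u : ι → ℕ → ℝ} (hu : HeckeFamily u) {g : κ → ι}
    (hg : Function.Injective g) : HeckeFamily fun i ↦ u (g i) where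
  seq i := hu.seq (g i)
  diag i := hu.diag (g i)
  off i j hij := hu.off (g i) (g j) (hg.ne hij)

lemma HeckeSeq.tendsto_abs_div_sqrt {u : ℕ → ℝ} (hu : HeckeSeq u) :
    Tendsto (fun n : ℕ ↦ |u n| / √n) atTop (𝓝 0) := by
  have h := hu.little.sqrt
  rw [Real.sqrt_zero] at h
  refine h.congr fun n ↦ ?_
  rw [Real.sqrt_div (sq_nonneg _), Real.sqrt_sq_eq_abs]

section Poly

open Polynomial

variable {ι : Type*} [Fintype ι] {w : ι → ℕ → ℝ}

lemma norm_sum_coeff_le (w : ι → ℕ → ℝ) {Q : ι → ℂ[X]} {R : ℂ[X]} {D : ℕ}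
    (hQ : ∀ i n, D < n → (Q i).coeff n = 0) (hR : ∀ n, D < n → R.coeff n = 0)
    (h : ∀ p : ℕ, p.Prime →
      R.eval ((√p : ℝ) : ℂ) + ∑ i, (Q i).eval ((√p : ℝ) : ℂ) * (w i p : ℂ) = 0) :
    ∃ C : ℝ, 0 ≤ C ∧ ∃ c : ι → ℝ, (∀ i, 0 ≤ c i) ∧ ∀ p : ℕ, p.Prime →
      √p * ‖R.coeff D + ∑ i, (Q i).coeff D * (w i p : ℂ)‖ ≤ C + ∑ i, c i * |w i p| := by
  obtain ⟨C, hC0, hC⟩ := exists_norm_eval_sub_le R hR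
  choose c hc0 hc using fun i ↦ exists_norm_eval_sub_le (Q i) (hQ i)
  refine ⟨C, hC0, c, hc0, fun p hp ↦ ?_⟩
  have hx1 : 1 ≤ √(p : ℝ) := Real.one_le_sqrt.2 (by exact_mod_cast hp.one_le)
  have hpp := h p hp
  set x : ℝ := √p with hx
  have hx0 : 0 < x := by linarith
  have key : (R.coeff D + ∑ i, (Q i).coeff D * (w i p : ℂ)) * (x : ℂ) ^ D =
      -((R.eval (x : ℂ) - R.coeff D * (x : ℂ) ^ D) +
        ∑ i, ((Q i).eval (x : ℂ) - (Q i).coeff D * (x : ℂ) ^ D) * (w i p : ℂ)) := by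
    simp only [sub_mul, Finset.sum_sub_distrib, add_mul, Finset.sum_mul]
    have e : ∑ i, (Q i).coeff D * (w i p : ℂ) * (x : ℂ) ^ D =
        ∑ i, (Q i).coeff D * (x : ℂ) ^ D * (w i p : ℂ) :=
      Finset.sum_congr rfl fun i _ ↦ by ring
    rw [e]
    linear_combination hpp
  have hxD : 0 < x ^ D := by positivity
  refine le_of_mul_le_mul_right ?_ hxD
  have e1 : x * ‖R.coeff D + ∑ i, (Q i).coeff D * (w i p : ℂ)‖ * x ^ D =
      x * ‖(R.coeff D + ∑ i, (Q i).coeff D * (w i p : ℂ)) * (x : ℂ) ^ D‖ := by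
    rw [norm_mul, norm_pow, Complex.norm_real, Real.norm_of_nonneg hx0.le, mul_assoc]
  rw [e1, key, norm_neg, add_mul, Finset.sum_mul]
  refine (mul_le_mul_of_nonneg_left (norm_add_le _ _) hx0.le).trans ?_
  rw [mul_add]
  refine add_le_add (hC x hx1) ?_
  refine (mul_le_mul_of_nonneg_left (norm_sum_le _ _) hx0.le).trans ?_
  rw [Finset.mul_sum]
  refine Finset.sum_le_sum fun i _ ↦ ?_
  rw [norm_mul, Complex.norm_real, Real.norm_eq_abs, ← mul_assoc]
  calc _ ≤ c i * x ^ D * |w i p| := mul_le_mul_of_nonneg_right (hc i x hx1) (abs_nonneg _)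
    _ = _ := by ring

theorem HeckeFamily.polynomial_eq_zero (hw : HeckeFamily w) {Q : ι → ℂ[X]} {R : ℂ[X]}
    (hQ : ∀ i n, Even n → (Q i).coeff n = 0) (hR : ∀ n, Odd n → R.coeff n = 0)
    (h : ∀ p : ℕ, p.Prime →
      R.eval ((√p : ℝ) : ℂ) + ∑ i, (Q i).eval ((√p : ℝ) : ℂ) * (w i p : ℂ) = 0) (i : ι) :
    Q i = 0 := by
  by_contra hi
  let D := Finset.univ.sup fun i ↦ (Q i).natDegree
  have hQD (i : ι) (n : ℕ) (hn : D < n) : (Q i).coeff n = 0 :=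
    coeff_eq_zero_of_natDegree_lt
      ((Finset.le_sup (f := fun i ↦ (Q i).natDegree) (Finset.mem_univ i)).trans_lt hn)
  have hRD (n : ℕ) (hn : D ≤ n) : R.coeff n = 0 := by
    by_contra hRn
    have hnd : n ≤ R.natDegree := le_natDegree_of_ne_zero hRn
    have hlead : R.coeff R.natDegree ≠ 0 := by
      rw [coeff_natDegree, Ne, leadingCoeff_eq_zero]
      rintro rfl
      exact hRn (coeff_zero n)
    have hev : Even R.natDegree := by
      by_contra hodd
      exact hlead (hR _ (Nat.not_even_iff_odd.1 hodd))
    obtain ⟨C, -, c, -, hC⟩ := norm_sum_coeff_le w (D := R.natDegree)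
      (fun i m hm ↦ hQD i m (by omega)) (fun m hm ↦ coeff_eq_zero_of_natDegree_lt hm) h
    have hlim : Tendsto (fun p : ℕ ↦ C / √p + ∑ i, c i * (|w i p| / √p)) atTop (𝓝 0) := by
      have h1 : Tendsto (fun p : ℕ ↦ C / √p) atTop (𝓝 0) :=
        (Real.tendsto_sqrt_atTop.comp tendsto_natCast_atTop_atTop).const_div_atTop C
      simpa using h1.add (tendsto_finsetSum Finset.univ fun i _ ↦
        ((hw.seq i).tendsto_abs_div_sqrt.const_mul (c i)))
    obtain ⟨N, hN⟩ := eventually_atTop.1 (hlim.eventually_lt_const (norm_pos_iff.2 hlead))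
    obtain ⟨p, hpN, hp⟩ := Nat.exists_infinite_primes N
    have hx : 0 < √(p : ℝ) := Real.sqrt_pos.2 (by exact_mod_cast hp.pos)
    have h1 := hC p hp
    simp only [hQ _ _ hev, zero_mul, Finset.sum_const_zero, add_zero] at h1
    have h2 := mul_lt_mul_of_pos_left (hN p hpN) hx
    rw [mul_add, mul_div_cancel₀ _ hx.ne', Finset.mul_sum] at h2
    have h3 : ∑ i, √(p : ℝ) * (c i * (|w i p| / √p)) = ∑ i, c i * |w i p| :=
      Finset.sum_congr rfl fun i _ ↦ by field_simp
    linarith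
  obtain ⟨i₀, -, hi₀⟩ := Finset.exists_mem_eq_sup _ ⟨i, Finset.mem_univ i⟩ fun i ↦ (Q i).natDegree
  obtain ⟨C, hC0, c, hc0, hC⟩ := norm_sum_coeff_le w hQD (fun n hn ↦ hRD n hn.le) h
  have hz := hw.eq_zero_of_le (fun i ↦ (Q i).coeff D) (C := 2 * (C ^ 2 + ∑ i, c i ^ 2))
    (by positivity) fun p hp ↦ by
      have hp0 : (0 : ℝ) < p := by exact_mod_cast hp.pos
      have h1 := hC p hp
      rw [hRD D le_rfl, zero_add] at h1
      set N := ‖∑ i, (Q i).coeff D * (w i p : ℂ)‖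
      have h2 : (√p * N) ^ 2 ≤ (C + ∑ i, c i * |w i p|) ^ 2 := by gcongr
      have h3 := Finset.sum_mul_sq_le_sq_mul_sq Finset.univ c fun i ↦ |w i p|
      simp only [sq_abs] at h3
      rw [mul_pow, Real.sq_sqrt hp0.le] at h2
      rw [div_mul_eq_mul_div, le_div_iff₀ hp0]
      have h4 : 0 ≤ ∑ i, w i p ^ 2 := by positivity
      have h5 : 0 ≤ ∑ i, c i ^ 2 := by positivity
      nlinarith [sq_nonneg (C - ∑ i, c i * |w i p|), mul_nonneg (sq_nonneg C) h4]
  have hD0 : ∀ i, Q i = 0 ∨ (Q i).natDegree < D := fun i ↦ by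
    by_contra! hne
    refine hne.1 (leadingCoeff_eq_zero.1 ?_)
    rw [leadingCoeff, (hne.2.antisymm' (Finset.le_sup (f := fun i ↦ (Q i).natDegree)
      (Finset.mem_univ i)))]
    exact hz i
  rcases hD0 i₀ with h0 | h0
  · have hD : D = 0 := by simp [D, hi₀, h0]
    rcases hD0 i with h1 | h1
    · exact hi h1
    · omega
  · exact h0.ne hi₀.symm

end Poly

lemma CuspForm.exists_eq_of_eq_SL {k : ℤ} {Γ : Subgroup (GL (Fin 2) ℝ)} (h : Γ = 𝒮ℒ)
    (f : CuspForm Γ k) : ∃ g : CuspForm 𝒮ℒ k, ∀ z, g z = f z := by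
  subst h
  exact ⟨f, fun _ ↦ rfl⟩

lemma exists_cf_eq {k : ℤ} {f : CuspForm (CongruenceSubgroup.Gamma 1) k} {a : ℕ → ℂ}
    (h : CuspFormCoeffs k f a) : ∃ g : CuspForm 𝒮ℒ k, ∀ n, a n = cf g n := by
  obtain ⟨g, hg⟩ := CuspForm.exists_eq_of_eq_SL (by
    rw [CongruenceSubgroup.Gamma_one_top, ← MonoidHom.range_eq_map]) f
  refine ⟨g, fun n ↦ cf_unique (fun z ↦ ?_) n⟩
  rw [hg, (h.2 z).2]
  exact (h.2 z).1.hasSum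

lemma IsEigen.weight_pos {k : ℤ} {f : CuspForm 𝒮ℒ k} (hf : IsEigen f) : 0 < k := by
  by_contra! hk
  have := rank_zero_iff.1 (CuspForm.rank_eq_zero_of_weight_lt_twelve (k := k) (by omega))
  exact hf.ne_zero (Subsingleton.elim _ _)

lemma IsEigen.even_weight {k : ℤ} {f : CuspForm 𝒮ℒ k} (hf : IsEigen f) : Even k := by
  by_contra hk
  have h := ModularForm.levelOne_odd_weight_eq_zero (Int.not_even_iff_odd.1 hk)
    (ModularFormClass.modularForm f)
  refine hf.ne_zero (DFunLike.ext _ _ fun z ↦ ?_)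
  exact DFunLike.congr_fun h z

lemma cf_eq_sqrt_pow_mul_ev (f : EigenForm) {n : ℕ} (hn : n ≠ 0) :
    cf f.1.2 n = ((√n : ℝ) : ℂ) ^ (f.1.1 - 1).toNat * (ev f.1.2 n : ℂ) := by
  have hk : (((f.1.1 - 1).toNat : ℕ) : ℝ) = (f.1.1 : ℝ) - 1 := by
    have : (((f.1.1 - 1).toNat : ℕ) : ℤ) = f.1.1 - 1 := Int.toNat_of_nonneg (by linarith [f.2.1])
    exact_mod_cast congrArg (Int.cast : ℤ → ℝ) this
  have hn0 : (0 : ℝ) < n := by positivity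
  rw [f.2.2.ofReal_ev, lam, mul_left_comm, ← Complex.ofReal_pow, ← Complex.ofReal_mul]
  have : √(n : ℝ) ^ (f.1.1 - 1).toNat * (n : ℝ) ^ (-((f.1.1 : ℝ) - 1) / 2) = 1 := by
    rw [Real.sqrt_eq_rpow, ← Real.rpow_mul_natCast hn0.le, hk, ← Real.rpow_add hn0]
    ring_nf
    exact Real.rpow_zero _
  rw [this, Complex.ofReal_one, mul_one]

lemma exists_finsupp_of_isQuasiCuspCoeff {S : ℕ → ℂ} (hS : IsQuasiCuspCoeff S) :
    ∃ c : EigenForm × ℕ →₀ ℂ, ∀ n : ℕ, S n = c.sum fun x b ↦ b * ((n : ℂ) ^ x.2 *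
        cf x.1.1.2 n) := by
  obtain ⟨m, A, j, k, f, a, ha, hS0, hS⟩ := hS
  let v : EigenForm × ℕ → ℕ → ℂ := fun x n ↦ (n : ℂ) ^ x.2 * cf x.1.1.2 n
  have hmem (k : ℤ) (j : ℕ) (g : CuspForm 𝒮ℒ k) :
      (fun n : ℕ ↦ (n : ℂ) ^ j * cf g n) ∈ Submodule.span ℂ (Set.range v) := by
    let T : CuspForm 𝒮ℒ k →ₗ[ℂ] ℕ → ℂ := LinearMap.pi fun n ↦ (n : ℂ) ^ j • cfₗ k n
    have hg : g ∈ Submodule.span ℂ {f : CuspForm 𝒮ℒ k | IsEigen f} := by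
      rw [span_isEigen]
      trivial
    have hle : Submodule.span ℂ {f : CuspForm 𝒮ℒ k | IsEigen f} ≤
        (Submodule.span ℂ (Set.range v)).comap T := by
      refine Submodule.span_le.2 fun e he ↦ Submodule.subset_span ?_
      exact ⟨(⟨⟨k, e⟩, IsEigen.weight_pos he, he⟩, j), rfl⟩
    exact hle hg
  have hmemS : S ∈ Submodule.span ℂ (Set.range v) := by
    choose g hg using fun i ↦ exists_cf_eq (ha i)
    have : S = ∑ i, A i • fun n : ℕ ↦ (n : ℂ) ^ j i * cf (g i) n := by
      ext n
      rw [Finset.sum_apply]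
      rcases n.eq_zero_or_pos with rfl | hn
      · rw [hS0, Finset.sum_eq_zero fun i _ ↦ by simp [cf_zero]]
      · rw [hS n hn]
        exact Finset.sum_congr rfl fun i _ ↦ by simp [hg, mul_assoc]
    rw [this]
    exact Submodule.sum_mem _ fun i _ ↦ Submodule.smul_mem _ _ (hmem _ _ _)
  obtain ⟨c, hc⟩ := Finsupp.mem_span_range_iff_exists_finsupp.1 hmemS
  refine ⟨c, fun n ↦ ?_⟩
  rw [← hc, Finsupp.sum, Finset.sum_apply]
  rfl

open Polynomial in
lemma exists_polynomial_of_isQuasiCuspCoeff {S : ℕ → ℂ} (hS : IsQuasiCuspCoeff S) :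
    ∃ (F : Finset EigenForm) (Q : F → ℂ[X]), (∀ i n, Even n → (Q i).coeff n = 0) ∧
      ∀ n : ℕ, n ≠ 0 →
        S n = ∑ i, (Q i).eval ((√n : ℝ) : ℂ) * (ev i.1.1.2 n : ℂ) := by
  classical
  obtain ⟨c, hc⟩ := exists_finsupp_of_isQuasiCuspCoeff hS
  refine ⟨c.support.image Prod.fst, fun e ↦ ∑ x ∈ c.support with x.1 = e.1,
    monomial (2 * x.2 + (x.1.1.1 - 1).toNat) (c x), fun e n hn ↦ ?_, fun n hn ↦ ?_⟩
  · rw [finsetSum_coeff]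
    refine Finset.sum_eq_zero fun x _ ↦ ?_
    rw [coeff_monomial, if_neg]
    rintro rfl
    have h1 := x.1.2.2.even_weight
    have h2 := x.1.2.1
    rw [Int.even_iff] at h1
    rw [Nat.even_iff] at hn
    omega
  · rw [hc, Finsupp.sum, ← Finset.sum_fiberwise_of_maps_to
      (t := c.support.image Prod.fst) (fun x hx ↦ Finset.mem_image_of_mem _ hx),
          ← Finset.sum_coe_sort]
    refine Finset.sum_congr rfl fun e _ ↦ ?_
    rw [eval_finsetSum, Finset.sum_mul]
    refine Finset.sum_congr rfl fun x hx ↦ ?_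
    rw [← (Finset.mem_filter.1 hx).2, eval_monomial, cf_eq_sqrt_pow_mul_ev _ hn, pow_add, pow_mul,
      ← Complex.ofReal_pow √(n : ℝ) 2, Real.sq_sqrt (Nat.cast_nonneg n), Complex.ofReal_natCast]
    ring

open Polynomial in
lemma exists_polynomial_of_isQuasiEisCoeff {E : ℕ → ℂ} (hE : IsQuasiEisCoeff E) :
    ∃ R : ℂ[X], (∀ n, Odd n → R.coeff n = 0) ∧
      ∀ p : ℕ, p.Prime → E p = R.eval ((√p : ℝ) : ℂ) := by
  obtain ⟨s, α, -, -, h⟩ := hE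
  refine ⟨∑ x ∈ s, (monomial (2 * x.2) (α x) + monomial (2 * (x.2 + (x.1 - 1))) (α x)),
    fun n hn ↦ ?_, fun p hp ↦ ?_⟩
  · rw [finsetSum_coeff]
    refine Finset.sum_eq_zero fun x _ ↦ ?_
    rw [Nat.odd_iff] at hn
    rw [coeff_add, coeff_monomial, coeff_monomial, if_neg (by omega), if_neg (by omega), add_zero]
  · rw [h p hp.one_le, eval_finsetSum]
    refine Finset.sum_congr rfl fun x _ ↦ ?_
    have h2 : ((√p : ℝ) : ℂ) ^ 2 = p := by
      rw [← Complex.ofReal_pow, Real.sq_sqrt (Nat.cast_nonneg p), Complex.ofReal_natCast]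
    rw [eval_add, eval_monomial, eval_monomial, pow_mul, pow_mul, h2,
      ArithmeticFunction.sigma_apply, Nat.Prime.sum_divisors hp]
    push_cast
    ring

end QMF

/-- Ω̃ = 𝓔 ∩ Ω̃: a quasimodular form whose Fourier coefficients vanish at every prime is a
quasimodular Eisenstein series, i.e. its cuspidal part vanishes. -/
theorem prime_vanishing_is_eisenstein (c E S : ℕ → ℂ)
    (hE : IsQuasiEisCoeff E) (hS : IsQuasiCuspCoeff S)
    (hc : ∀ n, c n = E n + S n)
    (hvanish : ∀ p : ℕ, p.Prime → c p = 0) :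
    ∀ n, S n = 0 := by
  obtain ⟨F, Q, hQ, hSn⟩ := QMF.exists_polynomial_of_isQuasiCuspCoeff hS
  obtain ⟨R, hR, hEp⟩ := QMF.exists_polynomial_of_isQuasiEisCoeff hE
  have hz := (QMF.heckeFamily_eigenForm.comp (g := fun i : F ↦ i.1)
    Subtype.val_injective).polynomial_eq_zero hQ hR fun p hp ↦ by
      rw [← hEp p hp, ← hSn p hp.ne_zero, ← hc, hvanish p hp]
  intro n
  rcases eq_or_ne n 0 with rfl | hn
  · obtain ⟨m, A, j, k, f, a, ha, hS0, -⟩ := hS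
    exact hS0
  · rw [hSn n hn]
    exact Finset.sum_eq_zero fun i _ ↦ by rw [hz i, Polynomial.eval_zero, zero_mul]
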